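/- For every Liouville number α there exist a smooth measure-preserving diffeomorphism f of T² and a Borel probability measure ν on T² × ℙ(ℝ²) such that: (i) f lies in the C^∞-closure of the conjugates of the rotation R_α, i.e. for every k ∈ ℕ and every δ > 0 there is a smooth measure-preserving diffeomorphism h of T² with d_k(h ∘ R_α ∘ h⁻¹, f) < δ; (ii) f is weakly mixing with respect to μ; (iii) ν has marginal μ and absolutely continuous fibers, ν is invariant under the projectivized derivative extension (f, df), and (f, df) is weakly mixing with respect to ν. -/

import Mathlib

noncomputable section
open MeasureTheory Filter Set

/-- The circle `ℝ/ℤ`. -/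
abbrev T1 : Type := AddCircle (1 : ℝ)
/-- The 2-torus `ℝ²/ℤ²`. -/
abbrev T2 : Type := T1 × T1

/-- Canonical projection `ℝ² → T²`. -/
def pro (x : ℝ × ℝ) : T2 := ((x.1 : T1), (x.2 : T1))

/-- The rotation `R_t(θ, r) = (θ + t, r)` on the torus. -/
def rotT (t : ℝ) : T2 → T2 := fun x => (x.1 + (t : T1), x.2)

/-- Lift of the rotation `R_t` to `ℝ²`. -/
def rotL (t : ℝ) : ℝ × ℝ → ℝ × ℝ := fun x => (x.1 + t, x.2)

/-- `ℤ²`-equivariance of a map `ℝ² → ℝ²`. -/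
def Zper (F : ℝ × ℝ → ℝ × ℝ) : Prop :=
  ∀ (x : ℝ × ℝ) (m : ℤ × ℤ),
    F (x.1 + (m.1 : ℝ), x.2 + (m.2 : ℝ)) = ((F x).1 + (m.1 : ℝ), (F x).2 + (m.2 : ℝ))

/-- First partial derivative `∂/∂θ`. -/
def pd1 (f : ℝ × ℝ → ℝ) : ℝ × ℝ → ℝ := fun x => fderiv ℝ f x (1, 0)
/-- Second partial derivative `∂/∂r`. -/
def pd2 (f : ℝ × ℝ → ℝ) : ℝ × ℝ → ℝ := fun x => fderiv ℝ f x (0, 1)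
/-- Iterated partial derivative `∂^a` for a multi-index `a = (a₁, a₂)`. -/
def pdm (a : ℕ × ℕ) (f : ℝ × ℝ → ℝ) : ℝ × ℝ → ℝ := pd1^[a.1] (pd2^[a.2] f)

/-- The open fundamental domain `(0,1)²`. -/
def unitSq : Set (ℝ × ℝ) := Ioo (0 : ℝ) 1 ×ˢ Ioo (0 : ℝ) 1

/-- Sup norm over the fundamental domain `(0,1)²`. -/
def sup01 (f : ℝ × ℝ → ℝ) : ℝ := ⨆ x ∈ unitSq, |f x|

/-- Multi-indices `a` with `|a| ≤ k`. -/
def mIdx (k : ℕ) : Finset (ℕ × ℕ) :=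
  (Finset.range (k + 1) ×ˢ Finset.range (k + 1)).filter fun a => a.1 + a.2 ≤ k

lemma mIdx_nonempty (k : ℕ) : (mIdx k).Nonempty :=
  ⟨(0, 0), Finset.mem_filter.mpr ⟨Finset.mem_product.mpr
    ⟨Finset.mem_range.mpr (Nat.succ_pos k), Finset.mem_range.mpr (Nat.succ_pos k)⟩,
    Nat.zero_le k⟩⟩

/-- The norm `|||F|||_k`, computed from a lift `F` and a lift `Fi` of the inverse:
the maximum of the sup-norms of all partial derivatives of order `≤ k` of the
coordinate functions of `F` and of `Fi`. -/
def CkNorm (k : ℕ) (F Fi : ℝ × ℝ → ℝ × ℝ) : ℝ :=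
  (mIdx k).sup' (mIdx_nonempty k) fun a =>
    max (max (sup01 (pdm a fun x => (F x).1)) (sup01 (pdm a fun x => (F x).2)))
        (max (sup01 (pdm a fun x => (Fi x).1)) (sup01 (pdm a fun x => (Fi x).2)))

/-- The metric `d̃₀` computed on lifts. -/
def dt0 (F G : ℝ × ℝ → ℝ × ℝ) : ℝ :=
  max (⨅ p : ℤ, sup01 fun x => (F x).1 - (G x).1 + (p : ℝ))
      (⨅ p : ℤ, sup01 fun x => (F x).2 - (G x).2 + (p : ℝ))

/-- The metric `d̃_k` computed on lifts. -/
def dtk (k : ℕ) (F G : ℝ × ℝ → ℝ × ℝ) : ℝ :=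
  (mIdx k).sup' (mIdx_nonempty k) fun a =>
    if a.1 + a.2 = 0 then dt0 F G
    else max (sup01 (pdm a fun x => (F x).1 - (G x).1))
             (sup01 (pdm a fun x => (F x).2 - (G x).2))

/-- The metric `d_k`, computed on lifts `F, G` and lifts `Fi, Gi` of the inverses. -/
def dkDist (k : ℕ) (F Fi G Gi : ℝ × ℝ → ℝ × ℝ) : ℝ :=
  max (dtk k F G) (dtk k Fi Gi)

/-- A smooth measure-preserving diffeomorphism of `T²`: a volume-preserving bijection
which, together with its inverse, admits a `C^∞` lift `ℝ² → ℝ²` commuting with the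
`ℤ²`-action. -/
structure STD where
  toFun : T2 → T2
  invFun : T2 → T2
  lift : ℝ × ℝ → ℝ × ℝ
  liftInv : ℝ × ℝ → ℝ × ℝ
  left_inv : Function.LeftInverse invFun toFun
  right_inv : Function.RightInverse invFun toFun
  measurePres : MeasurePreserving toFun (volume : Measure T2) volume
  smooth : ContDiff ℝ (⊤ : ℕ∞) lift
  smoothInv : ContDiff ℝ (⊤ : ℕ∞) liftInv
  per : Zper lift
  perInv : Zper liftInv
  liftp : ∀ x : ℝ × ℝ, pro (lift x) = toFun (pro x)
  liftInvp : ∀ x : ℝ × ℝ, pro (liftInv x) = invFun (pro x)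

/-- Weak mixing of a transformation w.r.t. a measure. -/
def WeakMixing {X : Type*} [MeasurableSpace X] (ν : Measure X) (T : X → X) : Prop :=
  ∃ s : ℕ → ℕ, StrictMono s ∧ ∀ A B : Set X, MeasurableSet A → MeasurableSet B →
    Tendsto (fun n => ν (B ∩ (T^[s n]) ⁻¹' A)) atTop (nhds (ν A * ν B))

/-- The projectivization `ℙ(ℝ²)`. -/
abbrev PP := Projectivization ℝ (ℝ × ℝ)

instance : TopologicalSpace PP :=
  inferInstanceAs (TopologicalSpace (Quotient (projectivizationSetoid ℝ (ℝ × ℝ))))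

instance : MeasurableSpace PP := borel PP

/-- The direction of angle `t` as a point of `ℙ(ℝ²)`. -/
def circDir (t : ℝ) : PP := Projectivization.mk ℝ (Real.cos t, Real.sin t) (by
  intro h
  have h1 : Real.cos t = 0 := congrArg Prod.fst h
  have h2 : Real.sin t = 0 := congrArg Prod.snd h
  have h3 := Real.sin_sq_add_cos_sq t
  rw [h1, h2] at h3
  norm_num at h3)

/-- The pushforward to `ℙ(ℝ²)` of the Haar measure of the unit circle. -/
def circMeasure : Measure PP :=
  Measure.map circDir (volume.restrict (Set.Ico 0 (2 * Real.pi)))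

/-- `ν` has marginal `μ` (the Haar measure of `T²`) and absolutely continuous fibers:
its first marginal is `μ` and it disintegrates over `μ` with conditional measures on
`ℙ(ℝ²)` that are `μ`-a.e. absolutely continuous w.r.t. the pushforward to `ℙ(ℝ²)` of the
Haar measure of the unit circle. -/
def MarginalMuAbsCtsFibers (ν : Measure (T2 × PP)) : Prop :=
  ν.map Prod.fst = (volume : Measure T2) ∧
  ∃ c : T2 → Measure PP, (∀ x, IsProbabilityMeasure (c x)) ∧
    (∀ (A : Set T2) (B : Set PP), MeasurableSet A → MeasurableSet B →
      ν (A ×ˢ B) = ∫⁻ x in A, c x B ∂(volume : Measure T2)) ∧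
    (∀ᵐ x ∂(volume : Measure T2), c x ≪ circMeasure)

/-- `Df` is the projectivized derivative extension `(f, df)` of the diffeomorphism with
lift `F`: it sends `(x, [v])` to `(f(x), [DF(x̃)v])`. -/
def IsProjDerivExt (F : ℝ × ℝ → ℝ × ℝ) (f : T2 → T2) (Df : T2 × PP → T2 × PP) : Prop :=
  ∀ (a : ℝ × ℝ) (v : ℝ × ℝ) (hv : v ≠ 0) (hw : fderiv ℝ F a v ≠ 0),
    Df (pro a, Projectivization.mk ℝ v hv)
      = (f (pro a), Projectivization.mk ℝ (fderiv ℝ F a v) hw)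

noncomputable section
open MeasureTheory Filter Set

/-- Smooth lifts with inverse and unit Jacobian. -/
structure SL where
  F : ℝ × ℝ → ℝ × ℝ
  G : ℝ × ℝ → ℝ × ℝ
  sF : ContDiff ℝ (⊤ : ℕ∞) F
  sG : ContDiff ℝ (⊤ : ℕ∞) G
  pF : Zper F
  pG : Zper G
  FG : ∀ x, F (G x) = x
  GF : ∀ x, G (F x) = x
  dF : ∀ x, (fderiv ℝ F x).det = 1

namespace SL

lemma diffF (S : SL) (x) : DifferentiableAt ℝ S.F x :=
  (S.sF.differentiable (by simp)) x
lemma diffG (S : SL) (x) : DifferentiableAt ℝ S.G x :=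
  (S.sG.differentiable (by simp)) x

lemma DFG (S : SL) (x) :
    (fderiv ℝ S.F (S.G x)).comp (fderiv ℝ S.G x) = ContinuousLinearMap.id ℝ _ := by
  rw [← fderiv_comp x (S.diffF _) (S.diffG _)]
  have : S.F ∘ S.G = id := funext S.FG
  rw [this, fderiv_id]

lemma DGF (S : SL) (x) :
    (fderiv ℝ S.G (S.F x)).comp (fderiv ℝ S.F x) = ContinuousLinearMap.id ℝ _ := by
  rw [← fderiv_comp x (S.diffG _) (S.diffF _)]
  have : S.G ∘ S.F = id := funext S.GF
  rw [this, fderiv_id]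

lemma det_comp' (A B : ℝ × ℝ →L[ℝ] ℝ × ℝ) : (A.comp B).det = A.det * B.det := by
  simp [ContinuousLinearMap.det, LinearMap.det_comp]

def inv (S : SL) : SL where
  F := S.G
  G := S.F
  sF := S.sG
  sG := S.sF
  pF := S.pG
  pG := S.pF
  FG := S.GF
  GF := S.FG
  dF := fun x => by
    have h := congrArg ContinuousLinearMap.det (S.DFG x)
    rw [det_comp', S.dF, one_mul] at h
    rw [h]
    simp [ContinuousLinearMap.det]

def comp (S T : SL) : SL where
  F := S.F ∘ T.F
  G := T.G ∘ S.G
  sF := S.sF.comp T.sF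
  sG := T.sG.comp S.sG
  pF := fun x m => by rw [Function.comp_apply, T.pF x m, S.pF (T.F x) m]; rfl
  pG := fun x m => by rw [Function.comp_apply, S.pG x m, T.pG (S.G x) m]; rfl
  FG := fun x => by simp [T.FG, S.FG]
  GF := fun x => by simp [T.GF, S.GF]
  dF := fun x => by
    rw [fderiv_comp x (S.diffF _) (T.diffF _), det_comp', S.dF, T.dF, one_mul]

lemma rot_fderiv (t : ℝ) (x) : HasFDerivAt (rotL t) (ContinuousLinearMap.id ℝ (ℝ × ℝ)) x := by
  have : rotL t = fun x => x + (t, (0:ℝ)) := by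
    funext x; ext <;> simp [rotL]
  rw [this]
  exact (hasFDerivAt_id x).add_const _

def rot (t : ℝ) : SL where
  F := rotL t
  G := rotL (-t)
  sF := by unfold rotL; fun_prop
  sG := by unfold rotL; fun_prop
  pF := fun x m => by simp only [rotL]; ext <;> simp; ring
  pG := fun x m => by simp only [rotL]; ext <;> simp; ring
  FG := fun x => by simp [rotL]
  GF := fun x => by simp [rotL]
  dF := fun x => by rw [(rot_fderiv t x).fderiv]; simp [ContinuousLinearMap.det]

/-- `H R_t H⁻¹`. -/
def conj (H : SL) (t : ℝ) : SL := (H.comp (rot t)).comp H.inv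

end SL

lemma pro_eq {a b : ℝ × ℝ} :
    pro a = pro b ↔ ∃ m : ℤ × ℤ, b = (a.1 + (m.1 : ℝ), a.2 + (m.2 : ℝ)) := by
  have key : ∀ x y : ℝ, (x : T1) = (y : T1) ↔ ∃ n : ℤ, y = x + n := by
    intro x y
    rw [eq_comm, ← sub_eq_zero, ← AddCircle.coe_sub, AddCircle.coe_eq_zero_iff]
    constructor
    · rintro ⟨n, hn⟩; exact ⟨n, by simp at hn; linarith⟩
    · rintro ⟨n, hn⟩; exact ⟨n, by simp [hn]⟩
  unfold pro
  rw [Prod.mk.injEq, key, key]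
  constructor
  · rintro ⟨⟨n, hn⟩, k, hk⟩; exact ⟨(n, k), by ext <;> simp [hn, hk]⟩
  · rintro ⟨m, hm⟩; exact ⟨⟨m.1, by simp [hm]⟩, m.2, by simp [hm]⟩

def rep (x : T2) : ℝ × ℝ := (Quotient.out x.1, Quotient.out x.2)

lemma pro_rep (x : T2) : pro (rep x) = x := by
  unfold pro rep
  ext
  · exact Quotient.out_eq x.1
  · exact Quotient.out_eq x.2

lemma rep_pro (a : ℝ × ℝ) : ∃ m : ℤ × ℤ, rep (pro a) = (a.1 + (m.1 : ℝ), a.2 + (m.2 : ℝ)) :=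
  pro_eq.1 (pro_rep (pro a)).symm

lemma pro_surj (x : T2) : ∃ a, pro a = x := ⟨_, pro_rep x⟩

lemma continuous_pro : Continuous pro := by
  unfold pro
  exact ((AddCircle.continuous_mk' 1).comp continuous_fst).prodMk
    ((AddCircle.continuous_mk' 1).comp continuous_snd)

lemma fderiv_zper {F : ℝ × ℝ → ℝ × ℝ} (h : Zper F) (x : ℝ × ℝ) (m : ℤ × ℤ) :
    fderiv ℝ F (x.1 + (m.1 : ℝ), x.2 + (m.2 : ℝ)) = fderiv ℝ F x := by
  have h1 : (fun y => F (y + ((m.1 : ℝ), (m.2 : ℝ)))) = fun y => F y + ((m.1 : ℝ), (m.2 : ℝ)) := by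
    funext y; exact h y m
  have h2 := fderiv_comp_add_right (𝕜 := ℝ) (f := F) (x := x) ((m.1 : ℝ), (m.2 : ℝ))
  rw [h1, fderiv_add_const] at h2
  exact h2.symm

namespace SL

/-- Map induced on the torus. -/
def map (S : SL) (x : T2) : T2 := pro (S.F (rep x))

lemma map_pro (S : SL) (a) : S.map (pro a) = pro (S.F a) := by
  obtain ⟨m, hm⟩ := rep_pro a
  unfold map
  rw [hm, S.pF]
  exact (pro_eq.2 ⟨m, rfl⟩).symm

lemma map_inv (S : SL) (x) : S.inv.map (S.map x) = x := by
  obtain ⟨a, rfl⟩ := pro_surj x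
  rw [map_pro, map_pro]; simp [inv, S.GF]

lemma map_inv' (S : SL) (x) : S.map (S.inv.map x) = x := by
  obtain ⟨a, rfl⟩ := pro_surj x
  rw [map_pro, map_pro]; simp [inv, S.FG]

end SL

lemma isOpenQuot_pro : IsOpenQuotientMap pro := by
  have h1 : IsOpenQuotientMap ((↑) : ℝ → T1) := QuotientAddGroup.isOpenQuotientMap_mk
  exact h1.prodMap h1

namespace SL
lemma continuous_map (S : SL) : Continuous S.map := by
  rw [isOpenQuot_pro.isQuotientMap.continuous_iff]
  have : S.map ∘ pro = pro ∘ S.F := funext fun a => S.map_pro a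
  rw [this]
  exact continuous_pro.comp S.sF.continuous

/-- fundamental domain -/
def DD : Set (ℝ × ℝ) := Ioc (0:ℝ) (0+1) ×ˢ Ioc (0:ℝ) (0+1)

lemma mp_pro : MeasurePreserving pro (volume.restrict DD) (volume : Measure T2) := by
  have h := (AddCircle.measurePreserving_mk 1 0).prod (AddCircle.measurePreserving_mk 1 0)
  rw [Measure.prod_restrict] at h
  exact h

def Lat : AddSubgroup (ℝ × ℝ) :=
  (AddSubgroup.zmultiples (1:ℝ)).prod (AddSubgroup.zmultiples (1:ℝ))

lemma mem_Lat {g : ℝ × ℝ} : g ∈ Lat ↔ ∃ m : ℤ × ℤ, g = ((m.1 : ℝ), (m.2 : ℝ)) := by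
  unfold Lat
  rw [AddSubgroup.mem_prod, AddSubgroup.mem_zmultiples_iff, AddSubgroup.mem_zmultiples_iff]
  constructor
  · rintro ⟨⟨n, hn⟩, k, hk⟩; exact ⟨(n, k), by ext <;> simp [← hn, ← hk]⟩
  · rintro ⟨m, hm⟩; exact ⟨⟨m.1, by simp [hm]⟩, m.2, by simp [hm]⟩

instance : Countable Lat := by
  have : Function.Surjective (fun m : ℤ × ℤ => (⟨((m.1 : ℝ), (m.2 : ℝ)), mem_Lat.2 ⟨m, rfl⟩⟩ : Lat)) := by
    rintro ⟨g, hg⟩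
    obtain ⟨m, hm⟩ := mem_Lat.1 hg
    exact ⟨m, by simp [hm]⟩
  exact this.countable

lemma unique_int (y : ℝ) : ∃! n : ℤ, (n : ℝ) + y ∈ Ioc (0:ℝ) (0+1) := by
  have h := existsUnique_add_zsmul_mem_Ioc (one_pos : (0:ℝ) < 1) y 0
  simpa [add_comm] using h

lemma fd_DD (S : SL) : IsAddFundamentalDomain Lat (S.F '' DD) (volume : Measure (ℝ × ℝ)) := by
  have hm : MeasurableSet (S.F '' DD) := by
    have : S.F '' DD = S.G ⁻¹' DD := by
      ext x; constructor
      · rintro ⟨y, hy, rfl⟩; simpa [S.GF] using hy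
      · intro h; exact ⟨S.G x, h, S.FG x⟩
    rw [this]
    exact S.sG.continuous.measurable (measurableSet_Ioc.prod measurableSet_Ioc)
  refine IsAddFundamentalDomain.mk' hm.nullMeasurableSet ?_
  intro x
  obtain ⟨n, hn, hn'⟩ := unique_int (S.G x).1
  obtain ⟨k, hk, hk'⟩ := unique_int (S.G x).2
  have tr : ∀ m : ℤ × ℤ, S.G (((m.1:ℝ), (m.2:ℝ)) + x) = ((m.1:ℝ), (m.2:ℝ)) + S.G x := by
    intro m
    have := S.pG x m
    rw [show ((m.1:ℝ), (m.2:ℝ)) + x = (x.1 + (m.1:ℝ), x.2 + (m.2:ℝ)) by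
      ext <;> simp [add_comm], this]
    ext <;> simp [add_comm]
  refine ⟨⟨((n:ℝ), (k:ℝ)), mem_Lat.2 ⟨(n, k), rfl⟩⟩, ?_, ?_⟩
  · refine ⟨((n:ℝ), (k:ℝ)) + S.G x, ⟨hn, hk⟩, ?_⟩
    rw [← tr (n, k), S.FG]; rfl
  · rintro ⟨g, hg⟩ ⟨y, hy, hyx⟩
    obtain ⟨m, rfl⟩ := mem_Lat.1 hg
    have h2 : S.F y = ((m.1:ℝ), (m.2:ℝ)) + x := hyx
    have h3 : y = ((m.1:ℝ), (m.2:ℝ)) + S.G x := by rw [← tr m, ← h2, S.GF]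
    rw [h3] at hy
    have e1 := hn' m.1 hy.1
    have e2 := hk' m.2 hy.2
    simp [e1, e2]

lemma mp_map (S : SL) : MeasurePreserving S.map (volume : Measure T2) volume := by
  refine ⟨S.continuous_map.measurable, ?_⟩
  ext A hA
  rw [Measure.map_apply S.continuous_map.measurable hA]
  have hD : MeasurableSet DD := measurableSet_Ioc.prod measurableSet_Ioc
  have e : ∀ B : Set T2, MeasurableSet B → volume B = volume (pro ⁻¹' B ∩ DD) := by
    intro B hB
    rw [← mp_pro.measure_preimage hB.nullMeasurableSet,
      Measure.restrict_apply (continuous_pro.measurable hB)]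
  rw [e _ hA, e _ (S.continuous_map.measurable hA)]
  have h1 : pro ⁻¹' (S.map ⁻¹' A) = S.F ⁻¹' (pro ⁻¹' A) := by
    ext x; simp [S.map_pro]
  have hA' : MeasurableSet (pro ⁻¹' A) := continuous_pro.measurable hA
  have hms : MeasurableSet (S.F ⁻¹' (pro ⁻¹' A) ∩ DD) :=
    (S.sF.continuous.measurable hA').inter hD
  have h2 := lintegral_abs_det_fderiv_eq_addHaar_image volume hms
    (fun x _ => (S.diffF x).hasFDerivAt.hasFDerivWithinAt)
    (Function.LeftInverse.injective S.GF).injOn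
  simp only [S.dF, abs_one, ENNReal.ofReal_one, lintegral_one, Measure.restrict_apply,
    MeasurableSet.univ, univ_inter] at h2
  rw [h1, h2, image_preimage_inter]
  have h3 := IsAddFundamentalDomain.measure_set_eq (S.fd_DD) ((rot 0).fd_DD) hA' (by
    rintro ⟨g, hg⟩
    obtain ⟨m, rfl⟩ := mem_Lat.1 hg
    ext x
    have : pro x = pro (((m.1:ℝ), (m.2:ℝ)) + x) := pro_eq.2 ⟨m, by ext <;> simp [add_comm]⟩
    show pro (((m.1:ℝ), (m.2:ℝ)) + x) ∈ A ↔ pro x ∈ A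
    rw [this])
  rw [h3]
  congr 2
  have : (rot 0).F = id := by funext x; simp [rot, rotL]
  rw [this, image_id]

def toSTD (S : SL) : STD where
  toFun := S.map
  invFun := S.inv.map
  lift := S.F
  liftInv := S.G
  left_inv := S.map_inv
  right_inv := S.map_inv'
  measurePres := S.mp_map
  smooth := S.sF
  smoothInv := S.sG
  per := S.pF
  perInv := S.pG
  liftp := fun x => (S.map_pro x).symm
  liftInvp := fun x => (S.inv.map_pro x).symm

end SL
end

noncomputable section
open MeasureTheory Filter Set

abbrev XX : Type := T2 × PP

def cz (v : ℝ × ℝ) : ℂ := ⟨v.1, v.2⟩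

lemma cz_ne {v : ℝ × ℝ} (h : v ≠ 0) : cz v ≠ 0 := by
  intro h'
  apply h
  have h1 := congrArg Complex.re h'
  have h2 := congrArg Complex.im h'
  exact Prod.ext h1 h2

lemma cz_smul (c : ℝ) (v : ℝ × ℝ) : cz (c • v) = c * cz v := by
  apply Complex.ext <;> simp [cz]

lemma cz_sub (v w : ℝ × ℝ) : cz (v - w) = cz v - cz w := by
  apply Complex.ext <;> simp [cz]

lemma continuous_cz : Continuous cz := by
  have : cz = fun v : ℝ × ℝ => (v.1 : ℂ) + v.2 * Complex.I := by
    funext v; apply Complex.ext <;> simp [cz]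
  rw [this]
  fun_prop

lemma norm_cz_le (v : ℝ × ℝ) : ‖cz v‖ ≤ 2 * ‖v‖ := by
  have h := Complex.norm_le_abs_re_add_abs_im (cz v)
  have h1 : |v.1| ≤ ‖v‖ := norm_fst_le v
  have h2 : |v.2| ≤ ‖v‖ := norm_snd_le v
  simp only [cz] at h ⊢
  linarith

lemma le_norm_cz (v : ℝ × ℝ) : ‖v‖ ≤ ‖cz v‖ := by
  have h1 := Complex.abs_re_le_norm (cz v)
  have h2 := Complex.abs_im_le_norm (cz v)
  exact max_le h1 h2

def chiV (v : ℝ × ℝ) : ℂ := (cz v / (‖cz v‖ : ℂ)) ^ 2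

lemma norm_chiV {v : ℝ × ℝ} (h : v ≠ 0) : ‖chiV v‖ = 1 := by
  have := norm_ne_zero_iff.2 (cz_ne h)
  simp [chiV, this]

lemma mkV_rel {v w : {v : ℝ × ℝ // v ≠ 0}} :
    (projectivizationSetoid ℝ (ℝ × ℝ)) v w ↔ ∃ c : ℝ, c ≠ 0 ∧ c • w.1 = v.1 := by
  constructor
  · rintro ⟨c, hc⟩; exact ⟨c, c.ne_zero, hc⟩
  · rintro ⟨c, h0, hc⟩; exact ⟨Units.mk0 c h0, hc⟩

def chi (p : PP) : ℂ := Quotient.lift (fun v : {v : ℝ × ℝ // v ≠ 0} => chiV v.1) (by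
  intro v w h
  obtain ⟨c, h0, hc⟩ := mkV_rel.1 h
  have hn : (‖cz w.1‖ : ℂ) ≠ 0 := by exact_mod_cast norm_ne_zero_iff.2 (cz_ne w.2)
  have h1 : ((|c| : ℝ) : ℂ) ≠ 0 := by exact_mod_cast abs_ne_zero.2 h0
  have h2 : ((|c| : ℝ) : ℂ) ^ 2 = (c : ℂ) ^ 2 := by exact_mod_cast sq_abs c
  simp only [chiV]
  rw [← hc, cz_smul]
  simp only [norm_mul, Complex.norm_real, Real.norm_eq_abs, Complex.ofReal_mul]
  rw [div_pow, div_pow, mul_pow, mul_pow, h2]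
  have h3 : (c : ℂ) ≠ 0 := by exact_mod_cast h0
  field_simp) p

lemma chi_mk (v : ℝ × ℝ) (h : v ≠ 0) : chi (Projectivization.mk ℝ v h) = chiV v := rfl

lemma norm_chi (p : PP) : ‖chi p‖ = 1 := by
  induction p using Projectivization.ind with
  | h v hv => rw [chi_mk, norm_chiV hv]

lemma continuous_mkP : Continuous (fun v : {v : ℝ × ℝ // v ≠ 0} => Projectivization.mk ℝ v.1 v.2) :=
  continuous_quotient_mk'

lemma continuousAt_chiV {v : ℝ × ℝ} (h : v ≠ 0) : ContinuousAt chiV v := by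
  unfold chiV
  have h0 : (‖cz v‖ : ℂ) ≠ 0 := by exact_mod_cast norm_ne_zero_iff.2 (cz_ne h)
  have h1 := continuous_cz
  refine ContinuousAt.pow (ContinuousAt.div h1.continuousAt ?_ h0) 2
  exact (Complex.continuous_ofReal.comp h1.norm).continuousAt

lemma continuous_chi : Continuous chi := by
  refine Continuous.quotient_lift ?_ _
  rw [continuous_iff_continuousAt]
  intro v
  exact (continuousAt_chiV v.2).comp continuous_subtype_val.continuousAt

lemma chi_inj : Function.Injective chi := by
  intro p p' h
  induction p using Projectivization.ind with
  | h v hv =>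
  induction p' using Projectivization.ind with
  | h w hw =>
  rw [chi_mk, chi_mk] at h
  have hv0 : (‖cz v‖ : ℂ) ≠ 0 := by exact_mod_cast norm_ne_zero_iff.2 (cz_ne hv)
  have hw0 : (‖cz w‖ : ℂ) ≠ 0 := by exact_mod_cast norm_ne_zero_iff.2 (cz_ne hw)
  rw [Projectivization.mk_eq_mk_iff']
  unfold chiV at h
  rcases sq_eq_sq_iff_eq_or_eq_neg.1 h with h | h
  · refine ⟨‖cz v‖ / ‖cz w‖, ?_⟩
    have : cz v = ((‖cz v‖ / ‖cz w‖ : ℝ) : ℂ) * cz w := by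
      push_cast; field_simp at h ⊢; linear_combination h
    rw [← cz_smul] at this
    exact Prod.ext (congrArg Complex.re this).symm (congrArg Complex.im this).symm
  · refine ⟨-(‖cz v‖ / ‖cz w‖), ?_⟩
    have : cz v = ((-(‖cz v‖ / ‖cz w‖) : ℝ) : ℂ) * cz w := by
      push_cast; field_simp at h ⊢; linear_combination h
    rw [← cz_smul] at this
    exact Prod.ext (congrArg Complex.re this).symm (congrArg Complex.im this).symm

lemma cs_ne (t : ℝ) : ((Real.cos t, Real.sin t) : ℝ × ℝ) ≠ 0 := by
  intro h
  have h1 : Real.cos t = 0 := congrArg Prod.fst h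
  have h2 : Real.sin t = 0 := congrArg Prod.snd h
  have h3 := Real.sin_sq_add_cos_sq t
  rw [h1, h2] at h3
  norm_num at h3

lemma circDir_eq (t : ℝ) : circDir t = Projectivization.mk ℝ (Real.cos t, Real.sin t) (cs_ne t) := rfl

lemma continuous_circDir : Continuous circDir :=
  continuous_mkP.comp (f := fun t : ℝ => (⟨(Real.cos t, Real.sin t), cs_ne t⟩ : {v : ℝ × ℝ // v ≠ 0}))
    ((Real.continuous_cos.prodMk Real.continuous_sin).subtype_mk _)

instance : CompactSpace PP := by
  have h : circDir '' Icc (-Real.pi) Real.pi = univ := by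
    rw [eq_univ_iff_forall]
    intro p
    induction p using Projectivization.ind with
    | h v hv =>
    refine ⟨Complex.arg (cz v), ⟨(Complex.neg_pi_lt_arg _).le, Complex.arg_le_pi _⟩, ?_⟩
    rw [circDir_eq, Projectivization.mk_eq_mk_iff']
    have hn := norm_ne_zero_iff.2 (cz_ne hv)
    refine ⟨‖cz v‖⁻¹, ?_⟩
    ext
    · show ‖cz v‖⁻¹ * v.1 = Real.cos (Complex.arg (cz v))
      rw [Complex.cos_arg (cz_ne hv)]
      show ‖cz v‖⁻¹ * v.1 = v.1 / ‖cz v‖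
      ring
    · simp [Complex.sin_arg, cz]; field_simp
  exact ⟨h ▸ isCompact_Icc.image continuous_circDir⟩

instance : T2Space PP := T2Space.of_injective_continuous chi_inj continuous_chi

lemma chi_emb : Topology.IsClosedEmbedding chi := continuous_chi.isClosedEmbedding chi_inj

instance : SecondCountableTopology PP := chi_emb.isEmbedding.secondCountableTopology
instance : PolishSpace PP := chi_emb.polishSpace
instance : BorelSpace PP := ⟨rfl⟩
instance : Nonempty PP := ⟨circDir 0⟩

lemma isOpenQuot_mkP :
    IsOpenQuotientMap (fun v : {v : ℝ × ℝ // v ≠ 0} => Projectivization.mk ℝ v.1 v.2) := by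
  refine ⟨?_, continuous_mkP, ?_⟩
  · intro p
    induction p using Projectivization.ind with
    | h v hv => exact ⟨⟨v, hv⟩, rfl⟩
  · intro U hU
    have hq : IsOpen ((fun v : {v : ℝ × ℝ // v ≠ 0} => Projectivization.mk ℝ v.1 v.2) ⁻¹'
        ((fun v : {v : ℝ × ℝ // v ≠ 0} => Projectivization.mk ℝ v.1 v.2) '' U)) := by
      have : ((fun v : {v : ℝ × ℝ // v ≠ 0} => Projectivization.mk ℝ v.1 v.2) ⁻¹'
        ((fun v : {v : ℝ × ℝ // v ≠ 0} => Projectivization.mk ℝ v.1 v.2) '' U)) =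
        ⋃ c : {c : ℝ // c ≠ 0}, (fun v : {v : ℝ × ℝ // v ≠ 0} =>
          (⟨c.1 • v.1, smul_ne_zero c.2 v.2⟩ : {v : ℝ × ℝ // v ≠ 0})) ⁻¹' U := by
        ext v
        simp only [mem_preimage, mem_image, mem_iUnion]
        constructor
        · rintro ⟨u, hu, h⟩
          rw [Projectivization.mk_eq_mk_iff'] at h
          obtain ⟨c, hc⟩ := h
          have hc0 : c ≠ 0 := by rintro rfl; exact u.2 (by simpa using hc.symm)
          refine ⟨⟨c, hc0⟩, ?_⟩
          convert hu
        · rintro ⟨c, hc⟩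
          refine ⟨_, hc, ?_⟩
          rw [Projectivization.mk_eq_mk_iff']
          exact ⟨c.1, rfl⟩
      rw [this]
      refine isOpen_iUnion fun c => hU.preimage ?_
      exact (continuous_subtype_val.const_smul c.1).subtype_mk _
    exact hq

namespace SL

lemma inj_D (S : SL) (a) : Function.Injective (fderiv ℝ S.F a) := by
  intro v w h
  have h1 := fun u => congrArg (fun L => L u) (S.DGF a)
  simp only [ContinuousLinearMap.comp_apply, ContinuousLinearMap.id_apply] at h1
  rw [← h1 v, ← h1 w, h]

lemma D_ne (S : SL) (a) {v : ℝ × ℝ} (h : v ≠ 0) : fderiv ℝ S.F a v ≠ 0 := by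
  intro h'
  exact h (S.inj_D a (by rw [h', map_zero]))

/-- projectivized derivative extension -/
def ext (S : SL) (y : XX) : XX :=
  (S.map y.1, Projectivization.map (fderiv ℝ S.F (rep y.1)).toLinearMap (S.inj_D _) y.2)

lemma ext_mk (S : SL) (a v) (hv : v ≠ 0) : S.ext (pro a, Projectivization.mk ℝ v hv) =
    (pro (S.F a), Projectivization.mk ℝ (fderiv ℝ S.F a v) (S.D_ne a hv)) := by
  obtain ⟨m, hm⟩ := rep_pro a
  unfold ext
  have h : fderiv ℝ S.F (rep (pro a)) = fderiv ℝ S.F a := by rw [hm, fderiv_zper S.pF]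
  refine Prod.ext (S.map_pro a) ?_
  simp only [Projectivization.map_mk]
  simp [h]

lemma XX_ind {P : XX → Prop} (h : ∀ a v (hv : v ≠ 0), P (pro a, Projectivization.mk ℝ v hv)) (y) :
    P y := by
  obtain ⟨x, p⟩ := y
  obtain ⟨a, rfl⟩ := pro_surj x
  induction p using Projectivization.ind with
  | h v hv => exact h a v hv

lemma ext_comp (S T : SL) (y) : (S.comp T).ext y = S.ext (T.ext y) := by
  induction y using XX_ind with
  | h a v hv =>
  rw [ext_mk, ext_mk, ext_mk]
  have : fderiv ℝ (S.comp T).F a = (fderiv ℝ S.F (T.F a)).comp (fderiv ℝ T.F a) :=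
    fderiv_comp a (S.diffF _) (T.diffF _)
  simp only [this]
  rfl

lemma ext_congr {S T : SL} (h : ∀ a, pro (S.F a) = pro (T.F a))
    (hd : ∀ a, fderiv ℝ S.F a = fderiv ℝ T.F a) (y) : S.ext y = T.ext y := by
  induction y using XX_ind with
  | h a v hv =>
  rw [ext_mk, ext_mk]
  simp only [hd, h]

lemma ext_congr' {S T : SL} (h : S.F = T.F) (y) : S.ext y = T.ext y :=
  ext_congr (fun a => by rw [h]) (fun a => by rw [h]) y

lemma ext_rot (t : ℝ) (y : XX) : (rot t).ext y = ((y.1.1 + (t : T1), y.1.2), y.2) := by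
  induction y using XX_ind with
  | h a v hv =>
  rw [ext_mk]
  have : fderiv ℝ (rot t).F a = ContinuousLinearMap.id ℝ _ := (rot_fderiv t a).fderiv
  simp only [this]
  simp [rot, rotL, pro]

lemma ext_inv (S : SL) (y) : S.inv.ext (S.ext y) = y := by
  rw [← ext_comp]
  have h : (S.inv.comp S).F = (rot 0).F := by
    funext x; simp [comp, inv, rot, rotL, S.GF]
  rw [ext_congr' h, ext_rot]
  simp

lemma ext_inv' (S : SL) (y) : S.ext (S.inv.ext y) = y := ext_inv S.inv y

lemma continuous_ext (S : SL) : Continuous S.ext := by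
  have hq := isOpenQuot_pro.prodMap isOpenQuot_mkP
  rw [hq.isQuotientMap.continuous_iff]
  have : S.ext ∘ Prod.map pro (fun v : {v : ℝ × ℝ // v ≠ 0} => Projectivization.mk ℝ v.1 v.2) =
    fun z => (pro (S.F z.1), Projectivization.mk ℝ (fderiv ℝ S.F z.1 z.2.1) (S.D_ne z.1 z.2.2)) := by
    funext z
    exact S.ext_mk z.1 z.2.1 z.2.2
  rw [this]
  refine (continuous_pro.comp (S.sF.continuous.comp continuous_fst)).prodMk ?_
  refine continuous_mkP.comp (f := fun z : (ℝ × ℝ) × {v : ℝ × ℝ // v ≠ 0} =>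
    (⟨fderiv ℝ S.F z.1 z.2.1, S.D_ne z.1 z.2.2⟩ : {v : ℝ × ℝ // v ≠ 0})) ?_
  refine Continuous.subtype_mk ?_ _
  exact ((S.sF.continuous_fderiv (by simp)).comp continuous_fst).clm_apply
    (continuous_subtype_val.comp continuous_snd)

end SL
end

noncomputable section
open MeasureTheory Filter Set
open scoped Pointwise

abbrev CL := ℝ × ℝ →L[ℝ] ℝ × ℝ

def ball0 : Set (ℝ × ℝ) := {v | v.1 ^ 2 + v.2 ^ 2 < 1}

lemma meas_ball0 : MeasurableSet ball0 := by
  apply IsOpen.measurableSet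
  exact isOpen_lt (by fun_prop) continuous_const

lemma ball0_pos : volume ball0 ≠ 0 := by
  have h : IsOpen ball0 := isOpen_lt (by fun_prop) continuous_const
  exact (h.measure_pos volume ⟨0, by simp [ball0]⟩).ne'

lemma ball0_fin : volume ball0 ≠ ⊤ := by
  have : ball0 ⊆ Metric.closedBall 0 1 := by
    intro v hv
    have hv : v.1 ^ 2 + v.2 ^ 2 < 1 := hv
    rw [mem_closedBall_zero_iff]
    refine max_le ?_ ?_
    · exact abs_le_one_iff_mul_self_le_one.2 (by nlinarith [sq_nonneg v.2])
    · exact abs_le_one_iff_mul_self_le_one.2 (by nlinarith [sq_nonneg v.1])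
  exact ((measure_mono this).trans_lt measure_closedBall_lt_top).ne

open Classical in
def toP (v : ℝ × ℝ) : PP := if h : v ≠ 0 then Projectivization.mk ℝ v h else circDir 0

lemma toP_mk {v : ℝ × ℝ} (h : v ≠ 0) : toP v = Projectivization.mk ℝ v h := by simp [toP, h]

lemma meas_toP : Measurable toP := by
  apply measurable_of_measurable_on_compl_singleton (0 : ℝ × ℝ)
  have : ({(0 : ℝ × ℝ)}ᶜ : Set _).domRestrict toP =
      (fun v : {v : ℝ × ℝ // v ≠ 0} => Projectivization.mk ℝ v.1 v.2) := by
    funext v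
    exact toP_mk v.2
  have h2 : Continuous (({(0 : ℝ × ℝ)}ᶜ : Set _).domRestrict toP) := by
    rw [this]; exact continuous_mkP
  exact h2.measurable

def lam : Measure PP := (volume ball0)⁻¹ • (volume.restrict ball0).map toP

instance : IsProbabilityMeasure lam := by
  constructor
  rw [lam, Measure.smul_apply, Measure.map_apply meas_toP MeasurableSet.univ]
  simp [ENNReal.inv_mul_cancel ball0_pos ball0_fin]

lemma toP_smul {c : ℝ} (hc : c ≠ 0) (v : ℝ × ℝ) : toP (c • v) = toP v := by
  by_cases hv : v = 0
  · simp [hv]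
  · rw [toP_mk hv, toP_mk (smul_ne_zero hc hv), Projectivization.mk_eq_mk_iff']
    exact ⟨c, rfl⟩

lemma lam_null {N : Set PP} (hN : MeasurableSet N) : lam N = 0 ↔ volume (toP ⁻¹' N) = 0 := by
  rw [lam, Measure.smul_apply, Measure.map_apply meas_toP hN, Measure.restrict_apply (meas_toP hN)]
  have h0 : (volume ball0)⁻¹ ≠ 0 := ENNReal.inv_ne_zero.2 ball0_fin
  simp only [smul_eq_mul, mul_eq_zero, h0, false_or]
  constructor
  · intro h
    have hsub : toP ⁻¹' N ⊆ ⋃ k : ℕ, ((k : ℝ) + 1) • (toP ⁻¹' N ∩ ball0) := by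
      intro v hv
      obtain ⟨k, hk⟩ := exists_nat_gt (v.1 ^ 2 + v.2 ^ 2)
      have hk0 : (0 : ℝ) < (k : ℝ) + 1 := by positivity
      refine mem_iUnion.2 ⟨k, ?_⟩
      rw [mem_smul_set_iff_inv_smul_mem₀ hk0.ne']
      refine ⟨?_, ?_⟩
      · rw [mem_preimage, toP_smul (inv_ne_zero hk0.ne')]; exact hv
      · show (((k : ℝ) + 1)⁻¹ * v.1) ^ 2 + (((k : ℝ) + 1)⁻¹ * v.2) ^ 2 < 1
        rw [mul_pow, mul_pow, ← mul_add, inv_pow, inv_mul_lt_iff₀ (by positivity)]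
        nlinarith [(Nat.cast_nonneg k : (0:ℝ) ≤ k)]
    refine measure_mono_null hsub (measure_iUnion_null fun k => ?_)
    rw [Measure.addHaar_smul, h, mul_zero]
  · intro h
    exact measure_mono_null inter_subset_left h

def Pm (A : CL) (h : Function.Injective A) : PP → PP := Projectivization.map A.toLinearMap h

lemma Pm_mk (A : CL) (h : Function.Injective A) {v : ℝ × ℝ} (hv : v ≠ 0) (hw : A v ≠ 0) :
    Pm A h (Projectivization.mk ℝ v hv) = Projectivization.mk ℝ (A v) hw := rfl

lemma inj_ne {A : CL} (h : Function.Injective A) {v : ℝ × ℝ} (hv : v ≠ 0) : A v ≠ 0 :=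
  fun h' => hv (h (by rw [h', map_zero]))

lemma Pm_toP (A : CL) (h : Function.Injective A) {v : ℝ × ℝ} (hv : v ≠ 0) :
    toP (A v) = Pm A h (toP v) := by
  rw [toP_mk hv, toP_mk (inj_ne h hv), Pm_mk A h hv]

lemma cont_Pm (A : CL) (h : Function.Injective A) : Continuous (Pm A h) := by
  rw [isOpenQuot_mkP.isQuotientMap.continuous_iff]
  have : Pm A h ∘ (fun v : {v : ℝ × ℝ // v ≠ 0} => Projectivization.mk ℝ v.1 v.2) =
      fun v => Projectivization.mk ℝ (A v.1) (inj_ne h v.2) := by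
    funext v; rfl
  rw [this]
  refine continuous_mkP.comp (f := fun v : {v : ℝ × ℝ // v ≠ 0} =>
    (⟨A v.1, inj_ne h v.2⟩ : {v : ℝ × ℝ // v ≠ 0})) ?_
  exact (A.continuous.comp continuous_subtype_val).subtype_mk _

lemma inj_det {A : CL} (h : Function.Injective A) : LinearMap.det A.toLinearMap ≠ 0 := by
  intro h0
  have h1 := LinearMap.bot_lt_ker_of_det_eq_zero h0
  rw [LinearMap.ker_eq_bot.2 h] at h1
  exact lt_irrefl _ h1

lemma lam_quasi (A : CL) (h : Function.Injective A) {N : Set PP} (hN : MeasurableSet N)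
    (h0 : lam N = 0) : lam (Pm A h ⁻¹' N) = 0 := by
  rw [lam_null ((cont_Pm A h).measurable hN)]
  rw [lam_null hN] at h0
  have h1 : volume (A.toLinearMap ⁻¹' (toP ⁻¹' N)) = 0 := by
    rw [Measure.addHaar_preimage_linearMap _ (inj_det h), h0, mul_zero]
  refine measure_mono_null (t := A.toLinearMap ⁻¹' (toP ⁻¹' N) ∪ {0}) ?_ ?_
  · intro v hv
    by_cases hv0 : v = 0
    · right; exact hv0
    · left
      show toP (A v) ∈ N
      rw [Pm_toP A h hv0]; exact hv
  · exact measure_union_null h1 (measure_singleton _)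

lemma lam_inv (A : CL) (h : Function.Injective A) (hd : A.det = 1)
    (hb : ∀ v, A v ∈ ball0 ↔ v ∈ ball0) : MeasurePreserving (Pm A h) lam lam := by
  refine ⟨(cont_Pm A h).measurable, ?_⟩
  ext N hN
  rw [Measure.map_apply (cont_Pm A h).measurable hN]
  simp only [lam, Measure.smul_apply]
  congr 1
  rw [Measure.map_apply meas_toP hN, Measure.map_apply meas_toP ((cont_Pm A h).measurable hN),
    Measure.restrict_apply (meas_toP hN),
    Measure.restrict_apply (meas_toP ((cont_Pm A h).measurable hN))]
  have h1 : volume (A.toLinearMap ⁻¹' (toP ⁻¹' N ∩ ball0)) = volume (toP ⁻¹' N ∩ ball0) := by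
    rw [Measure.addHaar_preimage_linearMap _ (inj_det h)]
    have : LinearMap.det A.toLinearMap = 1 := hd
    simp [this]
  rw [← h1]
  apply measure_congr
  have hz : ∀ᵐ v : ℝ × ℝ, v ≠ 0 := by
    rw [ae_iff]; simp
  filter_upwards [hz] with v hv
  apply propext
  show (Pm A h (toP v) ∈ N ∧ v ∈ ball0) ↔ (toP (A v) ∈ N ∧ A v ∈ ball0)
  rw [Pm_toP A h hv, hb]

lemma circDir_add_pi (t : ℝ) : circDir (t + Real.pi) = circDir t := by
  rw [circDir_eq, circDir_eq, Projectivization.mk_eq_mk_iff']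
  refine ⟨-1, ?_⟩
  ext <;> simp

lemma lam_ac : lam ≪ circMeasure := by
  refine Measure.AbsolutelyContinuous.mk fun N hN h => ?_
  rw [lam_null hN]
  rw [circMeasure, Measure.map_apply continuous_circDir.measurable hN,
    Measure.restrict_apply (continuous_circDir.measurable hN)] at h
  have hm : MeasurableSet (circDir ⁻¹' N) := continuous_circDir.measurable hN
  have h2 : volume (circDir ⁻¹' N ∩ Ioo (-Real.pi) Real.pi) = 0 := by
    refine measure_mono_null (t := (circDir ⁻¹' N ∩ Ico 0 (2 * Real.pi)) ∪
      (fun t => t + Real.pi) ⁻¹' (circDir ⁻¹' N ∩ Ico 0 (2 * Real.pi))) ?_ ?_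
    · rintro t ⟨ht, h1, h2⟩
      by_cases h0 : 0 ≤ t
      · left; exact ⟨ht, h0, by linarith [Real.pi_pos]⟩
      · right
        refine ⟨?_, by show 0 ≤ t + Real.pi; linarith, by show t + Real.pi < _; linarith⟩
        show circDir (t + Real.pi) ∈ N
        rw [circDir_add_pi]; exact ht
    · refine measure_union_null h ?_
      rw [measure_preimage_add_right]; exact h
  rw [← lintegral_indicator_one (meas_toP hN), ← lintegral_comp_polarCoord_symm]
  refine (setLIntegral_congr_fun (g := fun p => (ENNReal.ofReal p.1) * (circDir ⁻¹' N).indicator 1 p.2)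
    polarCoord.open_target.measurableSet ?_).trans ?_
  · rintro ⟨r, t⟩ hp
    have hr : 0 < r := hp.1
    simp only [smul_eq_mul]
    congr 1
    have : toP (polarCoord.symm (r, t)) = circDir t := by
      have : polarCoord.symm (r, t) = r • ((Real.cos t, Real.sin t) : ℝ × ℝ) := by
        simp [polarCoord]
      rw [this, toP_smul hr.ne', toP_mk (cs_ne t), circDir_eq]
    by_cases hc : circDir t ∈ N
    · rw [indicator_of_mem, indicator_of_mem]
      · rfl
      · exact hc
      · show toP _ ∈ N; rw [this]; exact hc
    · rw [indicator_of_notMem, indicator_of_notMem]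
      · exact hc
      · show toP _ ∉ N; rw [this]; exact hc
  · have h3 : ∀ᵐ p : ℝ × ℝ, ¬ (p.2 ∈ circDir ⁻¹' N ∩ Ioo (-Real.pi) Real.pi) := by
      have := Measure.quasiMeasurePreserving_snd (μ := (volume : Measure ℝ)) (ν := (volume : Measure ℝ))
      exact this.ae (p := fun t => ¬ (t ∈ circDir ⁻¹' N ∩ Ioo (-Real.pi) Real.pi))
        (by rw [ae_iff]; simp only [not_not]; exact h2)
    rw [lintegral_eq_zero_iff']
    · rw [Filter.EventuallyEq, ae_restrict_iff' polarCoord.open_target.measurableSet]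
      filter_upwards [h3] with p hp hpt
      have : p.2 ∉ circDir ⁻¹' N := fun h => hp ⟨h, hpt.2⟩
      simp [indicator_of_notMem this]
    · apply Measurable.aemeasurable
      exact (ENNReal.measurable_ofReal.comp measurable_fst).mul
        ((measurable_one.indicator hm).comp measurable_snd)

def mm : Measure XX := (volume : Measure T2).prod lam

instance : IsProbabilityMeasure (volume : Measure T1) :=
  ⟨UnitAddCircle.measure_univ⟩

instance : IsProbabilityMeasure (volume : Measure T2) := by
  rw [Measure.volume_eq_prod]; infer_instance

instance : IsProbabilityMeasure mm := by unfold mm; infer_instance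

namespace SL

def nu (H : SL) : Measure XX := mm.map H.ext

instance (H : SL) : IsProbabilityMeasure H.nu :=
  Measure.isProbabilityMeasure_map H.continuous_ext.measurable.aemeasurable

lemma ext_eq (H : SL) (x : T2) (p : PP) : H.ext (x, p) = (H.map x, Pm _ (H.inj_D (rep x)) p) := rfl

lemma nu_ac (H : SL) : H.nu ≪ mm := by
  refine Measure.AbsolutelyContinuous.mk fun N hN h => ?_
  have hm := H.continuous_ext.measurable hN
  rw [nu, Measure.map_apply H.continuous_ext.measurable hN, mm, Measure.measure_prod_null hm]
  rw [mm, Measure.measure_prod_null hN] at h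
  filter_upwards [H.mp_map.quasiMeasurePreserving.ae h] with x hx
  exact lam_quasi _ (H.inj_D (rep x)) (measurable_prodMk_left hN) hx

lemma nu_fst (H : SL) : H.nu.map Prod.fst = volume := by
  rw [nu, Measure.map_map measurable_fst H.continuous_ext.measurable]
  have : Prod.fst ∘ H.ext = H.map ∘ Prod.fst := rfl
  rw [this, ← Measure.map_map H.continuous_map.measurable measurable_fst, mm,
    Measure.map_fst_prod]
  simp [H.mp_map.map_eq]

lemma mp_rot (t : ℝ) : MeasurePreserving (rot t).ext mm mm := by
  have h1 : MeasurePreserving (rot t).map volume volume := (rot t).mp_map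
  have := h1.prod (MeasurePreserving.id lam)
  have e : (rot t).ext = Prod.map (rot t).map id := by
   funext y
   rw [ext_rot]
   refine Prod.ext ?_ rfl
   have h2 := congrArg Prod.fst (ext_rot t y)
   exact h2.symm
  rw [e]
  exact this

lemma mp_ext (H : SL) : MeasurePreserving H.ext mm H.nu := ⟨H.continuous_ext.measurable, rfl⟩

lemma conj_ext (H : SL) (t) (y) : (conj H t).ext (H.ext y) = H.ext ((rot t).ext y) := by
  rw [conj, ext_comp, ext_comp, ext_inv]

lemma mp_conj (H : SL) (t) : MeasurePreserving (conj H t).ext H.nu H.nu := by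
  refine ⟨(conj H t).continuous_ext.measurable, ?_⟩
  rw [nu, Measure.map_map (conj H t).continuous_ext.measurable H.continuous_ext.measurable]
  have : (conj H t).ext ∘ H.ext = H.ext ∘ (rot t).ext := funext fun y => H.conj_ext t y
  rw [this, ← Measure.map_map H.continuous_ext.measurable (rot t).continuous_ext.measurable,
    (mp_rot t).map_eq]

end SL

lemma chi_ne (p : PP) : chi p ≠ 0 := by
  rw [← norm_ne_zero_iff, norm_chi]; norm_num

def EE (a : ℤ × ℤ × ℤ) : C(XX, ℂ) where
  toFun y := fourier a.1 y.1.1 * fourier a.2.1 y.1.2 * chi y.2 ^ a.2.2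
  continuous_toFun := by
    have : Continuous fun y : XX => chi y.2 ^ a.2.2 :=
      (continuous_chi.comp continuous_snd).zpow₀ _ fun y => Or.inl (chi_ne _)
    fun_prop

lemma EE_apply (a : ℤ × ℤ × ℤ) (y : XX) :
    EE a y = fourier a.1 y.1.1 * fourier a.2.1 y.1.2 * chi y.2 ^ a.2.2 := rfl

lemma EE_zero : EE 0 = 1 := by
  ext y; simp [EE_apply]

lemma EE_add (a b) : EE (a + b) = EE a * EE b := by
  ext y
  simp only [EE_apply, ContinuousMap.mul_apply, Prod.fst_add, Prod.snd_add, fourier_add,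
    zpow_add₀ (chi_ne _)]
  ring

lemma EE_norm (a y) : ‖EE a y‖ = 1 := by
  rw [EE_apply, norm_mul, norm_mul, norm_zpow, norm_chi]
  simp only [fourier_apply, Circle.norm_coe, one_zpow, mul_one]

lemma EE_neg (a) : EE (-a) = star (EE a) := by
  ext y
  have h := congrArg (fun f : C(XX, ℂ) => f y) (EE_add (-a) a)
  simp only [neg_add_cancel, EE_zero, ContinuousMap.mul_apply, ContinuousMap.one_apply] at h
  have h1 : (starRingEnd ℂ) (EE a y) * EE a y = 1 := by
    rw [mul_comm, Complex.mul_conj, Complex.normSq_eq_norm_sq, EE_norm]; simp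
  have h2 : EE a y ≠ 0 := by rw [← norm_ne_zero_iff, EE_norm]; norm_num
  exact mul_right_cancel₀ h2 (h.symm.trans h1.symm)

/-- star algebra of trigonometric polynomials -/
def EA : StarSubalgebra ℂ C(XX, ℂ) where
  toSubalgebra := (Submodule.span ℂ (range EE)).toSubalgebra
    (Submodule.subset_span ⟨0, EE_zero⟩) (fun f g hf hg => by
      have := Submodule.mul_mem_mul hf hg
      rw [Submodule.span_mul_span] at this
      refine Submodule.span_mono ?_ this
      rintro _ ⟨_, ⟨a, rfl⟩, _, ⟨b, rfl⟩, rfl⟩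
      exact ⟨a + b, EE_add a b⟩)
  star_mem' := by
    intro f hf'
    have hf : f ∈ Submodule.span ℂ (range EE) := hf'
    clear hf'
    show star f ∈ Submodule.span ℂ (range EE)
    induction hf using Submodule.span_induction with
    | mem x hx =>
      obtain ⟨a, rfl⟩ := hx
      exact Submodule.subset_span ⟨-a, EE_neg a⟩
    | zero => simp
    | add x y _ _ hx hy => rw [star_add]; exact add_mem hx hy
    | smul c x _ hx => rw [star_smul]; exact Submodule.smul_mem _ _ hx

lemma EA_sep : EA.SeparatesPoints := by
  intro y z h
  by_contra hc
  have h' : ∀ a, EE a y = EE a z := by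
    intro a
    by_contra hne
    exact hc ⟨_, ⟨EE a, Submodule.subset_span ⟨a, rfl⟩, rfl⟩, hne⟩
  apply h
  have h1 := h' (1, 0, 0)
  have h2 := h' (0, 1, 0)
  have h3 := h' (0, 0, 1)
  simp only [EE_apply, fourier_zero, zpow_zero, mul_one, one_mul, zpow_one, fourier_one] at h1 h2 h3
  have inj := AddCircle.injective_toCircle (T := 1) one_ne_zero
  exact Prod.ext (Prod.ext (inj (Circle.ext h1)) (inj (Circle.ext h2))) (chi_inj h3)

lemma EA_dense : EA.topologicalClosure = ⊤ :=
  ContinuousMap.starSubalgebra_topologicalClosure_eq_top_of_separatesPoints EA EA_sep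

end

noncomputable section
open MeasureTheory Filter Set

lemma det_formula (A : CL) : A.det = (A (1,0)).1 * (A (0,1)).2 - (A (0,1)).1 * (A (1,0)).2 := by
  have h : A.det = LinearMap.det A.toLinearMap := rfl
  rw [h, ← LinearMap.det_toMatrix (Module.Basis.finTwoProd ℝ), Matrix.det_fin_two]
  simp [LinearMap.toMatrix_apply]

def Rt (φ : ℝ) (w : ℝ × ℝ) : ℝ × ℝ :=
  (Real.cos φ * w.1 - Real.sin φ * w.2, Real.sin φ * w.1 + Real.cos φ * w.2)

def nsq (w : ℝ × ℝ) : ℝ := w.1 ^ 2 + w.2 ^ 2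

lemma nsq_Rt (φ w) : nsq (Rt φ w) = nsq w := by
  simp only [nsq, Rt]
  linear_combination (w.1 ^ 2 + w.2 ^ 2) * Real.sin_sq_add_cos_sq φ

lemma Rt_neg (φ w) : Rt (-φ) (Rt φ w) = w := by
  have := Real.sin_sq_add_cos_sq φ
  simp only [Rt, Real.cos_neg, Real.sin_neg]
  ext
  · simp only; linear_combination w.1 * this
  · simp only; linear_combination w.2 * this

lemma cz_nsq (w) : ‖cz w‖ ^ 2 = nsq w := by
  rw [← Complex.normSq_eq_norm_sq, Complex.normSq_apply]; simp only [cz, nsq]; ring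

lemma cz_nrm_Rt (φ w) : ‖cz (Rt φ w)‖ = ‖cz w‖ := by
  have h : ‖cz (Rt φ w)‖ ^ 2 = ‖cz w‖ ^ 2 := by rw [cz_nsq, cz_nsq, nsq_Rt]
  exact (sq_eq_sq₀ (norm_nonneg _) (norm_nonneg _)).1 h

def twist (η : ℝ → ℝ) (C : ℝ × ℝ) (R θ : ℝ) (z : ℝ × ℝ) : ℝ × ℝ :=
  C + Rt (θ * η (nsq (z - C) / R ^ 2)) (z - C)

lemma twist_sub (η C R θ z) : twist η C R θ z - C = Rt (θ * η (nsq (z - C) / R ^ 2)) (z - C) := by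
  simp [twist]

lemma twist_inv (η C R θ z) : twist η C R (-θ) (twist η C R θ z) = z := by
  rw [twist, twist_sub, nsq_Rt, neg_mul, Rt_neg]; simp

lemma twist_norm (η C R θ z) : ‖cz (twist η C R θ z - C)‖ = ‖cz (z - C)‖ := by
  rw [twist_sub, cz_nrm_Rt]

lemma contDiff_twist {η : ℝ → ℝ} (hη : ContDiff ℝ (⊤ : ℕ∞) η) (C R θ) :
    ContDiff ℝ (⊤ : ℕ∞) (twist η C R θ) := by
  have h1 : ContDiff ℝ (⊤ : ℕ∞) (fun z : ℝ × ℝ => θ * η (nsq (z - C) / R ^ 2)) := by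
    refine contDiff_const.mul (hη.comp ?_)
    unfold nsq
    fun_prop
  unfold twist Rt
  refine contDiff_const.add (ContDiff.prodMk ?_ ?_)
  · refine ContDiff.sub ((Real.contDiff_cos.comp h1).mul (by fun_prop))
      ((Real.contDiff_sin.comp h1).mul (by fun_prop))
  · refine ContDiff.add ((Real.contDiff_sin.comp h1).mul (by fun_prop))
      ((Real.contDiff_cos.comp h1).mul (by fun_prop))

lemma det_twist {η : ℝ → ℝ} (hη : ContDiff ℝ (⊤ : ℕ∞) η) (C R θ z) :
    (fderiv ℝ (twist η C R θ) z).det = 1 := by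
  set w := z - C with hw
  set ψ : ℝ × ℝ → ℝ := fun z => θ * η (nsq (z - C) / R ^ 2) with hψ
  set g : ℝ := θ * deriv η (nsq (z - C) / R ^ 2) / R ^ 2 with hg
  have hs : HasFDerivAt (fun z : ℝ × ℝ => z - C) (ContinuousLinearMap.id ℝ _) z :=
    (hasFDerivAt_id z).sub_const C
  have h1 : HasFDerivAt (fun z : ℝ × ℝ => (z - C).1) (ContinuousLinearMap.fst ℝ ℝ ℝ) z := by
    simpa using hs.fst
  have h2 : HasFDerivAt (fun z : ℝ × ℝ => (z - C).2) (ContinuousLinearMap.snd ℝ ℝ ℝ) z := by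
    simpa using hs.snd
  have hn : HasFDerivAt (fun z : ℝ × ℝ => nsq (z - C) / R ^ 2)
      ((R ^ 2)⁻¹ • ((2 * w.1) • ContinuousLinearMap.fst ℝ ℝ ℝ +
        (2 * w.2) • ContinuousLinearMap.snd ℝ ℝ ℝ)) z := by
    have := ((h1.pow 2).add (h2.pow 2)).const_mul (R ^ 2)⁻¹
    have e : (fun z : ℝ × ℝ => nsq (z - C) / R ^ 2) =
      fun z : ℝ × ℝ => (R ^ 2)⁻¹ * ((z - C).1 ^ 2 + (z - C).2 ^ 2) := by
        funext z; simp only [nsq]; ring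
    rw [e]
    refine this.congr_fderiv ?_
    ext <;> simp [hw]
  have hd : HasDerivAt η (deriv η (nsq (z - C) / R ^ 2)) (nsq (z - C) / R ^ 2) :=
    ((hη.differentiable (by simp)) _).hasDerivAt
  have hp : HasFDerivAt ψ (g • ((2 * w.1) • ContinuousLinearMap.fst ℝ ℝ ℝ +
        (2 * w.2) • ContinuousLinearMap.snd ℝ ℝ ℝ)) z := by
    have := (hd.comp_hasFDerivAt z hn).const_mul θ
    refine this.congr_fderiv ?_
    ext <;> simp [hg] <;> ring
  have hc := hp.cos
  have hsn := hp.sin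
  have k1 := (hc.mul h1).sub (hsn.mul h2)
  have k2 := (hsn.mul h1).add (hc.mul h2)
  have k := (k1.prodMk k2).const_add C
  have k' : HasFDerivAt (twist η C R θ) _ z := k
  rw [k'.fderiv, det_formula]
  simp only [ContinuousLinearMap.prod_apply, sub_apply,
    add_apply, smul_apply, ContinuousLinearMap.coe_fst',
    ContinuousLinearMap.coe_snd', smul_eq_mul, ← hw]
  have := Real.sin_sq_add_cos_sq (ψ z)
  linear_combination this

/-- a family of disjoint discs with twist angles -/
structure DF where
  ι : Type
  C : ι → ℝ × ℝ
  R : ι → ℝ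
  R0 : ℝ
  hR0 : 0 < R0
  hR : ∀ d, R0 ≤ R d
  disj : ∀ d e z, ‖cz (z - C d)‖ < R d → ‖cz (z - C e)‖ < R e → d = e
  ρ : ℝ
  hρ : 0 < ρ
  hρ1 : ρ < 1

namespace DF

def r1 (X : DF) : ℝ := (1 + X.ρ) / 2

def eta (X : DF) (s : ℝ) : ℝ := Real.smoothTransition ((X.r1 ^ 2 - s) / (X.r1 ^ 2 - X.ρ ^ 2))

lemma eta_smooth (X : DF) : ContDiff ℝ (⊤ : ℕ∞) X.eta := by
  unfold eta
  exact Real.smoothTransition.contDiff.comp (by fun_prop)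

lemma r1_pos (X : DF) : 0 < X.r1 ^ 2 - X.ρ ^ 2 := by
  have := X.hρ; have := X.hρ1
  simp only [r1]; nlinarith

lemma eta_one (X : DF) {s : ℝ} (h : s ≤ X.ρ ^ 2) : X.eta s = 1 := by
  apply Real.smoothTransition.one_of_one_le
  rw [le_div_iff₀ X.r1_pos]; linarith

lemma eta_zero (X : DF) {s : ℝ} (h : X.r1 ^ 2 ≤ s) : X.eta s = 0 := by
  apply Real.smoothTransition.zero_of_nonpos
  exact div_nonpos_of_nonpos_of_nonneg (by linarith) X.r1_pos.le

def inD (X : DF) (d : X.ι) (z : ℝ × ℝ) : Prop := ‖cz (z - X.C d)‖ < X.R d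

open Classical in
def tw (X : DF) (θ : X.ι → ℝ) (z : ℝ × ℝ) : ℝ × ℝ :=
  if h : ∃ d, X.inD d z then twist X.eta (X.C h.choose) (X.R h.choose) (θ h.choose) z else z

lemma tw_mem (X : DF) (θ) {d z} (h : X.inD d z) :
    X.tw θ z = twist X.eta (X.C d) (X.R d) (θ d) z := by
  have hh : ∃ d, X.inD d z := ⟨d, h⟩
  have e : hh.choose = d := X.disj _ _ z hh.choose_spec h
  rw [tw, dif_pos hh, e]

lemma tw_not (X : DF) (θ) {z} (h : ∀ d, ¬ X.inD d z) : X.tw θ z = z := by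
  rw [tw, dif_neg (by push Not; exact h)]

lemma Rpos (X : DF) (d) : 0 < X.R d := X.hR0.trans_le (X.hR d)

lemma twist_eq_self (X : DF) (θ : ℝ) (d z) (h : X.r1 * X.R d ≤ ‖cz (z - X.C d)‖) :
    twist X.eta (X.C d) (X.R d) θ z = z := by
  have hr : 0 < X.r1 := by have := X.hρ; simp only [r1]; linarith
  have : X.r1 ^ 2 ≤ nsq (z - X.C d) / X.R d ^ 2 := by
    rw [le_div_iff₀ (pow_pos (X.Rpos d) 2), ← cz_nsq, ← mul_pow]
    exact pow_le_pow_left₀ (mul_nonneg hr.le (X.Rpos d).le) h 2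
  rw [twist, X.eta_zero this]
  ext <;> simp [Rt]

lemma inD_tw (X : DF) (θ) {d z} (h : X.inD d z) : X.inD d (X.tw θ z) := by
  rw [X.tw_mem θ h]; unfold inD; rw [twist_norm]; exact h

lemma tw_inv (X : DF) (θ z) : X.tw (-θ) (X.tw θ z) = z := by
  by_cases h : ∃ d, X.inD d z
  · obtain ⟨d, h⟩ := h
    rw [X.tw_mem _ (X.inD_tw θ h), X.tw_mem _ h]
    exact twist_inv _ _ _ _ _
  · push Not at h
    rw [X.tw_not θ h, X.tw_not _ h]

lemma isOpen_inD (X : DF) (d) : IsOpen {z | X.inD d z} :=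
  isOpen_lt ((continuous_cz.comp (continuous_id.sub continuous_const)).norm) continuous_const

/-- local form -/
lemma tw_local (X : DF) (θ) (z : ℝ × ℝ) :
    (∃ d, X.inD d z ∧ X.tw θ =ᶠ[nhds z] twist X.eta (X.C d) (X.R d) (θ d)) ∨
      (X.tw θ =ᶠ[nhds z] id) := by
  by_cases h : ∃ d, X.inD d z
  · left
    obtain ⟨d, h⟩ := h
    refine ⟨d, h, ?_⟩
    filter_upwards [(X.isOpen_inD d).mem_nhds h] with y hy
    exact X.tw_mem θ hy
  · right
    push Not at h
    have hr : X.r1 < 1 := by have := X.hρ1; simp only [r1]; linarith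
    have ho : IsOpen {y : ℝ × ℝ | ‖cz (y - z)‖ < (1 - X.r1) * X.R0} :=
      isOpen_lt ((continuous_cz.comp (continuous_id.sub continuous_const)).norm) continuous_const
    have hm : z ∈ {y : ℝ × ℝ | ‖cz (y - z)‖ < (1 - X.r1) * X.R0} := by
      have : cz 0 = 0 := by apply Complex.ext <;> simp [cz]
      simp only [mem_ofPred_eq, sub_self, this, norm_zero]
      exact mul_pos (by linarith) X.hR0
    filter_upwards [ho.mem_nhds hm] with y hy
    by_cases h2 : ∃ d, X.inD d y
    · obtain ⟨d, hd⟩ := h2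
      rw [X.tw_mem θ hd]
      apply X.twist_eq_self
      have h3 := h d
      unfold inD at h3
      push Not at h3
      have h4 : cz (z - X.C d) = cz (y - X.C d) - cz (y - z) := by
        rw [← cz_sub]; congr 1; abel
      have h5 := norm_sub_le (cz (y - X.C d)) (cz (y - z))
      rw [← h4] at h5
      have h6 : (1 - X.r1) * X.R0 ≤ (1 - X.r1) * X.R d :=
        mul_le_mul_of_nonneg_left (X.hR d) (by linarith)
      have hy : ‖cz (y - z)‖ < (1 - X.r1) * X.R0 := hy
      nlinarith
    · push Not at h2
      exact X.tw_not θ h2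

lemma tw_smooth (X : DF) (θ) : ContDiff ℝ (⊤ : ℕ∞) (X.tw θ) := by
  rw [contDiff_iff_contDiffAt]
  intro z
  rcases X.tw_local θ z with ⟨d, _, h⟩ | h
  · exact (contDiff_twist X.eta_smooth _ _ _).contDiffAt.congr_of_eventuallyEq h
  · exact contDiffAt_id.congr_of_eventuallyEq h

lemma tw_det (X : DF) (θ z) : (fderiv ℝ (X.tw θ) z).det = 1 := by
  rcases X.tw_local θ z with ⟨d, _, h⟩ | h
  · rw [h.fderiv_eq, det_twist X.eta_smooth]
  · rw [h.fderiv_eq, fderiv_id]; simp [ContinuousLinearMap.det]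

lemma tw_per (X : DF) (θ) (v : ℝ × ℝ) (σ : X.ι ≃ X.ι) (hC : ∀ d, X.C (σ d) = X.C d + v)
    (hR : ∀ d, X.R (σ d) = X.R d) (hθ : ∀ d, θ (σ d) = θ d) (z) :
    X.tw θ (z + v) = X.tw θ z + v := by
  by_cases h : ∃ d, X.inD d z
  · obtain ⟨d, h⟩ := h
    have h' : X.inD (σ d) (z + v) := by
      unfold inD at *; rw [hC, hR, add_sub_add_right_eq_sub]; exact h
    rw [X.tw_mem θ h, X.tw_mem θ h']
    simp only [twist, hC, hR, hθ, add_sub_add_right_eq_sub]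
    abel
  · push Not at h
    rw [X.tw_not θ h, X.tw_not]
    intro d hd
    apply h (σ.symm d)
    have h1 := hC (σ.symm d)
    have h2 := hR (σ.symm d)
    rw [Equiv.apply_symm_apply] at h1 h2
    unfold inD at *
    rwa [← h2, ← add_sub_add_right_eq_sub z _ v, ← h1]

/-- rotation on the shrunken discs -/
lemma tw_good (X : DF) (θ) {d z} (h : ‖cz (z - X.C d)‖ < X.ρ * X.R d) :
    X.tw θ =ᶠ[nhds z] fun y => X.C d + Rt (θ d) (y - X.C d) := by
  have ho : IsOpen {y : ℝ × ℝ | ‖cz (y - X.C d)‖ < X.ρ * X.R d} :=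
      isOpen_lt ((continuous_cz.comp (continuous_id.sub continuous_const)).norm) continuous_const
  filter_upwards [ho.mem_nhds h] with y hy
  have hy : ‖cz (y - X.C d)‖ < X.ρ * X.R d := hy
  have h1 : X.inD d y := by
    unfold inD; nlinarith [X.Rpos d, X.hρ1]
  rw [X.tw_mem θ h1, twist, X.eta_one, mul_one]
  rw [div_le_iff₀ (pow_pos (X.Rpos d) 2), ← cz_nsq, ← mul_pow]
  exact pow_le_pow_left₀ (norm_nonneg _) hy.le 2

end DF
end

noncomputable section
open MeasureTheory Filter Set

def sqC : Set ℂ := {z | z.re ∈ Ioo (0:ℝ) 1 ∧ z.im ∈ Ioo (0:ℝ) 1}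

lemma isOpen_sqC : IsOpen sqC := by
  have h1 : IsOpen {z : ℂ | z.re ∈ Ioo (0:ℝ) 1} := isOpen_Ioo.preimage Complex.continuous_re
  have h2 : IsOpen {z : ℂ | z.im ∈ Ioo (0:ℝ) 1} := isOpen_Ioo.preimage Complex.continuous_im
  exact h1.inter h2

lemma vol_sqC : volume sqC = 1 := by
  have h : sqC = Complex.measurableEquivRealProd ⁻¹' (Ioo (0:ℝ) 1 ×ˢ Ioo (0:ℝ) 1) := by
    ext z; simp [sqC]
  rw [h, Complex.volume_preserving_equiv_real_prod.measure_preimage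
    (measurableSet_Ioo.prod measurableSet_Ioo).nullMeasurableSet, Measure.volume_eq_prod,
    Measure.prod_prod]
  simp

/-- a disc packing of the unit square -/
structure Pk where
  t : Finset ℂ
  r : ℂ → ℝ
  ρ : ℝ
  R0 : ℝ
  δ : ℝ
  hρ : 0 < ρ
  hρ1 : ρ < 1
  hR0 : 0 < R0
  hR : ∀ c ∈ t, R0 ≤ r c
  sub : ∀ c ∈ t, Metric.closedBall c (r c) ⊆ sqC
  disj : ∀ c ∈ t, ∀ d ∈ t, ∀ z, z ∈ Metric.ball c (r c) → z ∈ Metric.ball d (r d) → c = d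
  hδ : 0 < δ
  hδ1 : δ ≤ (1 - ρ) * R0

def Pk.W (P : Pk) : Set ℂ := ⋃ c ∈ P.t, Metric.ball c (P.ρ * P.r c)

lemma exists_Pk (ε : ℝ) (hε : 0 < ε) : ∃ P : Pk, P.δ ≤ ε ∧ ENNReal.ofReal (1 - ε) ≤ volume P.W := by
  obtain ⟨t, r, tc, ts, tr, t0, td⟩ := Besicovitch.exists_disjoint_closedBall_covering_ae
    (volume : Measure ℂ) (fun x => {r | Metric.closedBall x r ⊆ sqC}) sqC (by
      intro x hx δ hδ
      obtain ⟨e, he, h⟩ := Metric.isOpen_iff.1 isOpen_sqC x hx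
      refine ⟨min (e/2) (δ/2), ?_, by positivity, (min_le_right _ _).trans_lt (by linarith)⟩
      refine (Metric.closedBall_subset_ball ?_).trans h
      exact (min_le_left _ _).trans_lt (by linarith)) (fun _ => 1) (fun _ _ => one_pos)
  obtain ⟨f, hf⟩ := Set.countable_iff_exists_injOn.1 tc
  set ρ : ℕ → ℝ := fun n => 1 - 1 / ((n : ℝ) + 2) with hρ
  have rho_pos : ∀ n, 0 < ρ n := by
    intro n
    have : 1 / ((n : ℝ) + 2) < 1 := by rw [div_lt_one (by positivity)]; linarith [(Nat.cast_nonneg n : (0:ℝ) ≤ n)]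
    simp only [hρ]; linarith
  have rho_lt : ∀ n, ρ n < 1 := by
    intro n
    have : 0 < 1 / ((n : ℝ) + 2) := by positivity
    simp only [hρ]; linarith
  have rho_mono : Monotone ρ := by
    intro a b h
    have h' : (a : ℝ) ≤ b := by exact_mod_cast h
    simp only [hρ]
    gcongr
  set U : ℕ → Set ℂ := fun n => ⋃ c ∈ {c | c ∈ t ∧ f c < n}, Metric.ball c (ρ n * r c) with hU
  have Umono : Monotone U := by
    intro a b h
    simp only [hU]
    refine iUnion₂_subset fun c hc => ?_
    refine subset_iUnion₂_of_subset c ⟨hc.1, hc.2.trans_le h⟩ ?_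
    apply Metric.ball_subset_ball
    exact mul_le_mul_of_nonneg_right (rho_mono h) (tr c hc.1).2.1.le
  have Uun : (⋃ c ∈ t, Metric.ball c (r c)) ⊆ ⋃ n, U n := by
    refine iUnion₂_subset fun c hc z hz => ?_
    have hr := (tr c hc).2.1
    have hz : dist z c < r c := hz
    have hlim : Tendsto (fun n => ρ n * r c) atTop (nhds ((1 - 0) * r c)) := by
      refine Tendsto.mul_const _ (Tendsto.const_sub _ ?_)
      have := (tendsto_const_div_atTop_nhds_zero_nat (1:ℝ)).comp (tendsto_add_atTop_nat 2)
      refine this.congr fun n => ?_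
      simp
    have hev := (hlim.eventually_const_lt (u := dist z c) (by simpa using hz)).and
      (eventually_gt_atTop (f c))
    obtain ⟨n, hn, hn2⟩ := hev.exists
    exact mem_iUnion.2 ⟨n, mem_iUnion₂.2 ⟨c, ⟨hc, hn2⟩, hn⟩⟩
  have hsph : volume (⋃ c ∈ t, Metric.sphere c (r c)) = 0 := by
    rw [measure_biUnion_null_iff tc]
    intro c hc
    exact Measure.addHaar_sphere _ _ _
  have hvol : 1 ≤ volume (⋃ n, U n) := by
    rw [← vol_sqC]
    have : sqC ⊆ (sqC \ ⋃ x ∈ t, Metric.closedBall x (r x)) ∪ (⋃ c ∈ t, Metric.sphere c (r c))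
        ∪ ⋃ n, U n := by
      intro z hz
      by_cases h : z ∈ ⋃ x ∈ t, Metric.closedBall x (r x)
      · obtain ⟨c, hc, hz2⟩ := mem_iUnion₂.1 h
        rcases (show dist z c ≤ r c from hz2).lt_or_eq with h3 | h3
        · right; exact Uun (mem_iUnion₂.2 ⟨c, hc, h3⟩)
        · left; right; exact mem_iUnion₂.2 ⟨c, hc, h3⟩
      · left; left; exact ⟨hz, h⟩
    calc volume sqC ≤ _ := measure_mono this
      _ ≤ _ := measure_union_le _ _
      _ ≤ _ := by
        rw [measure_union_null t0 hsph, zero_add]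
  have hl := tendsto_measure_iUnion_atTop (μ := (volume : Measure ℂ)) Umono
  have hlt : ENNReal.ofReal (1 - ε) < volume (⋃ n, U n) := by
    refine lt_of_lt_of_le ?_ hvol
    rw [ENNReal.ofReal_lt_one]; linarith
  obtain ⟨n, hn⟩ := (hl.eventually_const_lt hlt).exists
  have hfin : ({c | c ∈ t ∧ f c < n} : Set ℂ).Finite := by
    refine Set.Finite.of_finite_image (f := f) ?_ (hf.mono fun c hc => hc.1)
    refine (Set.finite_lt_nat n).subset ?_
    rintro _ ⟨c, hc, rfl⟩; exact hc.2
  have hR0 : ∀ s : Finset ℂ, (∀ c ∈ s, 0 < r c) → ∃ R0 > 0, ∀ c ∈ s, R0 ≤ r c := by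
    intro s hs
    induction s using Finset.induction_on with
    | empty => exact ⟨1, one_pos, by simp⟩
    | insert a s ha ih =>
      obtain ⟨R0, h0, h1⟩ := ih fun c hc => hs c (Finset.mem_insert_of_mem hc)
      refine ⟨min R0 (r a), lt_min h0 (hs a (Finset.mem_insert_self _ _)), ?_⟩
      intro c hc
      rcases Finset.mem_insert.1 hc with rfl | hc
      · exact min_le_right _ _
      · exact (min_le_left _ _).trans (h1 c hc)
  have hmem : ∀ c ∈ hfin.toFinset, c ∈ t := fun c hc => ((Set.Finite.mem_toFinset _).1 hc).1
  obtain ⟨R0, h0, h1⟩ := hR0 hfin.toFinset fun c hc => (tr c (hmem c hc)).2.1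
  refine ⟨⟨hfin.toFinset, r, ρ n, R0, min ε ((1 - ρ n) * R0),
    rho_pos n, rho_lt n, h0, h1, fun c hc => (tr c (hmem c hc)).1,
    ?_, ?_, min_le_right _ _⟩, min_le_left _ _, ?_⟩
  · intro c hc d hd z hz hz'
    by_contra hne
    exact Set.disjoint_left.1 (td (hmem c hc) (hmem d hd) hne) (Metric.ball_subset_closedBall hz)
      (Metric.ball_subset_closedBall hz')
  · exact lt_min hε (mul_pos (by linarith [rho_lt n]) h0)
  · refine hn.le.trans (measure_mono ?_)
    simp only [hU, Pk.W]
    refine iUnion₂_subset fun c hc => ?_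
    exact subset_iUnion₂_of_subset c ((Set.Finite.mem_toFinset _).2 hc) Subset.rfl

namespace Pk

lemma rpos (P : Pk) {c} (hc : c ∈ P.t) : 0 < P.r c := P.hR0.trans_le (P.hR c hc)

lemma disc_mem (P : Pk) {c} (hc : c ∈ P.t) {z : ℝ × ℝ} (h : cz z ∈ Metric.ball c (P.r c)) :
    z.1 ∈ Ioo (0:ℝ) 1 ∧ z.2 ∈ Ioo (0:ℝ) 1 := P.sub c hc (Metric.ball_subset_closedBall h)

lemma disc_mem' (P : Pk) {c} (hc : c ∈ P.t) {z : ℝ × ℝ} (h : ‖cz z - c‖ < P.ρ * P.r c) :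
    z.1 ∈ Ioo P.δ (1 - P.δ) ∧ z.2 ∈ Ioo P.δ (1 - P.δ) := by
  have hr := P.rpos hc
  have h1 := P.hδ1.trans (mul_le_mul_of_nonneg_left (P.hR c hc) (by linarith [P.hρ1]))
  have key : ∀ w : ℂ, ‖w‖ ≤ P.r c → c + w ∈ sqC := by
    intro w hw
    apply P.sub c hc
    simpa [Metric.mem_closedBall, dist_eq_norm] using hw
  have n1 : ‖((P.r c : ℝ) : ℂ)‖ = P.r c := by simp [abs_of_pos hr]
  have n2 : ‖((-P.r c : ℝ) : ℂ)‖ = P.r c := by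
    rw [Complex.norm_real, Real.norm_eq_abs, abs_neg, abs_of_pos hr]
  have k1 := key ((P.r c : ℝ) : ℂ) n1.le
  have k2 := key ((-P.r c : ℝ) : ℂ) n2.le
  have k3 := key (((P.r c : ℝ) : ℂ) * Complex.I) (by rw [norm_mul, n1]; simp)
  have k4 := key (((-P.r c : ℝ) : ℂ) * Complex.I) (by rw [norm_mul, n2]; simp)
  simp only [sqC, mem_ofPred_eq, Complex.add_re, Complex.add_im, Complex.ofReal_re,
    Complex.ofReal_im, mem_Ioo, Complex.mul_re, Complex.mul_im, Complex.I_re, Complex.I_im] at k1 k2 k3 k4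
  have a1 := (Complex.abs_re_le_norm (cz z - c)).trans_lt h
  have a2 := (Complex.abs_im_le_norm (cz z - c)).trans_lt h
  simp only [Complex.sub_re, Complex.sub_im, cz, abs_lt] at a1 a2
  refine ⟨⟨?_, ?_⟩, ⟨?_, ?_⟩⟩ <;> nlinarith [a1.1, a1.2, a2.1, a2.2, k1.1.2, k2.1.1, k3.2.2, k4.2.1]

lemma δ_lt (P : Pk) (h : P.t.Nonempty) : P.δ < 1 - P.δ := by
  obtain ⟨c, hc⟩ := h
  have := P.disc_mem' hc (z := (c.re, c.im)) (by
    have : cz (c.re, c.im) = c := rfl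
    rw [this, sub_self, norm_zero]; exact mul_pos P.hρ (P.rpos hc))
  exact this.1.1.trans this.1.2

def X (P : Pk) : DF where
  ι := (ℤ × ℤ) × {c // c ∈ P.t}
  C d := (d.1.1 + d.2.1.re, d.1.2 + d.2.1.im)
  R d := P.r d.2.1
  R0 := P.R0
  hR0 := P.hR0
  hR d := P.hR d.2.1 d.2.2
  ρ := P.ρ
  hρ := P.hρ
  hρ1 := P.hρ1
  disj := by
    have e : ∀ (z : ℝ × ℝ) (d : (ℤ × ℤ) × {c // c ∈ P.t}),
        cz (z - (d.1.1 + d.2.1.re, d.1.2 + d.2.1.im)) = cz (z - ((d.1.1 : ℝ), (d.1.2 : ℝ))) - d.2.1 := by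
      intro z d
      apply Complex.ext <;> simp [cz] <;> ring
    intro d f z hd hf
    rw [e] at hd hf
    have hd' : cz (z - ((d.1.1 : ℝ), (d.1.2 : ℝ))) ∈ Metric.ball d.2.1 (P.r d.2.1) := by
      rw [Metric.mem_ball, dist_eq_norm]; exact hd
    have hf' : cz (z - ((f.1.1 : ℝ), (f.1.2 : ℝ))) ∈ Metric.ball f.2.1 (P.r f.2.1) := by
      rw [Metric.mem_ball, dist_eq_norm]; exact hf
    have h1 := P.disc_mem d.2.2 hd'
    have h2 := P.disc_mem f.2.2 hf'
    simp only [Prod.fst_sub, Prod.snd_sub, mem_Ioo] at h1 h2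
    have hi : d.1.1 = f.1.1 := by
      have a1 : d.1.1 = ⌊z.1⌋ := (Int.floor_eq_iff.2 ⟨by linarith, by linarith⟩).symm
      have a2 : f.1.1 = ⌊z.1⌋ := (Int.floor_eq_iff.2 ⟨by linarith, by linarith⟩).symm
      rw [a1, a2]
    have hl : d.1.2 = f.1.2 := by
      have a1 : d.1.2 = ⌊z.2⌋ := (Int.floor_eq_iff.2 ⟨by linarith, by linarith⟩).symm
      have a2 : f.1.2 = ⌊z.2⌋ := (Int.floor_eq_iff.2 ⟨by linarith, by linarith⟩).symm
      rw [a1, a2]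
    have hii : d.1 = f.1 := Prod.ext hi hl
    rw [hii] at hd'
    exact Prod.ext hii (Subtype.ext (P.disj _ d.2.2 _ f.2.2 _ hd' hf'))

def thi (N : ℕ) (i l : ℤ) : ℝ := if Odd i then Real.pi * ((l % (N : ℤ) : ℤ) : ℝ) / N else 0

def th (P : Pk) (N : ℕ) (d : P.X.ι) : ℝ := thi N d.1.1 d.1.2

lemma X_e (P : Pk) (z : ℝ × ℝ) (d : P.X.ι) :
    cz (z - P.X.C d) = cz (z - ((d.1.1 : ℝ), (d.1.2 : ℝ))) - d.2.1 := by
  apply Complex.ext <;> simp [cz, X] <;> ring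

lemma th_per (P : Pk) (N : ℕ) (m1 m2 : ℤ) (z : ℝ × ℝ) (s : ℝ) :
    P.X.tw (s • P.th N) (z + (((2 * m1 : ℤ) : ℝ), ((N * m2 : ℤ) : ℝ))) =
      P.X.tw (s • P.th N) z + (((2 * m1 : ℤ) : ℝ), ((N * m2 : ℤ) : ℝ)) := by
  refine P.X.tw_per _ _ (Equiv.prodCongr (Equiv.addRight (2 * m1, N * m2)) (Equiv.refl _)) ?_ ?_ ?_ z
  · rintro ⟨⟨i, l⟩, c⟩
    show ((((i + 2 * m1 : ℤ) : ℝ) + c.1.re, ((l + N * m2 : ℤ) : ℝ) + c.1.im) : ℝ × ℝ) =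
      ((i : ℝ) + c.1.re, (l : ℝ) + c.1.im) + _
    ext <;> simp <;> ring
  · intro d; rfl
  · intro d
    show s * thi N (d.1.1 + 2 * m1) (d.1.2 + N * m2) = s * thi N d.1.1 d.1.2
    simp only [thi]
    have h1 : Odd (d.1.1 + 2 * m1) ↔ Odd d.1.1 := by
      rw [Int.odd_add]; simp
    have h2 : (d.1.2 + N * m2) % (N : ℤ) = d.1.2 % N := by simp
    simp only [h1, h2]

end Pk

/-- smooth bump -/
def beta (δ t : ℝ) : ℝ := Real.smoothTransition (t / δ) * Real.smoothTransition ((1 - t) / δ)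

lemma beta_smooth (δ) : ContDiff ℝ (⊤ : ℕ∞) (beta δ) := by
  unfold beta
  refine ContDiff.mul (Real.smoothTransition.contDiff.comp (by fun_prop))
    (Real.smoothTransition.contDiff.comp (by fun_prop))

lemma beta_zero {δ t : ℝ} (hδ : 0 < δ) (h : t ≤ 0 ∨ 1 ≤ t) : beta δ t = 0 := by
  unfold beta
  rcases h with h | h
  · rw [Real.smoothTransition.zero_of_nonpos (div_nonpos_of_nonpos_of_nonneg h hδ.le), zero_mul]
  · rw [Real.smoothTransition.zero_of_nonpos
      (div_nonpos_of_nonpos_of_nonneg (by linarith : 1 - t ≤ 0) hδ.le), mul_zero]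

lemma beta_one {δ t : ℝ} (hδ : 0 < δ) (h1 : δ ≤ t) (h2 : t ≤ 1 - δ) : beta δ t = 1 := by
  unfold beta
  rw [Real.smoothTransition.one_of_one_le (by rw [le_div_iff₀ hδ]; linarith),
    Real.smoothTransition.one_of_one_le (by rw [le_div_iff₀ hδ]; linarith), mul_one]

def stp (δ : ℝ) (w : ℤ → ℝ) (t : ℝ) : ℝ := w ⌊t⌋ * beta δ (Int.fract t)

lemma stp_smooth {δ : ℝ} (hδ : 0 < δ) (w) : ContDiff ℝ (⊤ : ℕ∞) (stp δ w) := by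
  rw [contDiff_iff_contDiffAt]
  intro t
  set i := ⌊t⌋ with hi
  have h : stp δ w =ᶠ[nhds t] fun s => w i * beta δ (s - i) + w (i - 1) * beta δ (s - i + 1) := by
    have ht : t ∈ Ioo ((i : ℝ) - 1) (i + 1) := ⟨by linarith [Int.floor_le t], Int.lt_floor_add_one t⟩
    filter_upwards [isOpen_Ioo.mem_nhds ht] with s hs
    by_cases hsi : (i : ℝ) ≤ s
    · have : ⌊s⌋ = i := Int.floor_eq_iff.2 ⟨hsi, hs.2⟩
      rw [stp, Int.fract, this, beta_zero hδ (t := s - i + 1) (Or.inr (by linarith))]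
      ring
    · have : ⌊s⌋ = i - 1 := Int.floor_eq_iff.2 ⟨by push_cast; exact hs.1.le, by push_cast; linarith⟩
      rw [stp, Int.fract, this, beta_zero hδ (t := s - i) (Or.inl (by linarith))]
      push_cast
      rw [show s - ((i : ℝ) - 1) = s - i + 1 by ring]; ring
  refine ContDiffAt.congr_of_eventuallyEq ?_ h
  have := beta_smooth δ
  apply ContDiff.contDiffAt
  exact (contDiff_const.mul (this.comp (by fun_prop))).add
    (contDiff_const.mul (this.comp (by fun_prop)))

lemma stp_per (δ : ℝ) {w : ℤ → ℝ} {p : ℤ} (hw : ∀ i, w (i + p) = w i) (t : ℝ) :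
    stp δ w (t + p) = stp δ w t := by
  rw [stp, stp, Int.floor_add_intCast, Int.fract_add_intCast, hw]

lemma stp_good {δ : ℝ} (hδ : 0 < δ) (w) {t : ℝ} {i : ℤ} (h1 : δ < t - i) (h2 : t - i < 1 - δ) :
    stp δ w =ᶠ[nhds t] fun _ => w i := by
  have ht : t ∈ Ioo ((i : ℝ) + δ) (i + 1 - δ) := ⟨by linarith, by linarith⟩
  filter_upwards [isOpen_Ioo.mem_nhds ht] with s hs
  have : ⌊s⌋ = i := Int.floor_eq_iff.2 ⟨by linarith [hs.1], by linarith [hs.2]⟩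
  rw [stp, Int.fract, this, beta_one hδ (by linarith [hs.1]) (by linarith [hs.2]), mul_one]

end

noncomputable section
open MeasureTheory Filter Set

namespace SL

def shV (b : ℝ → ℝ) (hb : ContDiff ℝ (⊤ : ℕ∞) b) (hp : ∀ (t : ℝ) (m : ℤ), b (t + m) = b t) : SL where
  F x := (x.1, x.2 + b x.1)
  G x := (x.1, x.2 - b x.1)
  sF := contDiff_fst.prodMk (contDiff_snd.add (hb.comp contDiff_fst))
  sG := contDiff_fst.prodMk (contDiff_snd.sub (hb.comp contDiff_fst))
  pF x m := by simp only [hp]; ext <;> simp <;> ring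
  pG x m := by simp only [hp]; ext <;> simp <;> ring
  FG x := by ext <;> simp
  GF x := by ext <;> simp
  dF x := by
    have hd : HasDerivAt b (deriv b x.1) x.1 := ((hb.differentiable (by simp)) _).hasDerivAt
    have h1 : HasFDerivAt (fun x : ℝ × ℝ => x.1) (ContinuousLinearMap.fst ℝ ℝ ℝ) x := hasFDerivAt_fst
    have h2 : HasFDerivAt (fun x : ℝ × ℝ => x.2) (ContinuousLinearMap.snd ℝ ℝ ℝ) x := hasFDerivAt_snd
    have h : HasFDerivAt (fun x : ℝ × ℝ => (x.1, x.2 + b x.1)) _ x :=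
      h1.prodMk (h2.add (hd.comp_hasFDerivAt x h1))
    rw [h.fderiv, det_formula]
    simp

def shH (b : ℝ → ℝ) (hb : ContDiff ℝ (⊤ : ℕ∞) b) (hp : ∀ (t : ℝ) (m : ℤ), b (t + m) = b t) : SL where
  F x := (x.1 + b x.2, x.2)
  G x := (x.1 - b x.2, x.2)
  sF := (contDiff_fst.add (hb.comp contDiff_snd)).prodMk contDiff_snd
  sG := (contDiff_fst.sub (hb.comp contDiff_snd)).prodMk contDiff_snd
  pF x m := by simp only [hp]; ext <;> simp <;> ring
  pG x m := by simp only [hp]; ext <;> simp <;> ring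
  FG x := by ext <;> simp
  GF x := by ext <;> simp
  dF x := by
    have hd : HasDerivAt b (deriv b x.2) x.2 := ((hb.differentiable (by simp)) _).hasDerivAt
    have h1 : HasFDerivAt (fun x : ℝ × ℝ => x.1) (ContinuousLinearMap.fst ℝ ℝ ℝ) x := hasFDerivAt_fst
    have h2 : HasFDerivAt (fun x : ℝ × ℝ => x.2) (ContinuousLinearMap.snd ℝ ℝ ℝ) x := hasFDerivAt_snd
    have h : HasFDerivAt (fun x : ℝ × ℝ => (x.1 + b x.2, x.2)) _ x :=
      (h1.add (hd.comp_hasFDerivAt x h2)).prodMk h2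
    rw [h.fderiv, det_formula]
    simp

end SL

namespace Pk

def wb (N : ℕ) (i : ℤ) : ℝ := if Odd i then (((i / 2) % ((N : ℤ) ^ 2) : ℤ) : ℝ) / (N : ℝ) ^ 2 else 0
def wc (N : ℕ) (i : ℤ) : ℝ := ((i % (N : ℤ) : ℤ) : ℝ) / (N : ℝ)

lemma wb_per (N : ℕ) (m i : ℤ) : wb N (i + 2 * (N : ℤ) ^ 2 * m) = wb N i := by
  unfold wb
  have h1 : Odd (i + 2 * (N : ℤ) ^ 2 * m) ↔ Odd i := by
    rw [Int.odd_add]; simp [mul_assoc]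
  have h2 : (i + 2 * (N : ℤ) ^ 2 * m) / 2 = i / 2 + (N : ℤ) ^ 2 * m := by
    rw [mul_assoc, Int.add_mul_ediv_left _ _ (by norm_num)]
  rw [h2, Int.add_mul_emod_self_left]
  simp only [h1]

lemma wc_per (N : ℕ) (m i : ℤ) : wc N (i + (N : ℤ) * m) = wc N i := by
  unfold wc
  rw [Int.add_mul_emod_self_left]

/-- the scale -/
def Qn (N q : ℕ) : ℝ := 2 * (N : ℝ) ^ 2 * q

variable (P : Pk) (N q : ℕ) (hN : 0 < N) (hq : 0 < q)

include hN hq in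
lemma Qpos : 0 < Qn N q := by unfold Qn; positivity

lemma kq_per (s : ℝ) (x : ℝ × ℝ) (m1 m2 : ℤ) :
    P.X.tw (s • P.th N) (x + (2 * (N : ℝ) ^ 2 * m1, 2 * (N : ℝ) ^ 2 * m2)) =
    P.X.tw (s • P.th N) x + (2 * (N : ℝ) ^ 2 * m1, 2 * (N : ℝ) ^ 2 * m2) := by
  have := P.th_per N ((N : ℤ) ^ 2 * m1) (2 * N * m2) x s
  have e : ((((2 * ((N : ℤ) ^ 2 * m1) : ℤ) : ℝ), ((N * (2 * N * m2) : ℤ) : ℝ)) : ℝ × ℝ) =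
    (2 * (N : ℝ) ^ 2 * m1, 2 * (N : ℝ) ^ 2 * m2) := by
    ext <;> push_cast <;> ring
  rwa [e] at this

def kF (s : ℝ) (x : ℝ × ℝ) : ℝ × ℝ := (Qn N q)⁻¹ • P.X.tw (s • P.th N) (Qn N q • x)

lemma kF_smooth (s) : ContDiff ℝ (⊤ : ℕ∞) (P.kF N q s) :=
  ((P.X.tw_smooth _).comp (contDiff_const_smul _)).const_smul _

include hN hq in
lemma kF_shift (s : ℝ) (x v : ℝ × ℝ) (m1 m2 : ℤ)
    (h1 : Qn N q * v.1 = 2 * (N : ℝ) ^ 2 * m1) (h2 : Qn N q * v.2 = 2 * (N : ℝ) ^ 2 * m2) :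
    P.kF N q s (x + v) = P.kF N q s x + v := by
  unfold kF
  have e : Qn N q • (x + v) = Qn N q • x + (2 * (N : ℝ) ^ 2 * m1, 2 * (N : ℝ) ^ 2 * m2) := by
    rw [smul_add]; congr 1
    ext
    · exact h1
    · exact h2
  rw [e, kq_per, smul_add]
  congr 1
  have := (Qpos N q hN hq).ne'
  ext
  · show (Qn N q)⁻¹ * (2 * (N : ℝ) ^ 2 * m1) = v.1
    rw [← h1]; field_simp
  · show (Qn N q)⁻¹ * (2 * (N : ℝ) ^ 2 * m2) = v.2
    rw [← h2]; field_simp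

include hN hq in
lemma kF_zper (s : ℝ) : Zper (P.kF N q s) := by
  intro x m
  have := P.kF_shift N q hN hq s x ((m.1 : ℝ), (m.2 : ℝ)) (q * m.1) (q * m.2)
    (by simp only [Qn]; push_cast; ring) (by simp only [Qn]; push_cast; ring)
  exact this

include hN hq in
lemma kF_inv (s x) : P.kF N q (-s) (P.kF N q s x) = x := by
  unfold kF
  have h0 := (Qpos N q hN hq).ne'
  rw [smul_inv_smul₀ h0, neg_smul, P.X.tw_inv, inv_smul_smul₀ h0]

include hN hq in
lemma kF_det (s x) : (fderiv ℝ (P.kF N q s) x).det = 1 := by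
  have h0 := (Qpos N q hN hq).ne'
  have h1 : HasFDerivAt (P.X.tw (s • P.th N)) _ (Qn N q • x) :=
    (((P.X.tw_smooth _).differentiable (by simp)) _).hasFDerivAt
  have h2 : HasFDerivAt (fun x : ℝ × ℝ => Qn N q • x) (Qn N q • ContinuousLinearMap.id ℝ (ℝ × ℝ)) x :=
    (hasFDerivAt_id x).const_smul (Qn N q)
  have h : HasFDerivAt (P.kF N q s) _ x := (h1.comp x h2).const_smul (Qn N q)⁻¹
  have e : (Qn N q)⁻¹ • (fderiv ℝ (P.X.tw (s • P.th N)) (Qn N q • x)).comp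
    (Qn N q • ContinuousLinearMap.id ℝ (ℝ × ℝ)) = fderiv ℝ (P.X.tw (s • P.th N)) (Qn N q • x) := by
    ext v <;> simp [h0]
  rw [h.fderiv, e, P.X.tw_det]

def kS : SL where
  F := P.kF N q 1
  G := P.kF N q (-1)
  sF := P.kF_smooth N q _
  sG := P.kF_smooth N q _
  pF := P.kF_zper N q hN hq _
  pG := P.kF_zper N q hN hq _
  FG x := by have := P.kF_inv N q hN hq (-1) x; rwa [neg_neg] at this
  GF x := P.kF_inv N q hN hq 1 x
  dF := P.kF_det N q hN hq 1

def bq (t : ℝ) : ℝ := stp P.δ (wb N) (Qn N q * t)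
def cq (t : ℝ) : ℝ := stp P.δ (wc N) ((N : ℝ) ^ 2 * t)

lemma wb_stp (t : ℝ) (m : ℤ) : stp P.δ (wb N) (t + 2 * (N : ℝ) ^ 2 * m) = stp P.δ (wb N) t := by
  have := stp_per P.δ (w := wb N) (p := 2 * (N : ℤ) ^ 2 * m) (fun i => wb_per N m i) t
  push_cast at this
  exact this

lemma wc_stp (t : ℝ) (m : ℤ) : stp P.δ (wc N) (t + (N : ℝ) * m) = stp P.δ (wc N) t := by
  have := stp_per P.δ (w := wc N) (p := (N : ℤ) * m) (fun i => wc_per N m i) t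
  push_cast at this
  exact this

def gS : SL := SL.shV (P.bq N q) ((stp_smooth P.hδ _).comp (by fun_prop)) (by
  intro t m
  have := P.wb_stp N (Qn N q * t) (q * m)
  unfold bq
  rw [← this]; congr 1; simp only [Qn]; push_cast; ring)

def cS : SL := SL.shH (P.cq N) ((stp_smooth P.hδ _).comp (by fun_prop)) (by
  intro t m
  have := P.wc_stp N ((N : ℝ) ^ 2 * t) (N * m)
  unfold cq
  rw [← this]; congr 1; push_cast; ring)

def hS : SL := (P.cS N).comp ((P.gS N q).comp (P.kS N q hN hq))

lemma hS_F (x) : (P.hS N q hN hq).F x = (P.cS N).F ((P.gS N q).F (P.kF N q 1 x)) := rfl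

include hq in
lemma hS_shift (x : ℝ × ℝ) (j : ℤ) :
    (P.hS N q hN hq).F (x + ((j : ℝ) / q, 0)) = (P.hS N q hN hq).F x + ((j : ℝ) / q, 0) := by
  have hq' : (q : ℝ) ≠ 0 := by positivity
  rw [hS_F, hS_F, P.kF_shift N q hN hq 1 x ((j : ℝ) / q, 0) j 0 (by simp only [Qn]; field_simp) (by simp)]
  set z := P.kF N q 1 x
  have e : (P.gS N q).F (z + ((j : ℝ) / q, 0)) = (P.gS N q).F z + ((j : ℝ) / q, 0) := by
    show ((z.1 + (j : ℝ) / q, z.2 + 0 + P.bq N q (z.1 + (j : ℝ) / q)) : ℝ × ℝ) =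
      (z.1, z.2 + P.bq N q z.1) + ((j : ℝ) / q, 0)
    have : P.bq N q (z.1 + (j : ℝ) / q) = P.bq N q z.1 := by
      unfold bq
      rw [← P.wb_stp N (Qn N q * z.1) j]
      congr 1; simp only [Qn]; field_simp
    rw [this]; ext <;> simp
  rw [e]
  set w := (P.gS N q).F z
  show ((w.1 + (j : ℝ) / q + P.cq N (w.2 + 0), w.2 + 0) : ℝ × ℝ) =
      (w.1 + P.cq N w.2, w.2) + ((j : ℝ) / q, 0)
  ext <;> simp; ring

/-- shift index -/
def jj (N : ℕ) (i : ℤ) : ℤ := if Odd i then (i / 2) % ((N : ℤ) ^ 2) else 0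

lemma wb_jj (i : ℤ) : wb N i = jj N i / (N : ℝ) ^ 2 := by
  unfold wb jj; split_ifs <;> simp

/-- Good lifted points with their index data. -/
def Gd (x : ℝ × ℝ) (i l k : ℤ) : Prop :=
  (∃ c ∈ P.t, ‖cz (Qn N q • x - ((i : ℝ), (l : ℝ))) - c‖ < P.ρ * P.r c) ∧
    2 * P.δ < (N : ℝ) ^ 2 * x.2 - k ∧ (N : ℝ) ^ 2 * x.2 - k < 1 - 2 * P.δ

def RtL (φ : ℝ) : CL := LinearMap.toContinuousLinearMap
  { toFun := Rt φ
    map_add' := fun x y => by simp only [Rt]; ext <;> simp <;> ring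
    map_smul' := fun c x => by simp only [Rt]; ext <;> simp <;> ring }

lemma RtL_apply (φ v) : RtL φ v = Rt φ v := rfl

include hN hq in
lemma hS_good (h2q : 1 / (2 * (q : ℝ)) ≤ P.δ) {x : ℝ × ℝ} {i l k : ℤ} (hx : P.Gd N q x i l k) :
    (∃ e : ℝ × ℝ, |e.1| ≤ 1 / Qn N q ∧ |e.2| ≤ 1 / Qn N q ∧
      (P.hS N q hN hq).F x = x + e + (wc N (k + jj N i), wb N i)) ∧
    fderiv ℝ (P.hS N q hN hq).F x = RtL (thi N i l) := by
  obtain ⟨⟨c, hc, hd⟩, hk1, hk2⟩ := hx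
  have hQ := Qpos N q hN hq
  set d : P.X.ι := ((i, l), ⟨c, hc⟩) with hdd
  have hC : P.X.C d = ((i : ℝ) + c.re, (l : ℝ) + c.im) := rfl
  have hd1 : ‖cz (Qn N q • x - P.X.C d)‖ < P.X.ρ * P.X.R d := by rw [P.X_e]; exact hd
  have hth : (1 : ℝ) • P.th N = P.th N := one_smul _ _
  have htw := P.X.tw_good ((1 : ℝ) • P.th N) hd1
  have hthd : ((1 : ℝ) • P.th N) d = thi N i l := by rw [hth]; rfl
  rw [hthd] at htw
  set K : ℝ × ℝ → ℝ × ℝ := fun y => (Qn N q)⁻¹ • (P.X.C d + Rt (thi N i l) (Qn N q • y - P.X.C d)) with hK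
  have hkF : P.kF N q 1 =ᶠ[nhds x] K := by
    have hcont : Tendsto (fun y : ℝ × ℝ => Qn N q • y) (nhds x) (nhds (Qn N q • x)) :=
      (continuous_const_smul _).tendsto x
    filter_upwards [hcont.eventually htw] with y hy
    simp only [kF, hK]; rw [hy]
  have hKd : HasFDerivAt K (RtL (thi N i l)) x := by
    have h1 : HasFDerivAt (fun y : ℝ × ℝ => Qn N q • y - P.X.C d)
      (Qn N q • ContinuousLinearMap.id ℝ (ℝ × ℝ)) x :=
      ((hasFDerivAt_id x).const_smul (Qn N q)).sub_const _
    have h2 := (((RtL (thi N i l)).hasFDerivAt.comp x h1).const_add (P.X.C d)).const_smul (Qn N q)⁻¹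
    refine HasFDerivAt.congr_fderiv (f' := _) h2 ?_
    ext v <;> simp [hQ.ne']
  -- values
  set z := K x with hz
  have hzQ : Qn N q • z = P.X.C d + Rt (thi N i l) (Qn N q • x - P.X.C d) := by
    rw [hz, hK]; simp only; rw [smul_inv_smul₀ hQ.ne']
  have hzd : ‖cz (Qn N q • z - ((i : ℝ), (l : ℝ))) - c‖ < P.ρ * P.r c := by
    have := P.X_e (Qn N q • z) d
    simp only [hdd] at this
    rw [← this, ← hdd, hzQ, add_sub_cancel_left, cz_nrm_Rt]; exact hd1
  have m1 := P.disc_mem' hc hd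
  have m2 := P.disc_mem' hc hzd
  simp only [Prod.fst_sub, Prod.snd_sub, Prod.smul_fst, Prod.smul_snd, smul_eq_mul, mem_Ioo] at m1 m2
  have hδ := P.hδ
  have e1 : |z.1 - x.1| ≤ 1 / Qn N q := by
    have : |z.1 - x.1| * Qn N q = |(z.1 - x.1) * Qn N q| := by rw [abs_mul, abs_of_pos hQ]
    rw [le_div_iff₀ hQ, this, abs_le]
    constructor <;> nlinarith
  have e2 : |z.2 - x.2| ≤ 1 / Qn N q := by
    have : |z.2 - x.2| * Qn N q = |(z.2 - x.2) * Qn N q| := by rw [abs_mul, abs_of_pos hQ]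
    rw [le_div_iff₀ hQ, this, abs_le]
    constructor <;> nlinarith
  have hN2 : (0:ℝ) < (N : ℝ) ^ 2 := by positivity
  have e2' : |(N : ℝ) ^ 2 * z.2 - (N : ℝ) ^ 2 * x.2| ≤ P.δ := by
    rw [← mul_sub, abs_mul, abs_of_pos hN2]
    refine le_trans (mul_le_mul_of_nonneg_left e2 hN2.le) (le_trans (le_of_eq ?_) h2q)
    unfold Qn
    have : (q : ℝ) ≠ 0 := by positivity
    field_simp
  rw [abs_le] at e2'
  -- b is locally constant
  have hb : (fun y => P.bq N q (K y).1) =ᶠ[nhds x] fun _ => wb N i := by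
    have h1 := stp_good hδ (wb N) (t := Qn N q * z.1) (i := i) m2.1.1 m2.1.2
    have hcont : Tendsto (fun y => Qn N q * (K y).1) (nhds x) (nhds (Qn N q * z.1)) :=
      ((continuous_fst.continuousAt.comp hKd.continuousAt).const_mul _ : ContinuousAt _ _).tendsto
    filter_upwards [hcont.eventually h1] with y hy
    exact hy
  have hcc : (fun y => P.cq N ((K y).2 + wb N i)) =ᶠ[nhds x] fun _ => wc N (k + jj N i) := by
    have hbN : (N : ℝ) ^ 2 * (z.2 + wb N i) = (N : ℝ) ^ 2 * z.2 + jj N i := by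
      rw [wb_jj]; field_simp
    have h1 := stp_good hδ (wc N) (t := (N : ℝ) ^ 2 * (z.2 + wb N i)) (i := k + jj N i)
      (by rw [hbN]; push_cast; linarith) (by rw [hbN]; push_cast; linarith)
    have hcont : Tendsto (fun y => (N : ℝ) ^ 2 * ((K y).2 + wb N i)) (nhds x)
        (nhds ((N : ℝ) ^ 2 * (z.2 + wb N i))) :=
      (((continuous_snd.continuousAt.comp hKd.continuousAt).add continuousAt_const).const_mul _ :
        ContinuousAt _ _).tendsto
    filter_upwards [hcont.eventually h1] with y hy
    exact hy
  have hF : (P.hS N q hN hq).F =ᶠ[nhds x] fun y => K y + (wc N (k + jj N i), wb N i) := by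
    filter_upwards [hkF, hb, hcc] with y h1 h2 h3
    rw [hS_F, h1]
    show (((K y).1 + P.cq N ((K y).2 + P.bq N q (K y).1), (K y).2 + P.bq N q (K y).1) : ℝ × ℝ) = _
    rw [h2, h3]; ext <;> simp
  constructor
  · refine ⟨z - x, e1, e2, ?_⟩
    rw [hF.eq_of_nhds]; simp [hz]
  · rw [hF.fderiv_eq]
    exact (hKd.add_const _).fderiv

end Pk
end

noncomputable section
open MeasureTheory Filter Set

def ez (t : ℝ) : ℂ := Complex.exp (((2 * Real.pi * t : ℝ) : ℂ) * Complex.I)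

lemma ez_add (s t) : ez (s + t) = ez s * ez t := by
  unfold ez; rw [← Complex.exp_add]; congr 1; push_cast; ring
lemma ez_norm (t) : ‖ez t‖ = 1 := Complex.norm_exp_ofReal_mul_I _
lemma ez_int (n : ℤ) : ez n = 1 := by
  unfold ez; rw [Complex.exp_eq_one_iff]; exact ⟨n, by push_cast; ring⟩
lemma ez_add_int (t : ℝ) (n : ℤ) : ez (t + n) = ez t := by rw [ez_add, ez_int, mul_one]
lemma ez_congr {s t : ℝ} (n : ℤ) (h : s = t + n) : ez s = ez t := by rw [h, ez_add_int]
lemma ez_zpow (t : ℝ) (n : ℤ) : ez t ^ n = ez (n * t) := by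
  unfold ez; rw [← Complex.exp_int_mul]; congr 1; push_cast; ring
lemma ez_pow (t : ℝ) (n : ℕ) : ez t ^ n = ez (n * t) := by
  have := ez_zpow t n; simpa using this
lemma ez_zero : ez 0 = 1 := by simpa using ez_int 0
lemma ez_sub_one (t : ℝ) : ‖ez t - 1‖ ≤ 2 * Real.pi * |t| := by
  have := Real.norm_exp_I_mul_ofReal_sub_one_le (x := 2 * Real.pi * t)
  unfold ez; rw [mul_comm]
  refine this.trans (le_of_eq ?_)
  rw [Real.norm_eq_abs, abs_mul, abs_of_pos Real.two_pi_pos]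
lemma ez_half : ez (1 / 2) = -1 := by
  unfold ez; rw [← Complex.exp_pi_mul_I]; congr 2; push_cast; ring

lemma ez_gap {N : ℕ} (hN : 0 < N) {n : ℤ} (h0 : n ≠ 0) (hn : |n| < N) :
    1 / (N : ℝ) ≤ ‖1 - ez ((n : ℝ) / N)‖ := by
  set w := ez ((n : ℝ) / N) with hw
  have hNr : (0:ℝ) < N := by positivity
  have hwN : w ^ N = 1 := by
    rw [hw, ez_pow, mul_div_cancel₀ _ hNr.ne', ez_int]
  have hw1 : w ≠ 1 := by
    intro h
    rw [hw, ez, Complex.exp_eq_one_iff] at h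
    obtain ⟨m, hm⟩ := h
    have h2 : (n : ℝ) / N = m := by
      have h3 : ((2 * Real.pi * (n / N) : ℝ) : ℂ) * Complex.I = ((2 * Real.pi * m : ℝ) : ℂ) * Complex.I := by
        rw [hm]; push_cast; ring
      have h4 := mul_right_cancel₀ Complex.I_ne_zero h3
      have h5 : 2 * Real.pi * ((n : ℝ) / N) = 2 * Real.pi * m := by exact_mod_cast h4
      exact mul_left_cancel₀ Real.two_pi_pos.ne' h5
    rw [div_eq_iff hNr.ne'] at h2
    have h3 : n = m * N := by exact_mod_cast h2
    have : m ≠ 0 := by rintro rfl; simp at h3; exact h0 h3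
    have h4 : 1 ≤ |m| := Int.one_le_abs this
    rw [h3, abs_mul, Nat.abs_cast] at hn
    nlinarith
  have hs : ∑ j ∈ Finset.range N, w ^ j = 0 := by
    have := mul_neg_geom_sum w N
    rw [hwN, sub_self] at this
    exact (mul_eq_zero.1 this).resolve_left (sub_ne_zero.2 hw1.symm)
  have hj : ∀ j : ℕ, ‖1 - w ^ j‖ ≤ j * ‖1 - w‖ := by
    intro j
    induction j with
    | zero => simp
    | succ j ih =>
      have : 1 - w ^ (j+1) = (1 - w ^ j) + w ^ j * (1 - w) := by ring
      rw [this]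
      refine (norm_add_le _ _).trans ?_
      rw [norm_mul, norm_pow, hw, ez_norm, ← hw]
      push_cast; rw [one_pow]; linarith
  have h1 : ‖∑ j ∈ Finset.range N, (1 - w ^ j)‖ ≤ ∑ j ∈ Finset.range N, (N : ℝ) * ‖1 - w‖ := by
    refine (norm_sum_le _ _).trans (Finset.sum_le_sum fun j hjN => (hj j).trans ?_)
    gcongr
    exact (Finset.mem_range.1 hjN).le
  rw [Finset.sum_sub_distrib, hs] at h1
  simp at h1
  rw [div_le_iff₀ hNr]
  nlinarith

lemma EE_pro (a : ℤ × ℤ × ℤ) (z : ℝ × ℝ) (p : PP) :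
    EE a (pro z, p) = ez (a.1 * z.1 + a.2.1 * z.2) * chi p ^ a.2.2 := by
  rw [EE_apply]
  simp only [pro]
  rw [fourier_coe_apply, fourier_coe_apply, ← Complex.exp_add]
  congr 1
  unfold ez; congr 1; push_cast; ring

lemma RtL_inj (φ) : Function.Injective (Pk.RtL φ) := by
  intro v w h
  rw [Pk.RtL_apply, Pk.RtL_apply] at h
  rw [← Rt_neg φ v, h, Rt_neg]

lemma chi_Rt (s : ℝ) (p : PP) : chi (Pm (Pk.RtL (Real.pi * s)) (RtL_inj _) p) = ez s * chi p := by
  induction p using Projectivization.ind with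
  | h v hv =>
  rw [Pm_mk _ _ hv (inj_ne (RtL_inj _) hv), chi_mk, chi_mk, Pk.RtL_apply, chiV, chiV, cz_nrm_Rt]
  have : cz (Rt (Real.pi * s) v) = Complex.exp ((Real.pi * s : ℝ) * Complex.I) * cz v := by
    rw [Complex.exp_mul_I, ← Complex.ofReal_cos, ← Complex.ofReal_sin]
    apply Complex.ext <;> simp only [cz, Rt, Complex.mul_re, Complex.mul_im, Complex.add_re, Complex.add_im,
      Complex.ofReal_re, Complex.ofReal_im, Complex.I_re, Complex.I_im] <;> ring
  rw [this, mul_div_assoc, mul_pow, ← Complex.exp_nat_mul]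
  congr 1
  unfold ez; congr 1; push_cast; ring

lemma mp_Rt (φ) : MeasurePreserving (Pm (Pk.RtL φ) (RtL_inj _)) lam lam := by
  apply lam_inv
  · rw [det_formula]; simp [Pk.RtL_apply, Rt]
    have := Real.sin_sq_add_cos_sq φ; linarith
  · intro v
    have := nsq_Rt φ v
    simp only [nsq] at this
    show (Rt φ v).1 ^ 2 + (Rt φ v).2 ^ 2 < 1 ↔ v.1 ^ 2 + v.2 ^ 2 < 1
    rw [this]

/-- symmetries -/
def TT (t : ℝ × ℝ) (s : ℝ) : XX → XX :=
  Prod.map (fun x => x + pro t) (Pm (Pk.RtL (Real.pi * s)) (RtL_inj _))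

lemma mp_TT (t s) : MeasurePreserving (TT t s) mm mm :=
  ((measurePreserving_add_right (volume : Measure T1) (t.1 : T1)).prod
    (measurePreserving_add_right (volume : Measure T1) (t.2 : T1))).prod (mp_Rt _)

lemma pro_add (x t : ℝ × ℝ) : pro x + pro t = pro (x + t) := rfl

lemma TT_pro (t s) (x : ℝ × ℝ) (p) :
    TT t s (pro x, p) = (pro (x + t), Pm (Pk.RtL (Real.pi * s)) (RtL_inj _) p) := rfl

lemma EE_TT (a : ℤ × ℤ × ℤ) (t s y) : EE a (TT t s y) = ez (a.1 * t.1 + a.2.1 * t.2 + a.2.2 * s) * EE a y := by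
  obtain ⟨x, p⟩ := y
  obtain ⟨x, rfl⟩ := pro_surj x
  rw [TT_pro, EE_pro, EE_pro, chi_Rt, mul_zpow, ez_zpow]
  have : ez (a.1 * (x + t).1 + a.2.1 * (x + t).2) = ez (a.1 * x.1 + a.2.1 * x.2) * ez (a.1 * t.1 + a.2.1 * t.2) := by
    rw [← ez_add]; congr 1; simp; ring
  rw [this, ez_add (_ + _) (a.2.2 * s)]; ring

lemma EE_rot (a : ℤ × ℤ × ℤ) (τ y) : EE a ((SL.rot τ).ext y) = ez (a.1 * τ) * EE a y := by
  rw [SL.ext_rot, EE_apply, EE_apply]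
  have : fourier a.1 (y.1.1 + (τ : T1)) = ez (a.1 * τ) * fourier a.1 y.1.1 := by
    have h := (fourier_coe_apply (T := 1) (n := a.1) (x := τ))
    simp only [fourier_apply, smul_add, AddCircle.toCircle_add, Circle.coe_mul] at h ⊢
    rw [h, mul_comm]; congr 1; unfold ez; congr 1; push_cast; ring
  simp only [this]; ring

namespace Pk
variable (P : Pk) (N q : ℕ) (hN : 0 < N) (hq : 0 < q)

def jo (i : ℤ) : ℤ := if Odd i then i / 2 else 0
def lo (i l : ℤ) : ℤ := if Odd i then l else 0

def uu (N : ℕ) (a : ℤ × ℤ × ℤ) (i l k : ℤ) : ℝ :=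
  (a.1 * N * (k + jo i) + a.2.1 * jo i + a.2.2 * N * lo i l) / (N : ℝ) ^ 2

include hN hq in
lemma hgood (h2q : 1 / (2 * (q : ℝ)) ≤ P.δ) {x : ℝ × ℝ} {i l k : ℤ} (hx : P.Gd N q x i l k)
    (a : ℤ × ℤ × ℤ) (p : PP) :
    ‖EE a ((P.hS N q hN hq).ext (pro x, p)) - ez (uu N a i l k) * EE a (pro x, p)‖ ≤
      2 * Real.pi * (|(a.1 : ℝ)| + |(a.2.1 : ℝ)|) / Qn N q := by
  obtain ⟨⟨e, he1, he2, hF⟩, hD⟩ := P.hS_good N q hN hq h2q hx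
  have hNr : (0:ℝ) < N := by positivity
  obtain ⟨n1, hn1⟩ : ∃ n : ℤ, jj N i = jo i + N ^ 2 * n := by
    unfold jj jo
    split_ifs
    · exact ⟨-(i / 2 / (N:ℤ) ^ 2), by have := Int.emod_add_mul_ediv (i/2) ((N:ℤ)^2); linarith⟩
    · exact ⟨0, by simp⟩
  obtain ⟨n2, hn2⟩ : ∃ n : ℤ, wc N (k + jj N i) = ((k : ℝ) + jo i) / N + n := by
    refine ⟨N * n1 - (k + jj N i) / N, ?_⟩
    have h1 := Int.emod_add_mul_ediv (k + jj N i) (N : ℤ)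
    unfold wc
    have h2 : (((k + jj N i) % (N:ℤ) : ℤ) : ℝ) = k + jo i + N ^ 2 * n1 - N * ((k + jj N i) / (N:ℤ) : ℤ) := by
      have h3 : (k + jj N i) % (N:ℤ) = k + jo i + N ^ 2 * n1 - N * ((k + jj N i) / (N:ℤ)) := by
        linarith
      rw [h3]; push_cast; ring
    rw [h2]; push_cast; field_simp; ring
  obtain ⟨σ, n3, hσ, hn3⟩ : ∃ (σ : ℝ) (n : ℤ), thi N i l = Real.pi * σ ∧ σ = (lo i l : ℝ) / N + n := by
    unfold thi lo
    split_ifs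
    · refine ⟨((l % (N : ℤ) : ℤ) : ℝ) / N, -(l / N), by ring, ?_⟩
      have h1 := Int.emod_add_mul_ediv l (N : ℤ)
      have h3 : l % (N:ℤ) = l - N * (l / (N:ℤ)) := by linarith
      rw [h3]; push_cast; field_simp; ring
    · exact ⟨0, 0, by simp, by simp⟩
  have hext : (P.hS N q hN hq).ext (pro x, p) =
      (pro (x + e + (wc N (k + jj N i), wb N i)), Pm (RtL (Real.pi * σ)) (RtL_inj _) p) := by
    induction p using Projectivization.ind with
    | h v hv =>
    rw [SL.ext_mk, hF, Pm_mk _ _ hv (inj_ne (RtL_inj _) hv)]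
    congr 2
    rw [hD, hσ]
  rw [hext, EE_pro, EE_pro, chi_Rt, mul_zpow, ez_zpow]
  have h1 : ez (a.1 * (x + e + (wc N (k + jj N i), wb N i)).1 +
      a.2.1 * (x + e + (wc N (k + jj N i), wb N i)).2) * (ez (a.2.2 * σ) * chi p ^ a.2.2)
      = ez (a.1 * e.1 + a.2.1 * e.2) *
        (ez (uu N a i l k) * (ez (a.1 * x.1 + a.2.1 * x.2) * chi p ^ a.2.2)) := by
    have h2 : ez (a.1 * (x + e + (wc N (k + jj N i), wb N i)).1 +
      a.2.1 * (x + e + (wc N (k + jj N i), wb N i)).2 + a.2.2 * σ) = ez (a.1 * e.1 + a.2.1 * e.2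
        + uu N a i l k + (a.1 * x.1 + a.2.1 * x.2)) := by
      apply ez_congr (a.1 * n2 + a.2.1 * n1 + a.2.2 * n3)
      simp only [Prod.fst_add, Prod.snd_add]
      rw [wb_jj, hn3, hn2, hn1, uu]
      push_cast; field_simp; ring
    rw [ez_add _ (a.2.2 * σ), ez_add _ (a.1 * x.1 + _), ez_add _ (uu N a i l k)] at h2
    linear_combination chi p ^ a.2.2 * h2
  rw [h1]
  set A := ez (uu N a i l k) * (ez (a.1 * x.1 + a.2.1 * x.2) * chi p ^ a.2.2) with hA
  have hA1 : ‖A‖ = 1 := by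
    rw [hA, norm_mul, norm_mul, ez_norm, ez_norm, norm_zpow, norm_chi]; simp
  have : ez (a.1 * e.1 + a.2.1 * e.2) * A - A = (ez (a.1 * e.1 + a.2.1 * e.2) - 1) * A := by ring
  rw [this, norm_mul, hA1, mul_one]
  refine (ez_sub_one _).trans ?_
  rw [mul_div_assoc]
  refine mul_le_mul_of_nonneg_left ?_ Real.two_pi_pos.le
  refine (abs_add_le _ _).trans ?_
  rw [abs_mul, abs_mul, add_div, div_eq_mul_one_div, div_eq_mul_one_div (|(a.2.1 : ℝ)|)]
  gcongr

/-- good set on the torus -/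
def W2 : Set (ℝ × ℝ) := {z | cz z ∈ P.W}

def Gs : Set T2 := {x | ((2 * N ^ 2 * q) • x.1, (2 * N ^ 2 * q) • x.2) ∈ pro '' P.W2 ∧
  (N ^ 2) • x.2 ∈ ((↑) : ℝ → T1) '' Ioo (2 * P.δ) (1 - 2 * P.δ)}

lemma open_W2 : IsOpen P.W2 := by
  apply IsOpen.preimage continuous_cz
  unfold W
  exact isOpen_biUnion fun c _ => Metric.isOpen_ball

lemma W2_sub : P.W2 ⊆ SL.DD := by
  intro z hz
  have hz : cz z ∈ P.W := hz
  simp only [W, mem_iUnion] at hz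
  obtain ⟨c, hc, h⟩ := hz
  have := P.disc_mem' hc (z := z) (by rwa [Metric.mem_ball, dist_eq_norm] at h)
  have hδ := P.hδ
  exact ⟨⟨by linarith [this.1.1], by linarith [this.1.2]⟩, ⟨by linarith [this.2.1], by linarith [this.2.2]⟩⟩

lemma vol_W2 : volume P.W2 = volume P.W := by
  have h : P.W2 = Complex.measurableEquivRealProd.symm ⁻¹' P.W := by
    ext z; rfl
  rw [h, Complex.volume_preserving_equiv_real_prod.symm.measure_preimage_equiv]

lemma vol_pW2 : volume P.W ≤ volume (pro '' P.W2) := by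
  have ho : IsOpen (pro '' P.W2) := isOpenQuot_pro.isOpenMap _ P.open_W2
  rw [← SL.mp_pro.measure_preimage ho.measurableSet.nullMeasurableSet,
    Measure.restrict_apply (continuous_pro.measurable ho.measurableSet), ← P.vol_W2]
  exact measure_mono fun z hz => ⟨⟨z, hz, rfl⟩, P.W2_sub hz⟩

lemma vol_coe (d : ℝ) (hd : 0 ≤ d) : ENNReal.ofReal (1 - 2 * d) ≤ volume (((↑) : ℝ → T1) '' Ioo d (1 - d)) := by
  have ho : IsOpen (((↑) : ℝ → T1) '' Ioo d (1 - d)) :=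
    (QuotientAddGroup.isOpenQuotientMap_mk).isOpenMap _ isOpen_Ioo
  rw [← (AddCircle.measurePreserving_mk 1 0).measure_preimage ho.measurableSet.nullMeasurableSet,
    Measure.restrict_apply (AddCircle.measurable_mk' ho.measurableSet)]
  have h1 : ENNReal.ofReal (1 - 2 * d) = volume (Ioo d (1 - d)) := by
    rw [Real.volume_Ioo]; congr 1; ring
  rw [h1]
  refine measure_mono fun z hz => ⟨⟨z, hz, rfl⟩, ⟨by linarith [hz.1], by linarith [hz.2]⟩⟩

lemma Gs_good {x : ℝ × ℝ} (hx : pro x ∈ P.Gs N q) : ∃ i l k, P.Gd N q x i l k := by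
  obtain ⟨⟨w, hw, hwx⟩, ⟨v, hv, hvx⟩⟩ := hx
  have e1 : pro w = pro (Qn N q • x) := by
    rw [hwx]
    have : ∀ y : ℝ, (2 * N ^ 2 * q) • (y : T1) = ((Qn N q * y : ℝ) : T1) := by
      intro y
      rw [← AddCircle.coe_nsmul, nsmul_eq_mul]; congr 1; simp [Qn]
    simp only [pro, this]; rfl
  obtain ⟨m, hm⟩ := pro_eq.1 e1
  have e2 : pro (0, v) = pro (0, (N : ℝ) ^ 2 * x.2) := by
    have : (v : T1) = (((N : ℝ) ^ 2 * x.2 : ℝ) : T1) := by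
      rw [hvx]
      show (N ^ 2) • ((x.2 : ℝ) : T1) = _
      rw [← AddCircle.coe_nsmul, nsmul_eq_mul]; congr 1; push_cast; ring
    simp [pro, this]
  obtain ⟨k, hk⟩ := pro_eq.1 e2
  have hk := congrArg Prod.snd hk
  simp only at hk
  refine ⟨m.1, m.2, k.2, ?_, by rw [hk]; linarith [hv.1], by rw [hk]; linarith [hv.2]⟩
  have hw : cz w ∈ P.W := hw
  simp only [W, mem_iUnion] at hw
  obtain ⟨c, hc, h⟩ := hw
  refine ⟨c, hc, ?_⟩
  rw [Metric.mem_ball, dist_eq_norm] at h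
  rw [hm]
  have e3 : ((w.1 + (m.1 : ℝ), w.2 + (m.2 : ℝ)) : ℝ × ℝ) - ((m.1 : ℝ), (m.2 : ℝ)) = w := by
    ext <;> simp
  rw [e3]; exact h

lemma Gs_meas : MeasurableSet (P.Gs N q) := by
  have ho : IsOpen (pro '' P.W2) := isOpenQuot_pro.isOpenMap _ P.open_W2
  have ho2 : IsOpen (((↑) : ℝ → T1) '' Ioo (2 * P.δ) (1 - 2 * P.δ)) :=
    (QuotientAddGroup.isOpenQuotientMap_mk).isOpenMap _ isOpen_Ioo
  apply IsOpen.measurableSet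
  exact (ho.preimage (by fun_prop)).inter (ho2.preimage (by fun_prop))

include hN hq in
lemma Gs_vol {ε : ℝ} (h1 : P.δ ≤ ε) (h2 : ENNReal.ofReal (1 - ε) ≤ volume P.W) (hN2 : 1 < N) :
    (volume : Measure T2).real (P.Gs N q)ᶜ ≤ 5 * ε := by
  have ho : IsOpen (pro '' P.W2) := isOpenQuot_pro.isOpenMap _ P.open_W2
  have ho2 : IsOpen (((↑) : ℝ → T1) '' Ioo (2 * P.δ) (1 - 2 * P.δ)) :=
    (QuotientAddGroup.isOpenQuotientMap_mk).isOpenMap _ isOpen_Ioo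
  have hQ1 : 1 < 2 * N ^ 2 * q := by nlinarith [Nat.one_le_pow 2 N hN]
  have hN1 : 1 < N ^ 2 := by nlinarith
  have m1 := (AddCircle.ergodic_nsmul (T := 1) hQ1).toMeasurePreserving
  have m2 := (AddCircle.ergodic_nsmul (T := 1) hN1).toMeasurePreserving
  have m3 := m1.prod m1
  have m4 : MeasurePreserving (fun x : T2 => (N ^ 2) • x.2) volume volume :=
    m2.comp (measurePreserving_snd (μ := (volume : Measure T1)) (ν := (volume : Measure T1)))
  have c1 := m3.measureReal_preimage (ho.measurableSet.nullMeasurableSet)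
  have c2 := m4.measureReal_preimage (ho2.measurableSet.nullMeasurableSet)
  have hδ := P.hδ
  have b1 : 1 - ε ≤ (volume : Measure T2).real (pro '' P.W2) :=
    (ENNReal.ofReal_le_iff_le_toReal (measure_ne_top _ _)).1 (h2.trans P.vol_pW2)
  have b2 : 1 - 4 * ε ≤ (volume : Measure T1).real (((↑) : ℝ → T1) '' Ioo (2 * P.δ) (1 - 2 * P.δ)) := by
    have := (ENNReal.ofReal_le_iff_le_toReal (measure_ne_top _ _)).1 (vol_coe (2 * P.δ) (by linarith))
    refine le_trans ?_ this
    linarith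
  set A := Prod.map (fun y : T1 => (2 * N ^ 2 * q) • y) (fun y : T1 => (2 * N ^ 2 * q) • y) ⁻¹' (pro '' P.W2) with hA
  set B := (fun x : T2 => (N ^ 2) • x.2) ⁻¹' (((↑) : ℝ → T1) '' Ioo (2 * P.δ) (1 - 2 * P.δ)) with hB
  have hG : (P.Gs N q)ᶜ = Aᶜ ∪ Bᶜ := by
    rw [← compl_inter]; rfl
  have hAm : MeasurableSet A := m3.measurable ho.measurableSet
  have hBm : MeasurableSet B := m4.measurable ho2.measurableSet
  rw [hG]
  refine (measureReal_union_le _ _).trans ?_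
  rw [probReal_compl_eq_one_sub hAm, probReal_compl_eq_one_sub hBm]
  have c1' : (volume : Measure T2).real A = (volume : Measure T2).real (pro '' P.W2) := c1
  rw [c1', c2]
  linarith

end Pk
end

noncomputable section
open MeasureTheory Filter Set

lemma approx_sym {X : Type*} [MeasurableSpace X] {m : Measure X} [IsProbabilityMeasure m] {T : X → X}
    (hT : MeasurePreserving T m m) {O : Set X} (hO : MeasurableSet O) (hTO : ∀ y, T y ∈ O ↔ y ∈ O)
    {Ψ : X → ℂ} (hm : Measurable Ψ) (h1 : ∀ y, ‖Ψ y‖ ≤ 1) {B : Set X} (hB : MeasurableSet B) {ζ : ℂ}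
    (hζ : ‖ζ‖ = 1) {e : ℝ} (he : 0 ≤ e) (h : ∀ y ∈ O, y ∉ B → ‖Ψ (T y) - ζ * Ψ y‖ ≤ e) :
    ‖∫ y in O, Ψ y ∂m‖ * ‖1 - ζ‖ ≤ e + 2 * m.real B := by
  set Φ := O.indicator Ψ with hΦ
  have hΦm : Measurable Φ := hm.indicator hO
  have hΦ1 : ∀ y, ‖Φ y‖ ≤ 1 := fun y => by
    rw [hΦ]; exact (norm_indicator_le_norm_self _ _).trans (h1 y)
  have hi : Integrable Φ m := Integrable.of_bound hΦm.aestronglyMeasurable 1 (ae_of_all _ hΦ1)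
  have hiT : Integrable (fun y => Φ (T y)) m := hT.integrable_comp_of_integrable hi
  have e1 : ∫ y, Φ (T y) ∂m = ∫ y, Φ y ∂m := by
    conv_rhs => rw [← hT.map_eq]
    rw [integral_map hT.measurable.aemeasurable hΦm.aestronglyMeasurable]
  have e2 : (1 - ζ) * ∫ y, Φ y ∂m = ∫ y, (Φ (T y) - ζ * Φ y) ∂m := by
    rw [integral_sub hiT (hi.const_mul ζ), e1, integral_const_mul]; ring
  rw [← integral_indicator hO, mul_comm, ← norm_mul, e2]
  have hb : ∀ y, ‖Φ (T y) - ζ * Φ y‖ ≤ e + B.indicator (fun _ => (2:ℝ)) y := by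
    intro y
    by_cases hyB : y ∈ B
    · rw [indicator_of_mem hyB]
      refine (norm_sub_le _ _).trans ?_
      rw [norm_mul, hζ]; linarith [hΦ1 y, hΦ1 (T y)]
    · rw [indicator_of_notMem hyB, add_zero]
      by_cases hy : y ∈ O
      · rw [hΦ, indicator_of_mem hy, indicator_of_mem ((hTO y).2 hy)]; exact h y hy hyB
      · rw [hΦ, indicator_of_notMem hy, indicator_of_notMem (fun h' => hy ((hTO y).1 h'))]; simpa using he
  refine (norm_integral_le_of_norm_le (g := fun y => e + B.indicator (fun _ => (2:ℝ)) y)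
    ((integrable_const e).add ((integrable_const _).indicator hB)) (ae_of_all _ hb)).trans (le_of_eq ?_)
  rw [integral_add (integrable_const e) ((integrable_const _).indicator hB), integral_indicator hB]
  simp [mul_comm]

lemma prod_close {A B A' B' : ℂ} {E : ℝ} (hA' : ‖A'‖ = 1) (hB : ‖B‖ = 1) (h1 : ‖A - A'‖ ≤ E)
    (h2 : ‖B - B'‖ ≤ E) : ‖A * B - A' * B'‖ ≤ 2 * E := by
  have : A * B - A' * B' = (A - A') * B + A' * (B - B') := by ring
  rw [this]
  refine (norm_add_le _ _).trans ?_
  rw [norm_mul, norm_mul, hA', hB]; linarith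

namespace Pk
variable (P : Pk) (N q : ℕ) (hN : 0 < N) (hq : 0 < q)

def Od : Set XX := {y | (fourier ((N ^ 2 * q : ℕ) : ℤ) y.1.1 : ℂ).im < 0}

lemma Od_pro (x : ℝ × ℝ) (p) : (pro x, p) ∈ Od N q ↔ Real.sin (Real.pi * (Qn N q * x.1)) < 0 := by
  show (fourier ((N ^ 2 * q : ℕ) : ℤ) ((x.1 : ℝ) : T1) : ℂ).im < 0 ↔ _
  rw [fourier_coe_apply]
  have : 2 * (Real.pi : ℂ) * Complex.I * (((N ^ 2 * q : ℕ) : ℤ) : ℂ) * (x.1 : ℂ) / ((1 : ℝ) : ℂ) =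
    ((Real.pi * (Qn N q * x.1) : ℝ) : ℂ) * Complex.I := by
    simp only [Qn]; push_cast; ring
  rw [this, Complex.exp_ofReal_mul_I_im]

lemma meas_Od : MeasurableSet (Od N q) := by
  apply IsOpen.measurableSet
  apply isOpen_lt _ continuous_const
  fun_prop

lemma Od_TT (t : ℝ × ℝ) (s : ℝ) (d : ℤ) (h : Qn N q * t.1 = 2 * d) (y) : TT t s y ∈ Od N q ↔ y ∈ Od N q := by
  obtain ⟨x, p⟩ := y
  obtain ⟨x, rfl⟩ := pro_surj x
  rw [TT_pro, Od_pro, Od_pro]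
  have : Real.pi * (Qn N q * (x + t).1) = Real.pi * (Qn N q * x.1) + d * (2 * Real.pi) := by
    simp only [Prod.fst_add]; rw [mul_add (Qn N q), h]; ring
  rw [this, Real.sin_add_int_mul_two_pi]

lemma Gd_loc {x : ℝ × ℝ} {i l k : ℤ} (h : P.Gd N q x i l k) :
    Qn N q * x.1 - i ∈ Ioo P.δ (1 - P.δ) ∧ Qn N q * x.2 - l ∈ Ioo P.δ (1 - P.δ) ∧
    (N : ℝ) ^ 2 * x.2 - k ∈ Ioo P.δ (1 - P.δ) := by
  obtain ⟨⟨c, hc, hd⟩, h1, h2⟩ := h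
  have := P.disc_mem' hc hd
  have hδ := P.hδ
  exact ⟨this.1, this.2, by linarith, by linarith⟩

lemma idx {A B δ : ℝ} {m n D : ℤ} (h1 : A - m ∈ Ioo δ (1 - δ)) (h2 : B - n ∈ Ioo δ (1 - δ))
    (h : |B - A - D| < 2 * δ) : n = m + D := by
  rw [abs_lt] at h
  have a1 : ((n - m - D : ℤ) : ℝ) < (1 : ℤ) := by push_cast; linarith [h1.1, h1.2, h2.1, h2.2, h.1, h.2]
  have a2 : ((-1 : ℤ) : ℝ) < ((n - m - D : ℤ) : ℝ) := by
    push_cast; linarith [h1.1, h1.2, h2.1, h2.2, h.1, h.2]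
  have a1 := Int.cast_lt.1 a1
  have a2 := Int.cast_lt.1 a2
  omega

lemma Od_odd {x : ℝ × ℝ} {i l k : ℤ} (h : P.Gd N q x i l k) (p) : (pro x, p) ∈ Od N q ↔ Odd i := by
  have h1 := (P.Gd_loc N q h).1
  have hδ := P.hδ
  rw [Od_pro]
  set f := Qn N q * x.1 - i with hf
  have hs : 0 < Real.sin (Real.pi * f) := Real.sin_pos_of_pos_of_lt_pi
    (mul_pos Real.pi_pos (by linarith [h1.1])) (by nlinarith [Real.pi_pos, h1.2])
  have e : Real.pi * (Qn N q * x.1) = Real.pi * f + i * Real.pi := by rw [hf]; ring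
  rw [e, Real.sin_add_int_mul_pi]
  rcases Int.even_or_odd i with hi | hi
  · rw [hi.neg_one_zpow]
    simp only [one_mul, Int.not_odd_iff_even.2 hi, iff_false]; linarith
  · rw [hi.neg_one_zpow]; simp only [hi, iff_true]; linarith

lemma jo_odd {i : ℤ} (h : Odd i) (d : ℤ) : jo (i + 2 * d) = jo i + d := by
  have : Odd (i + 2 * d) := h.add_even (even_two_mul d)
  simp only [jo, h, this, if_true]; omega
lemma jo_even {i : ℤ} (h : Even i) : jo i = 0 := by
  simp [jo, h]

lemma lo_odd {i : ℤ} (h : Odd i) (l : ℤ) : lo i l = l := by simp [lo, h]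
lemma lo_even {i : ℤ} (h : Even i) (l) : lo i l = 0 := by simp [lo, h]

/-- correlation integrand -/
def Psi (τ : ℝ) (a a' : ℤ × ℤ × ℤ) (y : XX) : ℂ :=
  EE a ((P.hS N q hN hq).ext ((SL.rot τ).ext y)) * EE a' ((P.hS N q hN hq).ext y)

def zz (N : ℕ) (a a' c : ℤ × ℤ × ℤ) (t : ℝ × ℝ) (ρ : ℝ) (d Δl Δk : ℤ) : ℝ :=
  (a.1 + a'.1) * Δk / N + ((c.1 * N + c.2.1) * d + c.2.2 * N * Δl) / (N : ℝ) ^ 2 +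
    ((a.1 + a'.1) * t.1 + (a.2.1 + a'.2.1) * t.2 + (a.2.2 + a'.2.2) * ρ)

def badS : Set XX := {y | y.1 ∉ P.Gs N q}

lemma sym_step (h2q : 1 / (2 * (q : ℝ)) ≤ P.δ) {s : ℤ} (hs : s = 1 ∨ s = -1) {τ : ℝ}
    (hτ : |Qn N q * τ - s| < 2 * P.δ) {a a' c : ℤ × ℤ × ℤ} {t : ℝ × ℝ} {ρ : ℝ} {d Δl Δk : ℤ}
    (ht1 : Qn N q * t.1 = 2 * d) (ht2 : Qn N q * t.2 = Δl)
    (hk : (N : ℝ) ^ 2 * t.2 = Δk ∨ (a.1 = 0 ∧ a'.1 = 0)) {E : ℝ}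
    (hE : 2 * Real.pi * (|(a.1 : ℝ)| + |(a.2.1 : ℝ)|) / Qn N q ≤ E)
    (hE' : 2 * Real.pi * (|(a'.1 : ℝ)| + |(a'.2.1 : ℝ)|) / Qn N q ≤ E) {y : XX}
    (hc : (y ∈ Od N q ∧ c = a') ∨ (y ∉ Od N q ∧ c = a))
    (g1 : y ∉ P.badS N q) (g2 : (SL.rot τ).ext y ∉ P.badS N q) (g3 : TT t ρ y ∉ P.badS N q)
    (g4 : (SL.rot τ).ext (TT t ρ y) ∉ P.badS N q) :
    ‖P.Psi N q hN hq τ a a' (TT t ρ y) - ez (zz N a a' c t ρ d Δl Δk) * P.Psi N q hN hq τ a a' y‖ ≤ 4 * E := by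
  have hNr : (0:ℝ) < N := by positivity
  have hδ := P.hδ
  have hrot : ∀ (z : ℝ × ℝ) (p : PP), (SL.rot τ).ext (pro z, p) = (pro (z + (τ, 0)), p) := by
    intro z p
    rw [SL.ext_rot]; simp [pro]
  obtain ⟨x, p⟩ := y
  obtain ⟨x, rfl⟩ := pro_surj x
  have R1 := EE_rot a τ (pro x, p)
  have R2 := EE_rot a τ (TT t ρ (pro x, p))
  rw [EE_TT] at R2
  have R3 := EE_TT a' t ρ (pro x, p)
  simp only [Psi]
  rw [hrot] at g2 R1 ⊢
  rw [TT_pro] at g3 g4 R2 R3 ⊢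
  rw [hrot] at g4 R2 ⊢
  simp only [badS, mem_ofPred_eq, not_not] at g1 g2 g3 g4
  set p' := Pm (RtL (Real.pi * ρ)) (RtL_inj _) p
  obtain ⟨i1, l1, k1, G1⟩ := P.Gs_good N q g1
  obtain ⟨i2, l2, k2, G2⟩ := P.Gs_good N q g2
  obtain ⟨i3, l3, k3, G3⟩ := P.Gs_good N q g3
  obtain ⟨i4, l4, k4, G4⟩ := P.Gs_good N q g4
  have L1 := P.Gd_loc N q G1
  have L2 := P.Gd_loc N q G2
  have L3 := P.Gd_loc N q G3
  have L4 := P.Gd_loc N q G4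
  have z2 : |(0:ℝ)| < 2 * P.δ := by simpa using hδ
  have I2 : i2 = i1 + s := idx L1.1 L2.1 (by
    convert hτ using 2; simp only [Prod.fst_add]; ring)
  have I3 : i3 = i1 + 2 * d := idx L1.1 L3.1 (by
    convert z2 using 2; simp only [Prod.fst_add]; push_cast; linarith)
  have I4 : i4 = i1 + 2 * d + s := by rw [← I3]; exact idx L3.1 L4.1 (by
    convert hτ using 2; simp only [Prod.fst_add]; ring)
  have J2 : l2 = l1 := by simpa using idx (D := 0) L1.2.1 L2.2.1 (by
    convert z2 using 2; simp only [Prod.snd_add]; push_cast; ring)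
  have J3 : l3 = l1 + Δl := idx L1.2.1 L3.2.1 (by
    convert z2 using 2; simp only [Prod.snd_add]; linarith)
  have J4 : l4 = l3 := by simpa using idx (D := 0) L3.2.1 L4.2.1 (by
    convert z2 using 2; simp only [Prod.snd_add]; push_cast; ring)
  have K2 : k2 = k1 := by simpa using idx (D := 0) L1.2.2 L2.2.2 (by
    convert z2 using 2; simp only [Prod.snd_add]; push_cast; ring)
  have K4 : k4 = k3 := by simpa using idx (D := 0) L3.2.2 L4.2.2 (by
    convert z2 using 2; simp only [Prod.snd_add]; push_cast; ring)
  have K3 : k3 = k1 + Δk ∨ (a.1 = 0 ∧ a'.1 = 0) := hk.imp_left fun h => idx L1.2.2 L3.2.2 (by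
    convert z2 using 2; simp only [Prod.snd_add]; linarith)
  have H1 := (P.hgood N q hN hq h2q G1 a' p).trans hE'
  have H2 := (P.hgood N q hN hq h2q G2 a p).trans hE
  have H3 := (P.hgood N q hN hq h2q G3 a' p').trans hE'
  have H4 := (P.hgood N q hN hq h2q G4 a p').trans hE
  have C1 := prod_close (by rw [norm_mul, ez_norm, EE_norm, one_mul]) (EE_norm _ _) H2 H1
  have C2 := prod_close (by rw [norm_mul, ez_norm, EE_norm, one_mul]) (EE_norm _ _) H4 H3
  have hso : Odd s := by rcases hs with rfl | rfl <;> decide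
  have hph : uu N a i4 l4 k4 + uu N a' i3 l3 k3 + (a.1 * t.1 + a.2.1 * t.2 + a.2.2 * ρ) +
     (a'.1 * t.1 + a'.2.1 * t.2 + a'.2.2 * ρ) = zz N a a' c t ρ d Δl Δk + uu N a i2 l2 k2 +
      uu N a' i1 l1 k1 := by
    rw [P.Od_odd N q G1] at hc
    rw [I4, I3, I2, J4, J3, J2, K4, K2]
    rcases hc with ⟨ho, rfl⟩ | ⟨ho, rfl⟩
    · have e1 : Even (i1 + s) := ho.add_odd hso
      have e2 : Even (i1 + 2 * d + s) := (ho.add_even (even_two_mul d)).add_odd hso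
      have e3 : Odd (i1 + 2 * d) := ho.add_even (even_two_mul d)
      simp only [uu, zz, jo_odd ho, jo_even e1, jo_even e2, lo_odd ho, lo_even e1, lo_even e2, lo_odd e3]
      rcases K3 with h | ⟨h, h'⟩
      · rw [h]; push_cast; field_simp; ring
      · rw [h, h']; push_cast; field_simp; ring
    · rw [Int.not_odd_iff_even] at ho
      have e1 : Odd (i1 + s) := ho.add_odd hso
      have e2 : Odd (i1 + s + 2 * d) := e1.add_even (even_two_mul d)
      have e3 : Even (i1 + 2 * d) := ho.add (even_two_mul d)
      have e4 : i1 + 2 * d + s = i1 + s + 2 * d := by ring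
      rw [e4]
      simp only [uu, zz, jo_odd e1, jo_even ho, jo_even e3, lo_odd e1, lo_even ho, lo_even e3, lo_odd e2]
      rcases K3 with h | ⟨h, h'⟩
      · rw [h]; push_cast; field_simp; ring
      · rw [h, h']; push_cast; field_simp; ring
  have hph := congrArg ez hph
  rw [ez_add, ez_add, ez_add, ez_add _ (uu N a' i1 l1 k1), ez_add _ (uu N a i2 l2 k2)] at hph
  have key : ez (uu N a i4 l4 k4) * EE a (pro (x + t + (τ, 0)), p') * (ez (uu N a' i3 l3 k3) * EE a' (pro (x + t), p'))
    = ez (zz N a a' c t ρ d Δl Δk) * (ez (uu N a i2 l2 k2) * EE a (pro (x + (τ, 0)), p) *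
      (ez (uu N a' i1 l1 k1) * EE a' (pro x, p))) := by
    rw [R1, R2, R3]
    linear_combination (ez (a.1 * τ) * EE a (pro x, p) * EE a' (pro x, p)) * hph
  have e5 : ∀ A B C D Z : ℂ, C = Z * D → ‖A - C‖ ≤ 2 * E → ‖B - D‖ ≤ 2 * E → ‖Z‖ = 1 → ‖A - Z * B‖ ≤ 4 * E := by
    intro A B C D Z h1 h2 h3 h4
    have : A - Z * B = (A - C) - Z * (B - D) := by rw [h1]; ring
    rw [this]
    refine (norm_sub_le _ _).trans ?_
    rw [norm_mul, h4]; linarith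
  exact e5 _ _ _ _ _ key C2 C1 (ez_norm _)

lemma bad_meas : MeasurableSet (P.badS N q) := measurable_fst (P.Gs_meas N q).compl

lemma bad_vol : mm.real (P.badS N q) = (volume : Measure T2).real (P.Gs N q)ᶜ :=
  (measurePreserving_fst (μ := (volume : Measure T2)) (ν := lam)).measureReal_preimage
    (P.Gs_meas N q).compl.nullMeasurableSet

lemma sym_int (h2q : 1 / (2 * (q : ℝ)) ≤ P.δ) {s : ℤ} (hs : s = 1 ∨ s = -1) {τ : ℝ}
    (hτ : |Qn N q * τ - s| < 2 * P.δ) {a a' : ℤ × ℤ × ℤ} (t : ℝ × ℝ) (ρ : ℝ) (d Δl Δk : ℤ)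
    (ht1 : Qn N q * t.1 = 2 * d) (ht2 : Qn N q * t.2 = Δl)
    (hk : (N : ℝ) ^ 2 * t.2 = Δk ∨ (a.1 = 0 ∧ a'.1 = 0)) {E : ℝ} (hE0 : 0 ≤ E)
    (hE : 2 * Real.pi * (|(a.1 : ℝ)| + |(a.2.1 : ℝ)|) / Qn N q ≤ E)
    (hE' : 2 * Real.pi * (|(a'.1 : ℝ)| + |(a'.2.1 : ℝ)|) / Qn N q ≤ E) {κ : ℝ} (hκ : 0 < κ)
    (hz : ∀ c, c = a ∨ c = a' → κ ≤ ‖1 - ez (zz N a a' c t ρ d Δl Δk)‖) :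
    ‖∫ y, P.Psi N q hN hq τ a a' y ∂mm‖ ≤ 2 * (4 * E + 8 * mm.real (P.badS N q)) / κ := by
  have hmh := (P.hS N q hN hq).continuous_ext
  have hmr := (SL.rot τ).continuous_ext
  have hΨ : Continuous (P.Psi N q hN hq τ a a') := by unfold Psi; fun_prop
  have hΨ1 : ∀ y, ‖P.Psi N q hN hq τ a a' y‖ ≤ 1 := by
    intro y; simp [Psi, EE_norm]
  have hT := mp_TT t ρ
  have hR := SL.mp_rot τ
  set b := P.badS N q
  have hb : MeasurableSet b := P.bad_meas N q
  set B := b ∪ (SL.rot τ).ext ⁻¹' b ∪ TT t ρ ⁻¹' b ∪ ((SL.rot τ).ext ∘ TT t ρ) ⁻¹' b with hB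
  have hBm : MeasurableSet B := ((hb.union (hR.measurable hb)).union (hT.measurable hb)).union
    ((hR.measurable.comp hT.measurable) hb)
  have hBv : mm.real B ≤ 4 * mm.real b := by
    rw [hB]
    have u1 := measureReal_union_le (μ := mm) (b ∪ (SL.rot τ).ext ⁻¹' b ∪ TT t ρ ⁻¹' b) (((SL.rot τ).ext ∘ TT t ρ) ⁻¹' b)
    have u2 := measureReal_union_le (μ := mm) (b ∪ (SL.rot τ).ext ⁻¹' b) (TT t ρ ⁻¹' b)
    have u3 := measureReal_union_le (μ := mm) b ((SL.rot τ).ext ⁻¹' b)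
    rw [(hR.comp hT).measureReal_preimage hb.nullMeasurableSet] at u1
    rw [hT.measureReal_preimage hb.nullMeasurableSet] at u2
    rw [hR.measureReal_preimage hb.nullMeasurableSet] at u3
    linarith
  have main : ∀ (O : Set XX) (c : ℤ × ℤ × ℤ), MeasurableSet O → (∀ y, TT t ρ y ∈ O ↔ y ∈ O) →
      (∀ y ∈ O, (y ∈ Od N q ∧ c = a') ∨ (y ∉ Od N q ∧ c = a)) →
      (c = a ∨ c = a') → ‖∫ y in O, P.Psi N q hN hq τ a a' y ∂mm‖ ≤ (4 * E + 8 * mm.real b) / κ := by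
    intro O c hO hTO hc hc'
    have := approx_sym hT hO hTO hΨ.measurable hΨ1 hBm (ζ := ez (zz N a a' c t ρ d Δl Δk)) (ez_norm _)
      (e := 4 * E) (by linarith) (fun y hy hyB => by
        simp only [hB, mem_union, mem_preimage, not_or, Function.comp] at hyB
        exact P.sym_step N q hN hq h2q hs hτ ht1 ht2 hk hE hE' (hc y hy) hyB.1.1.1 hyB.1.1.2 hyB.1.2 hyB.2)
    rw [le_div_iff₀ hκ]
    nlinarith [mul_le_mul_of_nonneg_left (hz c hc') (norm_nonneg (∫ y in O, P.Psi N q hN hq τ a a' y ∂mm))]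
  have m1 := main (Od N q) a' (meas_Od N q) (Od_TT N q t ρ d ht1) (fun y hy => Or.inl ⟨hy, rfl⟩) (Or.inr rfl)
  have m2 := main (Od N q)ᶜ a (meas_Od N q).compl (fun y => not_congr (Od_TT N q t ρ d ht1 y))
    (fun y hy => Or.inr ⟨hy, rfl⟩) (Or.inl rfl)
  have hi : Integrable (P.Psi N q hN hq τ a a') mm :=
    Integrable.of_bound hΨ.aestronglyMeasurable 1 (ae_of_all _ hΨ1)
  rw [← integral_add_compl (meas_Od N q) hi]
  refine (norm_add_le _ _).trans ((add_le_add m1 m2).trans (le_of_eq (by ring)))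

end Pk
end

noncomputable section
open MeasureTheory Filter Set

lemma Pm_pres {A : CL} (h : Function.Injective A) {θ : ℝ} (hA : A = Pk.RtL θ) :
    MeasurePreserving (Pm A h) lam lam := by
  subst hA; exact mp_Rt θ

/-- box of characters -/
def bx (K : ℕ) (a : ℤ × ℤ × ℤ) : Prop := |a.1| ≤ K ∧ |a.2.1| ≤ K ∧ |a.2.2| ≤ K

lemma ez_gap' {z : ℝ} (h1 : 1 / 4 ≤ |z|) (h2 : |z| ≤ 1 / 2) : 1 ≤ ‖1 - ez z‖ := by
  have hre : (ez z).re = Real.cos (2 * Real.pi * |z|) := by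
    unfold ez; rw [Complex.exp_ofReal_mul_I_re, ← Real.cos_abs, abs_mul, abs_of_pos Real.two_pi_pos]
  have hc : Real.cos (2 * Real.pi * |z|) ≤ 0 := Real.cos_nonpos_of_pi_div_two_le_of_le
    (by nlinarith [Real.pi_pos]) (by nlinarith [Real.pi_pos])
  have := Complex.re_le_norm (1 - ez z)
  simp only [Complex.sub_re, Complex.one_re, hre] at this
  linarith

namespace Pk
variable (P : Pk) (N q : ℕ) (hN : 0 < N) (hq : 0 < q)

lemma nu_le (h2q : 1 / (2 * (q : ℝ)) ≤ P.δ) {A : Set XX} (hA : MeasurableSet A) :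
    (P.hS N q hN hq).nu A ≤ mm A + (volume : Measure T2) (P.Gs N q)ᶜ := by
  set h := P.hS N q hN hq with hh
  rw [SL.nu, Measure.map_apply h.continuous_ext.measurable hA]
  have h1 : mm (h.ext ⁻¹' A) = ∫⁻ x : T2, lam (Prod.mk x ⁻¹' (h.ext ⁻¹' A)) :=
    Measure.prod_apply (h.continuous_ext.measurable hA)
  have h2 : mm A = ∫⁻ x : T2, lam (Prod.mk (h.map x) ⁻¹' A) := by
    have := h.mp_map.lintegral_comp (f := fun x => lam (Prod.mk x ⁻¹' A)) (measurable_measure_prodMk_left hA)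
    rw [this]
    exact Measure.prod_apply hA
  have h3 : (volume : Measure T2) (P.Gs N q)ᶜ = ∫⁻ x : T2, (P.Gs N q)ᶜ.indicator 1 x := by
    rw [lintegral_indicator_one (P.Gs_meas N q).compl]
  rw [h1, h2, h3, ← lintegral_add_right _ (measurable_one.indicator (P.Gs_meas N q).compl)]
  refine lintegral_mono fun x => ?_
  by_cases hx : x ∈ P.Gs N q
  · rw [indicator_of_notMem (by simpa using hx), add_zero]
    obtain ⟨i, l, k, G⟩ := P.Gs_good N q (x := rep x) (by rwa [pro_rep])
    have hD := (P.hS_good N q hN hq h2q G).2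
    have hp := Pm_pres (h.inj_D (rep x)) hD
    have e : Prod.mk x ⁻¹' (h.ext ⁻¹' A) = Pm _ (h.inj_D (rep x)) ⁻¹' (Prod.mk (h.map x) ⁻¹' A) := rfl
    rw [e, hp.measure_preimage (measurable_prodMk_left hA).nullMeasurableSet]
  · rw [indicator_of_mem (by simpa using hx)]
    exact (prob_le_one).trans (by simp)

lemma nu_close (h2q : 1 / (2 * (q : ℝ)) ≤ P.δ) {A : Set XX} (hA : MeasurableSet A) :
    |(P.hS N q hN hq).nu.real A - mm.real A| ≤ mm.real (P.badS N q) := by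
  rw [bad_vol]
  have key : ∀ B : Set XX, MeasurableSet B → (P.hS N q hN hq).nu.real B ≤
      mm.real B + (volume : Measure T2).real (P.Gs N q)ᶜ := by
    intro B hB
    have := P.nu_le N q hN hq h2q hB
    simp only [measureReal_def]
    rw [← ENNReal.toReal_add (measure_ne_top _ _) (measure_ne_top _ _)]
    exact ENNReal.toReal_mono (by finiteness) this
  have k1 := key A hA
  have k2 := key Aᶜ hA.compl
  rw [probReal_compl_eq_one_sub hA, probReal_compl_eq_one_sub hA] at k2
  rw [abs_le]; constructor <;> linarith

lemma mix_all (h2q : 1 / (2 * (q : ℝ)) ≤ P.δ) {K : ℕ} (hK : 2 * K < N) (hqK : 8 * K ≤ q) {s : ℤ}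
    (hs : s = 1 ∨ s = -1) {τ : ℝ}
    (hτ : |Qn N q * τ - s| < 2 * P.δ) {a a' : ℤ × ℤ × ℤ} (ha : bx K a) (ha' : bx K a')
    (hne : ¬ (a = 0 ∧ a' = 0)) :
    ‖∫ y, P.Psi N q hN hq τ a a' y ∂mm‖ ≤
      2 * (4 * (4 * Real.pi * K / Qn N q) + 8 * mm.real (P.badS N q)) * N := by
  obtain ⟨a1, a2, a3⟩ := a
  obtain ⟨b1, b2, b3⟩ := a'
  simp only [bx] at ha ha'
  have hNr : (0:ℝ) < N := by positivity
  have hqr : (0:ℝ) < q := by positivity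
  have hQ := Qpos N q hN hq
  have hN1 : 1 / (N : ℝ) ≤ 1 := by
    rw [div_le_one hNr]; exact_mod_cast hN
  have hE : ∀ x y : ℤ, |x| ≤ K → |y| ≤ K → 2 * Real.pi * (|(x : ℝ)| + |(y : ℝ)|) / Qn N q ≤
      4 * Real.pi * K / Qn N q := by
    intro x y hx hy
    have hx' : |(x : ℝ)| ≤ K := by exact_mod_cast hx
    have hy' : |(y : ℝ)| ≤ K := by exact_mod_cast hy
    rw [div_le_div_iff_of_pos_right hQ]
    nlinarith [Real.pi_pos]
  have go := fun t ρ d Δl Δk u1 u2 u3 u4 => P.sym_int N q hN hq h2q hs hτ (a := (a1, a2, a3))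
    (a' := (b1, b2, b3)) t ρ d Δl Δk
    u1 u2 u3 (by positivity : (0:ℝ) ≤ 4 * Real.pi * K / Qn N q) (hE a1 a2 ha.1 ha.2.1) (hE b1 b2 ha'.1 ha'.2.1)
    (κ := 1 / N) (by positivity) u4
  simp only [div_div_eq_mul_div, div_one] at go
  have gap : ∀ (n m : ℤ) (z : ℝ), z = (n : ℝ) / N + m → n ≠ 0 → |n| < N → 1 / (N : ℝ) ≤ ‖1 - ez z‖ := by
    intro n m z hz h0 hn
    rw [ez_congr m hz]; exact ez_gap hN h0 hn
  rw [abs_le, abs_le, abs_le] at ha ha'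
  by_cases c3 : a3 + b3 ≠ 0
  · apply go 0 (1 / (2 * (a3 + b3 : ℤ))) 0 0 0 (by simp) (by simp) (Or.inl (by simp))
    intro c hc
    have : ez (zz N (a1, a2, a3) (b1, b2, b3) c 0 (1 / (2 * (a3 + b3 : ℤ))) 0 0 0) = -1 := by
      rw [← ez_half]
      congr 1
      have : ((a3 : ℝ) + b3) ≠ 0 := by exact_mod_cast c3
      simp only [zz]; push_cast; simp; field_simp
    rw [this]; refine hN1.trans ?_; norm_num
  push Not at c3
  by_cases c1 : a1 + b1 ≠ 0
  · set B : ℤ := a1 + b1 with hB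
    have hB0 : (1 : ℝ) ≤ |(B : ℝ)| := by exact_mod_cast Int.one_le_abs c1
    have hBK : |(B : ℝ)| ≤ 2 * K := by
      have : |B| ≤ 2 * K := by rw [abs_le]; constructor <;> omega
      exact_mod_cast this
    set m : ℤ := ⌊(q : ℝ) / (2 * |(B : ℝ)|)⌋ with hm
    have f1 : (m : ℝ) * (2 * |(B : ℝ)|) ≤ q := by
      rw [← le_div_iff₀ (by positivity)]; exact Int.floor_le _
    have f2 : (q : ℝ) < (m + 1) * (2 * |(B : ℝ)|) := by
      rw [← div_lt_iff₀ (by positivity)]; exact Int.lt_floor_add_one _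
    have hm0 : (0:ℝ) ≤ m := by
      have : 0 ≤ m := Int.floor_nonneg.2 (by positivity)
      exact_mod_cast this
    have hqK' : 8 * (K:ℝ) ≤ q := by exact_mod_cast hqK
    apply go ((m : ℝ) / q, 0) 0 (N ^ 2 * m) 0 0 (by simp only [Qn]; push_cast; field_simp)
      (by simp) (Or.inl (by simp))
    intro c hc
    have e : ez (zz N (a1, a2, a3) (b1, b2, b3) c ((m : ℝ) / q, 0) 0 (N ^ 2 * m) 0 0) = ez (B * (m / q)) := by
      apply ez_congr ((c.1 * N + c.2.1) * m)
      simp only [zz, hB]; push_cast; field_simp; ring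
    rw [e]
    have habs : |(B : ℝ) * (m / q)| = |(B : ℝ)| * m / q := by
      rw [abs_mul, abs_of_nonneg (by positivity : (0:ℝ) ≤ m / q)]; ring
    refine hN1.trans (ez_gap' ?_ ?_)
    · rw [habs, le_div_iff₀ hqr]; nlinarith
    · rw [habs, div_le_iff₀ hqr]; nlinarith
  push Not at c1
  have c1' : (a1 : ℝ) + b1 = 0 := by exact_mod_cast c1
  have c3' : (a3 : ℝ) + b3 = 0 := by exact_mod_cast c3
  by_cases c2 : a2 + b2 ≠ 0
  · apply go (0, 1 / (N : ℝ)) 0 0 (2 * N * q) N (by simp) (by simp only [Qn]; push_cast; field_simp)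
      (Or.inl (by simp; field_simp))
    intro c hc
    refine gap (a2 + b2) (c.2.2 * 2 * q) _ ?_ c2 (by rw [abs_lt]; constructor <;> omega)
    simp only [zz]; rw [c1', c3']; push_cast; field_simp; ring
  push Not at c2
  have c2' : (a2 : ℝ) + b2 = 0 := by exact_mod_cast c2
  obtain rfl : b1 = -a1 := by omega
  obtain rfl : b2 = -a2 := by omega
  obtain rfl : b3 = -a3 := by omega
  by_cases d2 : a2 ≠ 0
  · apply go (1 / ((N : ℝ) * q), 0) 0 N 0 0 (by simp only [Qn]; push_cast; field_simp)
      (by simp) (Or.inl (by simp))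
    intro c hc
    refine gap c.2.1 c.1 _ ?_ (by rcases hc with rfl | rfl <;> simpa using d2)
      (by rcases hc with rfl | rfl <;> rw [abs_lt] <;> constructor <;> simp only <;> omega)
    simp only [zz]; rw [c1', c2', c3']; push_cast; field_simp; ring
  push Not at d2; subst d2
  by_cases d1 : a1 ≠ 0
  · apply go (2 / Qn N q, 0) 0 1 0 0 (by field_simp; push_cast; ring) (by simp) (Or.inl (by simp))
    intro c hc
    have hc2 : c.2.1 = 0 := by rcases hc with rfl | rfl <;> simp
    refine gap c.1 0 _ ?_ (by rcases hc with rfl | rfl <;> simpa using d1)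
      (by rcases hc with rfl | rfl <;> rw [abs_lt] <;> constructor <;> simp only <;> omega)
    simp only [zz]; rw [c1', c2', c3', hc2]; push_cast; field_simp; ring
  push Not at d1; subst d1
  have d3 : a3 ≠ 0 := by
    rintro rfl; exact hne (by simp)
  apply go (0, 1 / Qn N q) 0 0 1 0 (by simp) (by push_cast; field_simp) (Or.inr (by simp))
  intro c hc
  refine gap c.2.2 0 _ ?_ (by rcases hc with rfl | rfl <;> simpa using d3)
    (by rcases hc with rfl | rfl <;> rw [abs_lt] <;> constructor <;> simp only <;> omega)
  simp only [zz]; push_cast; field_simp; ring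

end Pk

/-- Interface of the mixing construction. -/
theorem mixH (K : ℕ) {ε : ℝ} (hε : 0 < ε) : ∃ (P : Pk) (N : ℕ) (hN : 0 < N) (q0 : ℕ) (δ' : ℝ), 0 < δ' ∧
    ∀ (q : ℕ) (hq : 0 < q), q0 ≤ q →
      (∀ A, MeasurableSet A → |(P.hS N q hN hq).nu.real A - mm.real A| ≤ ε) ∧
      ∀ (s : ℤ) (τ : ℝ) (a a' : ℤ × ℤ × ℤ), (s = 1 ∨ s = -1) → |Pk.Qn N q * τ - s| < δ' → bx K a →
        bx K a' → ¬ (a = 0 ∧ a' = 0) →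
        ‖∫ y, EE a ((P.hS N q hN hq).ext ((SL.rot τ).ext y)) * EE a' ((P.hS N q hN hq).ext y) ∂mm‖ ≤ ε := by
  set N := 2 * K + 2 with hNd
  have hN : 0 < N := by omega
  have hNr : (0:ℝ) < N := by positivity
  have hN1 : (1:ℝ) ≤ N := by exact_mod_cast hN
  set ε1 := ε / (160 * N) with hε1
  have hε1p : 0 < ε1 := by positivity
  obtain ⟨P, hP1, hP2⟩ := exists_Pk ε1 hε1p
  have hδ := P.hδ
  refine ⟨P, N, hN, max (8 * K) (max ⌈1 / (2 * P.δ)⌉₊ ⌈64 * Real.pi * K * N / ε⌉₊), 2 * P.δ, by linarith, ?_⟩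
  intro q hq hq0
  simp only [max_le_iff, Nat.ceil_le] at hq0
  obtain ⟨q1, q2, q3⟩ := hq0
  have hqr : (0:ℝ) < q := by positivity
  have h2q : 1 / (2 * (q : ℝ)) ≤ P.δ := by
    rw [div_le_iff₀ (by positivity)] at q2 ⊢; linarith
  have hbad : mm.real (P.badS N q) ≤ 5 * ε1 := by
    rw [P.bad_vol]; exact P.Gs_vol N q hN hq hP1 hP2 (by omega)
  have he : ε1 * (160 * N) = ε := by rw [hε1]; field_simp
  refine ⟨fun A hA => (P.nu_close N q hN hq h2q hA).trans (hbad.trans (by nlinarith)), ?_⟩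
  intro s τ a a' hs hτ ha ha' hne
  refine (P.mix_all N q hN hq h2q (by omega : 2 * K < N) q1 hs hτ ha ha' hne).trans ?_
  have hQ : (q : ℝ) ≤ Pk.Qn N q := by
    unfold Pk.Qn
    have : (1:ℝ) ≤ 2 * (N:ℝ) ^ 2 := by nlinarith
    nlinarith
  have h4 : 4 * Real.pi * K / Pk.Qn N q ≤ 4 * Real.pi * K / q := by
    have := Real.pi_pos
    gcongr
  have h5 : 4 * Real.pi * K / q * (16 * N) ≤ ε := by
    rw [div_le_iff₀ hε] at q3
    rw [div_mul_eq_mul_div, div_le_iff₀ hqr]; linarith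
  have h6 := mul_le_mul_of_nonneg_right h4 hNr.le
  have h7 := mul_le_mul_of_nonneg_right hbad hNr.le
  nlinarith

end

noncomputable section
open MeasureTheory Filter Set

abbrev R2 := ℝ × ℝ

abbrev iD (k : ℕ) (F : R2 → R2) (x : R2) := iteratedFDeriv ℝ k F x

abbrev Sm (F : R2 → R2) := ContDiff ℝ (⊤ : ℕ∞) F

/-- Uniform bounds on derivatives of orders `1..n`. -/
def Bd (n : ℕ) (B : ℝ) (F : R2 → R2) : Prop := ∀ k, 1 ≤ k → k ≤ n → ∀ x, ‖iD k F x‖ ≤ B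

lemma Sm.at' {F : R2 → R2} (h : Sm F) (k : ℕ) (x) : ContDiffAt ℝ k F x :=
  (h.of_le (by exact_mod_cast le_top)).contDiffAt

lemma iD_sub_const {F : R2 → R2} (hF : Sm F) {k : ℕ} (hk : 1 ≤ k) (c x : R2) :
    iD k (fun y => F y - c) x = iD k F x := by
  have := iteratedFDeriv_sub_apply (hF.at' k x) (contDiffAt_const (c := c))
  have e : (fun y => F y - c) = F - fun _ => c := rfl
  rw [iD, e, this, iteratedFDeriv_const_of_ne (by omega)]
  simp

lemma Bd.comp {n : ℕ} {B D : ℝ} {F G : R2 → R2} (hF : Bd n B F) (hG : Bd n D G) (sF : Sm F) (sG : Sm G)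
    (hB : 0 ≤ B) (hD : 1 ≤ D) : Bd n (n.factorial * B * D ^ n) (F ∘ G) := by
  intro k hk hkn x
  have e : iD k (F ∘ G) x = iD k ((fun y => F y - F (G x)) ∘ G) x :=
    (iD_sub_const (sF.comp sG) hk (F (G x)) x).symm
  rw [e]
  refine (norm_iteratedFDeriv_comp_le (N := (⊤ : ℕ∞)) (C := B) (D := D) (sF.sub contDiff_const) sG
    (by exact_mod_cast le_top) x ?_ ?_).trans ?_
  · intro i hi
    rcases Nat.eq_zero_or_pos i with rfl | h
    · simpa using hB
    · rw [← iD, iD_sub_const sF h]; exact hF i h (hi.trans hkn) _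
  · intro i h1 h2
    exact (hG i h1 (h2.trans hkn) x).trans (le_self_pow₀ hD (by omega))
  · have : (k.factorial : ℝ) ≤ n.factorial := by exact_mod_cast Nat.factorial_le hkn
    gcongr

/-- Equivariance under a lattice gives uniform bounds. -/
lemma Bd_per {F : R2 → R2} (sF : Sm F) {L : ℝ} (hL : 0 < L)
    (hp : ∀ x (m1 m2 : ℤ), F (x + (L * m1, L * m2)) = F x + (L * m1, L * m2)) (n : ℕ) :
    ∃ B, 1 ≤ B ∧ Bd n B F := by
  have key : ∀ k, 1 ≤ k → ∃ B : ℝ, ∀ x, ‖iD k F x‖ ≤ B := by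
    intro k hk
    have hc : Continuous fun x => iD k F x :=
      sF.continuous_iteratedFDeriv (by exact_mod_cast le_top)
    obtain ⟨B, hB⟩ := ((isCompact_Icc (a := (0:ℝ)) (b := L)).prod
      (isCompact_Icc (a := (0:ℝ)) (b := L))).exists_bound_of_continuousOn hc.continuousOn
    refine ⟨B, fun x => ?_⟩
    set m1 : ℤ := ⌊x.1 / L⌋
    set m2 : ℤ := ⌊x.2 / L⌋
    have e : iD k F x = iD k F (x - (L * m1, L * m2)) := by
      have h1 : (fun y => F (y + (L * m1, L * m2))) = fun y => F y - (-(L * m1, L * m2)) := by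
        funext y; rw [hp, sub_neg_eq_add]
      have h2 := iteratedFDeriv_comp_add_right (𝕜 := ℝ) (f := F) k ((L * m1, L * m2) : R2) (x - (L * m1, L * m2))
      rw [h1] at h2
      have h3 := iD_sub_const sF hk (-(L * m1, L * m2)) (x - (L * m1, L * m2))
      rw [iD] at h3
      rw [h3] at h2
      rw [h2]; simp
    rw [e]
    apply hB
    have a1 := Int.floor_le (x.1 / L)
    have a2 := Int.lt_floor_add_one (x.1 / L)
    have b1 := Int.floor_le (x.2 / L)
    have b2 := Int.lt_floor_add_one (x.2 / L)
    rw [le_div_iff₀ hL] at a1 b1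
    rw [div_lt_iff₀ hL] at a2 b2
    refine ⟨⟨?_, ?_⟩, ?_, ?_⟩ <;> simp only [Prod.fst_sub, Prod.snd_sub, m1, m2] <;> linarith
  choose! B hB using key
  refine ⟨1 + ∑ k ∈ Finset.range (n + 1), |B k|, ?_, ?_⟩
  · have : 0 ≤ ∑ k ∈ Finset.range (n + 1), |B k| := Finset.sum_nonneg fun _ _ => abs_nonneg _
    linarith
  · intro k h1 h2 x
    have := Finset.single_le_sum (f := fun k => |B k|) (fun _ _ => abs_nonneg _)
      (Finset.mem_range.2 (Nat.lt_succ_of_le h2))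
    have h3 := hB k h1 x
    have h4 := le_abs_self (B k)
    linarith

lemma Bd_lin (A : R2 →L[ℝ] R2) (n : ℕ) {B : ℝ} (hB : ‖A‖ ≤ B) : Bd n B A := by
  intro k h1 _ x
  obtain rfl | h := eq_or_lt_of_le h1
  · rw [norm_iteratedFDeriv_one, A.fderiv]; exact hB
  · obtain ⟨j, rfl⟩ : ∃ j, k = j + 2 := ⟨k - 2, by omega⟩
    rw [iD, ← norm_iteratedFDeriv_fderiv]
    have : fderiv ℝ (A : R2 → R2) = fun _ => A := by funext y; exact A.fderiv
    rw [this, iteratedFDeriv_succ_const]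
    simpa using (norm_nonneg _).trans hB

/-- Polynomially bounded families. -/
def PB (F : ℕ → R2 → R2) : Prop :=
  (∀ q, Sm (F q)) ∧ ∀ n, ∃ (C : ℝ) (M : ℕ), 1 ≤ C ∧ ∀ q : ℕ, 0 < q → Bd n (C * (q : ℝ) ^ M) (F q)

lemma PB.const {F : R2 → R2} (sF : Sm F) (h : ∀ n, ∃ B, 1 ≤ B ∧ Bd n B F) : PB fun _ => F := by
  refine ⟨fun _ => sF, fun n => ?_⟩
  obtain ⟨B, h1, h2⟩ := h n
  exact ⟨B, 0, h1, fun q _ => by simpa using h2⟩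

lemma PB.comp {F G : ℕ → R2 → R2} (hF : PB F) (hG : PB G) : PB fun q => F q ∘ G q := by
  refine ⟨fun q => (hF.1 q).comp (hG.1 q), fun n => ?_⟩
  obtain ⟨C, M, hC, h1⟩ := hF.2 n
  obtain ⟨D, L, hD, h2⟩ := hG.2 n
  refine ⟨n.factorial * C * D ^ n, M + L * n, ?_, fun q hq => ?_⟩
  · have : (1:ℝ) ≤ n.factorial := by exact_mod_cast n.factorial_pos
    exact one_le_mul_of_one_le_of_one_le (one_le_mul_of_one_le_of_one_le this hC) (one_le_pow₀ hD)
  · have hq1 : (1:ℝ) ≤ q := by exact_mod_cast hq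
    have := (h1 q hq).comp (h2 q hq) (hF.1 q) (hG.1 q) (by positivity)
      (one_le_mul_of_one_le_of_one_le hD (one_le_pow₀ hq1))
    have e : (n.factorial : ℝ) * (C * (q : ℝ) ^ M) * (D * (q : ℝ) ^ L) ^ n =
      n.factorial * C * D ^ n * (q : ℝ) ^ (M + L * n) := by
      rw [mul_pow, ← pow_mul, pow_add]; ring
    rwa [e] at this

lemma PB.lin (A : ℕ → R2 →L[ℝ] R2) {C : ℝ} (hC : 1 ≤ C) (h : ∀ q : ℕ, 0 < q → ‖A q‖ ≤ C * q) : PB fun q => A q :=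
  ⟨fun q => (A q).contDiff, fun n => ⟨C, 1, hC, fun q hq => Bd_lin _ _ (by simpa using h q hq)⟩⟩

lemma SL.Bd (S : SL) (n : ℕ) : ∃ B, 1 ≤ B ∧ Bd n B S.F :=
  Bd_per S.sF one_pos (fun x m1 m2 => by simp only [one_mul]; exact S.pF x (m1, m2)) n

lemma SL.PB (S : SL) : PB fun _ => S.F := PB.const S.sF S.Bd

/-- Diagonal maps. -/
def dg (a b : ℝ) : R2 →L[ℝ] R2 := (a • ContinuousLinearMap.fst ℝ ℝ ℝ).prod (b • ContinuousLinearMap.snd ℝ ℝ ℝ)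

lemma dg_apply (a b : ℝ) (x : R2) : dg a b x = (a * x.1, b * x.2) := rfl

lemma dg_norm {a b c : ℝ} (ha : |a| ≤ c) (hb : |b| ≤ c) : ‖dg a b‖ ≤ c := by
  refine ContinuousLinearMap.opNorm_le_bound _ ((abs_nonneg _).trans ha) fun x => ?_
  rw [dg_apply, Prod.norm_def]
  simp only [Real.norm_eq_abs, abs_mul]
  have h1 : |x.1| ≤ ‖x‖ := norm_fst_le x
  have h2 : |x.2| ≤ ‖x‖ := norm_snd_le x
  have h0 := (abs_nonneg _).trans ha
  exact max_le (by gcongr) (by gcongr)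

namespace Pk
variable (P : Pk) (N : ℕ) (hN : 0 < N)

lemma Qn_abs (q : ℕ) : |Qn N q| = 2 * (N:ℝ) ^ 2 * q := by
  unfold Qn; exact abs_of_nonneg (by positivity)

include hN in
lemma Qn_inv (q : ℕ) (hq : 0 < q) : |(Qn N q)⁻¹| ≤ 1 := by
  rw [abs_inv, Qn_abs]
  have h1 : (1:ℝ) ≤ N := by exact_mod_cast hN
  have h2 : (1:ℝ) ≤ q := by exact_mod_cast hq
  apply inv_le_one_of_one_le₀
  nlinarith [one_le_pow₀ h1 (n := 2)]

include hN in
lemma PB_kF (s : ℝ) : PB fun q => P.kF N q s := by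
  have h1 : (1:ℝ) ≤ N := by exact_mod_cast hN
  have h2 := one_le_pow₀ h1 (n := 2)
  have a1 : PB fun q => dg (Qn N q)⁻¹ (Qn N q)⁻¹ := PB.lin _ le_rfl fun q hq => by
    have h3 : (1:ℝ) ≤ q := by exact_mod_cast hq
    have := Qn_inv N hN q hq
    exact dg_norm (by linarith) (by linarith)
  have a2 : PB fun q => dg (Qn N q) (Qn N q) := PB.lin _ (C := 2 * (N:ℝ) ^ 2) (by linarith) fun q hq =>
    dg_norm (Qn_abs N q).le (Qn_abs N q).le
  have a3 : PB fun _ => P.X.tw (s • P.th N) := PB.const (P.X.tw_smooth _)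
    (Bd_per (P.X.tw_smooth _) (by positivity : (0:ℝ) < 2 * (N:ℝ) ^ 2) (P.kq_per N s))
  exact a1.comp (a3.comp a2)

include hN in
lemma PB_g (s : ℝ) : PB fun q x => ((x.1, x.2 + s * P.bq N q x.1) : R2) := by
  have h1 : (1:ℝ) ≤ N := by exact_mod_cast hN
  have h2 := one_le_pow₀ h1 (n := 2)
  have a1 : PB fun q => dg (Qn N q)⁻¹ 1 := PB.lin _ le_rfl fun q hq => by
    have h3 : (1:ℝ) ≤ q := by exact_mod_cast hq
    have := Qn_inv N hN q hq
    exact dg_norm (by linarith) (by simpa using h3)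
  have a2 : PB fun q => dg (Qn N q) 1 := PB.lin _ (C := 2 * (N:ℝ) ^ 2) (by linarith) fun q hq =>
    dg_norm (Qn_abs N q).le (by
      have h3 : (1:ℝ) ≤ q := by exact_mod_cast hq
      rw [abs_one]; nlinarith)
  have sm : Sm fun x : R2 => (x.1, x.2 + s * stp P.δ (wb N) x.1) :=
    contDiff_fst.prodMk (contDiff_snd.add (contDiff_const.mul ((stp_smooth P.hδ _).comp contDiff_fst)))
  have a3 : PB fun _ (x : R2) => ((x.1, x.2 + s * stp P.δ (wb N) x.1) : R2) := PB.const sm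
    (Bd_per sm (by positivity : (0:ℝ) < 2 * (N:ℝ) ^ 2) fun x m1 m2 => by
      simp only [Prod.fst_add, Prod.snd_add, P.wb_stp]; ext <;> simp; ring)
  have a4 := a1.comp (a3.comp a2)
  refine ⟨fun q => ?_, fun n => ?_⟩
  · exact contDiff_fst.prodMk (contDiff_snd.add (contDiff_const.mul
      (((stp_smooth P.hδ _).comp (by fun_prop : ContDiff ℝ _ fun t : ℝ => Qn N q * t)).comp contDiff_fst)))
  · obtain ⟨C, M, hC, h⟩ := a4.2 n
    refine ⟨C, M, hC, fun q hq => ?_⟩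
    convert h q hq using 1
    funext x
    have := (Qpos N q hN hq).ne'
    simp only [Function.comp_apply, dg_apply, one_mul, bq, inv_mul_cancel_left₀ this]

include hN in
lemma PB_h : (∃ U : ℕ → R2 → R2, PB U ∧ ∀ q hq, U q = (P.hS N q hN hq).F) ∧
    ∃ V : ℕ → R2 → R2, PB V ∧ ∀ q hq, V q = (P.hS N q hN hq).G := by
  refine ⟨⟨_, (P.cS N).PB.comp ((P.PB_g N hN 1).comp (P.PB_kF N hN 1)), fun q hq => ?_⟩,
    ⟨_, (P.PB_kF N hN (-1)).comp ((P.PB_g N hN (-1)).comp (P.cS N).inv.PB), fun q hq => ?_⟩⟩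
  · funext x
    show _ = (P.cS N).F ((P.gS N q).F (P.kF N q 1 x))
    simp only [Function.comp_apply, one_mul]; rfl
  · funext x
    show _ = P.kF N q (-1) ((P.gS N q).G ((P.cS N).G x))
    simp only [Function.comp_apply, neg_one_mul, ← sub_eq_add_neg]; rfl

end Pk

/-- Key closeness estimate. -/
lemma close_rot {n : ℕ} {B D s t : ℝ} {U V : R2 → R2} (hU : Bd (n + 1) B U) (hV : Bd n D V) (sU : Sm U) (sV : Sm V)
    (hB : 0 ≤ B) (hD : 1 ≤ D) {i : ℕ} (hi : i ≤ n) (x : R2) :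
    ‖iD i (fun y => U (rotL s (V y)) - U (rotL t (V y))) x‖ ≤ n.factorial * (B * |s - t|) * D ^ n := by
  have er : ∀ s, rotL s = fun y => y + (s, (0:ℝ)) := fun s => by funext y; ext <;> simp [rotL]
  have sr : ∀ s, Sm fun y => U (rotL s y) := fun s => by
    rw [er]; exact sU.comp (contDiff_id.add contDiff_const)
  refine (norm_iteratedFDeriv_comp_le (N := (⊤ : ℕ∞)) (C := B * |s - t|) (D := D)
    (g := fun y => U (rotL s y) - U (rotL t y)) ((sr s).sub (sr t)) sV (by exact_mod_cast le_top) x ?_ ?_).trans ?_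
  · intro k hk
    have e : (fun y => U (rotL s y) - U (rotL t y)) = (fun y => U (rotL s y)) - fun y => U (rotL t y) := rfl
    rw [e, iteratedFDeriv_sub_apply ((sr s).at' k _) ((sr t).at' k _)]
    simp only [er]
    rw [iteratedFDeriv_comp_add_right, iteratedFDeriv_comp_add_right]
    have hd : Differentiable ℝ (iteratedFDeriv ℝ k U) :=
      sU.differentiable_iteratedFDeriv (by exact_mod_cast WithTop.coe_lt_top _)
    have := Convex.norm_image_sub_le_of_norm_fderiv_le (𝕜 := ℝ) (f := iteratedFDeriv ℝ k U) (C := B) (s := univ)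
      (fun y _ => hd y) (fun y _ => by
        rw [norm_fderiv_iteratedFDeriv]; exact hU (k + 1) (by omega) (by omega) y) convex_univ
      (mem_univ (V x + (t, (0:ℝ)))) (mem_univ (V x + (s, (0:ℝ))))
    refine this.trans (le_of_eq ?_)
    rw [add_sub_add_left_eq_sub]
    simp [Prod.norm_def]
  · intro k h1 h2
    exact (hV k h1 (h2.trans hi) x).trans (le_self_pow₀ hD (by omega))
  · have : (i.factorial : ℝ) ≤ n.factorial := by exact_mod_cast Nat.factorial_le hi
    gcongr

end

noncomputable section
open MeasureTheory Filter Set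

lemma zpow_close {z w : ℂ} (hz : ‖z‖ = 1) (hw : ‖w‖ = 1) (n : ℤ) : ‖z ^ n - w ^ n‖ ≤ |(n : ℝ)| * ‖z - w‖ := by
  have hn : ∀ n : ℕ, ‖z ^ n - w ^ n‖ ≤ n * ‖z - w‖ := by
    intro n
    induction n with
    | zero => simp
    | succ n ih =>
      have e : z ^ (n + 1) - w ^ (n + 1) = z * (z ^ n - w ^ n) + (z - w) * w ^ n := by ring
      rw [e]
      refine (norm_add_le _ _).trans ?_
      rw [norm_mul, norm_mul, norm_pow, hz, hw]
      push_cast; simp; linarith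
  have hi : ∀ n : ℕ, (z ^ n)⁻¹ - (w ^ n)⁻¹ = (starRingEnd ℂ) (z ^ n - w ^ n) := by
    intro n
    rw [map_sub, Complex.inv_eq_conj (by simp [hz]), Complex.inv_eq_conj (by simp [hw])]
  obtain ⟨m, rfl | rfl⟩ := n.eq_nat_or_neg
  · simpa using hn m
  · rw [zpow_neg, zpow_neg, zpow_natCast, zpow_natCast, hi, Complex.norm_conj]
    simpa using hn m

lemma unit_close {u v : ℂ} (hu : u ≠ 0) (hv : v ≠ 0) :
    ‖u / (‖u‖ : ℂ) - v / (‖v‖ : ℂ)‖ ≤ 2 * ‖u - v‖ / ‖u‖ := by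
  have h1 : (‖u‖ : ℂ) ≠ 0 := by exact_mod_cast norm_ne_zero_iff.2 hu
  have h2 : (‖v‖ : ℂ) ≠ 0 := by exact_mod_cast norm_ne_zero_iff.2 hv
  have h1' := norm_pos_iff.2 hu
  have h2' := norm_pos_iff.2 hv
  have e : u / (‖u‖ : ℂ) - v / (‖v‖ : ℂ) = (u - v) / (‖u‖ : ℂ) + v / (‖v‖ : ℂ) * (((‖v‖ - ‖u‖ : ℝ) : ℂ) / (‖u‖ : ℂ)) := by
    push_cast; field_simp; ring
  rw [e]
  refine (norm_add_le _ _).trans ?_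
  have h3 : |‖v‖ - ‖u‖| ≤ ‖u - v‖ := by rw [norm_sub_rev]; exact abs_norm_sub_norm_le v u
  simp only [norm_mul, norm_div, Complex.norm_real, Real.norm_eq_abs, abs_norm]
  rw [div_self h2'.ne', one_mul, ← add_div]
  gcongr; linarith

lemma chiV_close {v w : R2} (hv : v ≠ 0) (hw : w ≠ 0) : ‖chiV v - chiV w‖ ≤ 8 * ‖v - w‖ / ‖v‖ := by
  have h := unit_close (cz_ne hv) (cz_ne hw)
  have n1 : ‖cz v / (‖cz v‖ : ℂ)‖ = 1 := by
    have := norm_ne_zero_iff.2 (cz_ne hv); simp [this]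
  have n2 : ‖cz w / (‖cz w‖ : ℂ)‖ = 1 := by
    have := norm_ne_zero_iff.2 (cz_ne hw); simp [this]
  have h2 := zpow_close n1 n2 2
  have e : ∀ z : ℂ, z ^ (2:ℤ) = z ^ 2 := fun z => by norm_cast
  rw [e, e] at h2
  have h3 := norm_cz_le (v - w)
  have h4 := le_norm_cz v
  have h0 := norm_pos_iff.2 hv
  unfold chiV
  refine h2.trans ?_
  rw [← cz_sub] at h
  have : 2 * ‖cz (v - w)‖ / ‖cz v‖ ≤ 4 * ‖v - w‖ / ‖v‖ := by
    apply div_le_div₀ (by positivity) (by linarith) h0 h4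
  have e8 : 8 * ‖v - w‖ / ‖v‖ = 2 * (4 * ‖v - w‖ / ‖v‖) := by ring
  rw [e8]
  simp only [Int.cast_ofNat, abs_two]
  linarith

lemma ez_close (s t : ℝ) : ‖ez s - ez t‖ ≤ 2 * Real.pi * |s - t| := by
  have e : ez s - ez t = (ez (s - t) - 1) * ez t := by
    rw [sub_mul, ← ez_add, sub_add_cancel, one_mul]
  rw [e, norm_mul, ez_norm, mul_one]
  exact ez_sub_one _

lemma EE_close {S T : SL} {η B : ℝ} (hB : ∀ x, ‖fderiv ℝ T.G x‖ ≤ B)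
    (h0 : ∀ x, ‖S.F x - T.F x‖ ≤ η) (h1 : ∀ x, ‖fderiv ℝ S.F x - fderiv ℝ T.F x‖ ≤ η) {K : ℕ}
    {a : ℤ × ℤ × ℤ} (ha : bx K a) (y : XX) :
    ‖EE a (S.ext y) - EE a (T.ext y)‖ ≤ 16 * K * (1 + B) * η := by
  revert y
  apply SL.XX_ind
  intro z v hv
  rw [SL.ext_mk, SL.ext_mk, EE_pro, EE_pro, chi_mk, chi_mk]
  have hη : 0 ≤ η := (norm_nonneg _).trans (h0 0)
  have hB0 : 0 ≤ B := (norm_nonneg _).trans (hB 0)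
  set w := fderiv ℝ S.F z v
  set w' := fderiv ℝ T.F z v
  have hw : w ≠ 0 := S.D_ne z hv
  have hw' : w' ≠ 0 := T.D_ne z hv
  have c1 : ‖w' - w‖ ≤ η * ‖v‖ := by
    rw [norm_sub_rev]
    exact (ContinuousLinearMap.le_opNorm (fderiv ℝ S.F z - fderiv ℝ T.F z) v).trans
      (by gcongr; exact h1 z)
  have c2 : ‖v‖ ≤ B * ‖w'‖ := by
    have := congrArg (fun A : R2 →L[ℝ] R2 => A v) (T.DGF z)
    simp only [ContinuousLinearMap.comp_apply, ContinuousLinearMap.id_apply] at this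
    rw [← this]
    exact (ContinuousLinearMap.le_opNorm _ _).trans (by gcongr; exact hB _)
  have c3 : ‖chiV w' - chiV w‖ ≤ 8 * (η * B) := by
    refine (chiV_close hw' hw).trans ?_
    rw [div_le_iff₀ (norm_pos_iff.2 hw')]
    nlinarith [mul_le_mul_of_nonneg_left c2 hη]
  obtain ⟨a1, a2, a3⟩ := a
  obtain ⟨b1, b2, b3⟩ := ha
  have b1' : |(a1 : ℝ)| ≤ K := by exact_mod_cast b1
  have b2' : |(a2 : ℝ)| ≤ K := by exact_mod_cast b2
  have b3' : |(a3 : ℝ)| ≤ K := by exact_mod_cast b3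
  simp only
  set x1 := (a1 : ℝ) * (S.F z).1 + a2 * (S.F z).2
  set x2 := (a1 : ℝ) * (T.F z).1 + a2 * (T.F z).2
  have d1 : ‖ez x1 - ez x2‖ ≤ 16 * K * η := by
    refine (ez_close _ _).trans ?_
    have e1 : |(S.F z).1 - (T.F z).1| ≤ η := (norm_fst_le (S.F z - T.F z)).trans (h0 z)
    have e2 : |(S.F z).2 - (T.F z).2| ≤ η := (norm_snd_le (S.F z - T.F z)).trans (h0 z)
    have e3 : |x1 - x2| ≤ 2 * (K * η) := by
      have : x1 - x2 = a1 * ((S.F z).1 - (T.F z).1) + a2 * ((S.F z).2 - (T.F z).2) := by simp only [x1, x2]; ring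
      rw [this]
      refine (abs_add_le _ _).trans ?_
      rw [abs_mul, abs_mul, two_mul]
      gcongr
    have := Real.pi_lt_four
    have h5 : (0:ℝ) ≤ K * η := by positivity
    have h6 := Real.pi_pos
    nlinarith [mul_le_mul_of_nonneg_left e3 h6.le]
  have d2 : ‖chiV w ^ a3 - chiV w' ^ a3‖ ≤ 16 * K * (B * η) := by
    refine (zpow_close (norm_chiV hw) (norm_chiV hw') a3).trans ?_
    rw [norm_sub_rev]
    have := mul_le_mul b3' c3 (norm_nonneg _) (by positivity)
    have : (0:ℝ) ≤ K * (B * η) := by positivity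
    nlinarith
  have e : ez x1 * chiV w ^ a3 - ez x2 * chiV w' ^ a3 =
    (ez x1 - ez x2) * chiV w ^ a3 + ez x2 * (chiV w ^ a3 - chiV w' ^ a3) := by ring
  rw [e]
  refine (norm_add_le _ _).trans ?_
  rw [norm_mul, norm_mul, ez_norm, norm_zpow, norm_chiV hw, one_zpow]
  nlinarith

/-- Arithmetic of Liouville numbers. -/
lemma liou {α : ℝ} (hα : Liouville α) {N : ℕ} (hN : 0 < N) (L : ℕ) {C η δ' : ℝ} (hη : 0 < η) (hδ : 0 < δ')
    (q0 M : ℕ) : ∃ (q : ℕ) (p : ℤ) (M' : ℕ) (s k : ℤ), 0 < q ∧ q0 ≤ q ∧ C * (q:ℝ) ^ L * |α - p / q| ≤ η ∧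
      M < M' ∧ (s = 1 ∨ s = -1) ∧ |Pk.Qn N q * (M' * α - k) - s| < δ' := by
  have h1 := hα.frequently_exists_num (L + 4)
  have h2 : ∀ᶠ b : ℕ in atTop, 1 ≤ b ∧ q0 ≤ b ∧ ⌈|C| / η⌉₊ ≤ b ∧ ⌈2 * (N:ℝ) ^ 2 / δ'⌉₊ + 1 ≤ b ∧ 2 * N ^ 2 ≤ b ∧ M + 1 ≤ b := by
    filter_upwards [eventually_ge_atTop 1, eventually_ge_atTop q0, eventually_ge_atTop ⌈|C| / η⌉₊,
      eventually_ge_atTop (⌈2 * (N:ℝ) ^ 2 / δ'⌉₊ + 1), eventually_ge_atTop (2 * N ^ 2),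
      eventually_ge_atTop (M + 1)] with b a1 a2 a3 a4 a5 a6
    exact ⟨a1, a2, a3, a4, a5, a6⟩
  obtain ⟨q, ⟨p, hp0, hp⟩, b1, b2, b3, b4, b5, b6⟩ := (h1.and_eventually h2).exists
  have hq : (1:ℝ) ≤ q := by exact_mod_cast b1
  have hN1 : (1:ℝ) ≤ N := by exact_mod_cast hN
  have c3 := Nat.ceil_le.1 b3
  have c4 : 2 * (N:ℝ) ^ 2 / δ' < q := by
    have := Nat.le_ceil (2 * (N:ℝ) ^ 2 / δ')
    have h : ((⌈2 * (N:ℝ) ^ 2 / δ'⌉₊ : ℝ)) + 1 ≤ q := by exact_mod_cast b4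
    linarith
  have c5 : 2 * (N:ℝ) ^ 2 ≤ q := by exact_mod_cast b5
  have c6 : (M:ℝ) + 1 ≤ q := by exact_mod_cast b6
  rw [div_le_iff₀ hη] at c3
  rw [div_lt_iff₀ hδ] at c4
  set d := α - p / q with hd
  have hd0 : 0 < |d| := abs_pos.2 (sub_ne_zero.2 hp0)
  have hq4 : |d| * (q:ℝ) ^ (L + 4) < 1 := by
    rwa [lt_div_iff₀ (by positivity)] at hp
  have hL1 : (1:ℝ) ≤ (q:ℝ) ^ L := one_le_pow₀ hq
  have hq4' : |d| * (q:ℝ) ^ 4 < 1 := by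
    refine lt_of_le_of_lt ?_ hq4
    gcongr
    omega
  set X := Pk.Qn N q * q * |d| with hX
  have hXp : 0 < X := by have := Pk.Qpos N q hN b1; positivity
  have hX1 : X ≤ 2 * (N:ℝ) ^ 2 * ((q:ℝ)^2 * |d|) := by rw [hX, Pk.Qn]; apply le_of_eq; ring
  have hXδ : X < δ' := by
    -- X * q^2 ≤ 2N² < q δ'
    have : X * (q:ℝ)^2 ≤ 2 * (N:ℝ)^2 := by
      have : X * (q:ℝ)^2 ≤ 2 * (N:ℝ) ^ 2 * (|d| * (q:ℝ)^4) := by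
        calc _ ≤ 2 * (N:ℝ) ^ 2 * ((q:ℝ)^2 * |d|) * (q:ℝ)^2 := by gcongr
          _ = _ := by ring
      nlinarith
    have h3 : X * q ≤ X * (q:ℝ)^2 := by gcongr; nlinarith
    have : X * q < δ' * q := by linarith
    exact lt_of_mul_lt_mul_right this (by positivity)
  set j := ⌈1 / X⌉₊ with hj
  have j1 := Nat.le_ceil (1 / X)
  have j2 := Nat.ceil_lt_add_one (by positivity : 0 ≤ 1 / X)
  rw [← hj] at j1 j2
  have j1' : 1 ≤ j * X := by rwa [div_le_iff₀ hXp] at j1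
  have j2' : j * X < 1 + X := by
    have := mul_lt_mul_of_pos_right j2 hXp
    rwa [add_mul, one_mul, div_mul_cancel₀ _ hXp.ne'] at this
  have hXq : X * q ≤ 1 := by
    have : X * q ≤ q * ((q:ℝ)^2 * |d|) * q := by
      gcongr
      exact hX1.trans (by gcongr)
    calc X * q ≤ _ := this
      _ = |d| * (q:ℝ) ^ 4 := by ring
      _ ≤ 1 := hq4'.le
  have hjM : (1:ℝ) ≤ j := by
    have : X ≤ 1 := by nlinarith
    by_contra h
    push Not at h
    have h0 : (j:ℝ) * X < 1 := by nlinarith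
    linarith
  have habs : ∃ s : ℤ, (s = 1 ∨ s = -1) ∧ d = s * |d| := by
    rcases le_total 0 d with h | h
    · exact ⟨1, Or.inl rfl, by simp [abs_of_nonneg h]⟩
    · exact ⟨-1, Or.inr rfl, by simp [abs_of_nonpos h]⟩
  obtain ⟨s, hs, hsd⟩ := habs
  have hs1 : |(s:ℝ)| = 1 := by rcases hs with rfl | rfl <;> simp
  refine ⟨q, p, q * j, s, j * p, b1, b2, ?_, ?_, hs, ?_⟩
  · have h5 : |d| * (q:ℝ)^L * q ≤ 1 := by
      refine le_trans ?_ hq4.le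
      rw [mul_assoc, ← pow_succ]
      gcongr
      omega
    have h6 : (0:ℝ) ≤ |d| * (q:ℝ)^L := by positivity
    calc C * (q:ℝ) ^ L * |d| ≤ |C| * (q:ℝ) ^ L * |d| := by gcongr; exact le_abs_self C
      _ = |C| * (|d| * (q:ℝ)^L) := by ring
      _ ≤ (q * η) * (|d| * (q:ℝ)^L) := by gcongr
      _ = η * (|d| * (q:ℝ)^L * q) := by ring
      _ ≤ η * 1 := by gcongr
      _ = η := mul_one _
  · have : (M:ℝ) < q * j := by nlinarith
    exact_mod_cast this
  · have e : Pk.Qn N q * (((q * j : ℕ) : ℝ) * α - ((j * p : ℤ) : ℝ)) - s = s * (j * X - 1) := by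
      have : α = s * |d| + p / q := by rw [← hsd, hd]; ring
      rw [this, hX]
      push_cast
      field_simp
      ring
    rw [e, abs_mul, hs1, one_mul, abs_of_nonneg (by linarith)]
    linarith

end

noncomputable section
open MeasureTheory Filter Set

lemma conj_F (H : SL) (t x) : (H.conj t).F x = H.F (rotL t (H.G x)) := rfl
lemma conj_G (H : SL) (t x) : (H.conj t).G x = H.F (rotL (-t) (H.G x)) := rfl

lemma rotL_add (t : ℝ) (x : R2) : rotL t x = x + (t, 0) := by ext <;> simp [rotL]

/-- Closeness of conjugates. -/
lemma stepClose (P : Pk) {N : ℕ} (hN : 0 < N) (H : SL) (n : ℕ) : ∃ (C : ℝ) (L : ℕ), 0 ≤ C ∧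
    ∀ (q : ℕ) (hq : 0 < q) (α : ℝ) (p m : ℤ), ∀ i ≤ n, ∀ x,
      ‖iD i (fun y => ((H.comp (P.hS N q hN hq)).conj (m * α)).F y - (H.conj (m * α)).F y) x‖
        ≤ C * (q:ℝ) ^ L * (|(m:ℝ)| * |α - p / q|) := by
  obtain ⟨⟨U, hU, eU⟩, V, hV, eV⟩ := P.PB_h N hN
  have A := H.PB.comp hU
  have A' := hV.comp H.inv.PB
  obtain ⟨C1, L1, hC1, h1⟩ := A.2 (n + 1)
  obtain ⟨C2, L2, hC2, h2⟩ := A'.2 n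
  obtain ⟨B, hB, hB'⟩ := H.Bd (n + 1)
  obtain ⟨D, hD, hD'⟩ := H.inv.Bd n
  refine ⟨n.factorial * C1 * C2 ^ n + n.factorial * B * D ^ n, L1 + L2 * n, by positivity, ?_⟩
  intro q hq α p m i hi x
  have hq1 : (1:ℝ) ≤ q := by exact_mod_cast hq
  set h := P.hS N q hN hq with hh
  have k1 := close_rot (s := m * α) (t := m * p / q) (h1 q hq) (h2 q hq) (A.1 q) (A'.1 q) (by positivity)
    (one_le_mul_of_one_le_of_one_le hC2 (one_le_pow₀ hq1)) hi x
  have k2 := close_rot (s := m * α) (t := m * p / q) hB' hD' H.sF H.inv.sF (by positivity) hD hi x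
  have est : |(m:ℝ) * α - m * p / q| = |(m:ℝ)| * |α - p / q| := by
    rw [← abs_mul]; congr 1; ring
  rw [est] at k1 k2
  set τ := |(m:ℝ)| * |α - p / q|
  have hτ : 0 ≤ τ := by positivity
  set f1 : R2 → R2 := fun y => (H.F ∘ U q) (rotL (m * α) ((V q ∘ H.inv.F) y)) -
    (H.F ∘ U q) (rotL (m * p / q) ((V q ∘ H.inv.F) y)) with hf1
  set f2 : R2 → R2 := fun y => H.F (rotL (m * α) (H.inv.F y)) - H.F (rotL (m * p / q) (H.inv.F y)) with hf2
  have e : (fun y => ((H.comp h).conj (m * α)).F y - (H.conj (m * α)).F y) = f1 - f2 := by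
    funext y
    simp only [hf1, hf2, Pi.sub_apply, Function.comp_apply, eU q hq, eV q hq, conj_F]
    have s1 : h.F (rotL (m * p / q) (h.G (H.inv.F y))) = rotL (m * p / q) (H.inv.F y) := by
      have := P.hS_shift N q hN hq (h.G (H.inv.F y)) (m * p)
      push_cast at this
      rw [rotL_add, rotL_add, hh, this, ← hh, h.FG]
    rw [← hh, s1]
    show H.F (h.F (rotL (m * α) (h.G (H.G y)))) - H.F (rotL (m * α) (H.G y)) =
      H.F (h.F (rotL (m * α) (h.G (H.G y)))) - H.F (rotL (m * p / q) (H.G y)) -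
      (H.F (rotL (m * α) (H.G y)) - H.F (rotL (m * p / q) (H.G y)))
    abel
  have sr : ∀ s, Sm (rotL s) := fun s => (SL.rot s).sF
  have sm1 : Sm f1 := (((A.1 q).comp (sr _)).comp (A'.1 q)).sub (((A.1 q).comp (sr _)).comp (A'.1 q))
  have sm2 : Sm f2 := ((H.sF.comp (sr _)).comp H.inv.sF).sub ((H.sF.comp (sr _)).comp H.inv.sF)
  rw [e, iD, iteratedFDeriv_sub_apply (sm1.at' i x) (sm2.at' i x)]
  refine (norm_sub_le _ _).trans ((add_le_add k1 k2).trans ?_)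
  have e1 : (n.factorial : ℝ) * (C1 * (q:ℝ) ^ L1 * τ) * (C2 * (q:ℝ) ^ L2) ^ n =
    n.factorial * C1 * C2 ^ n * (q:ℝ) ^ (L1 + L2 * n) * τ := by
    rw [mul_pow, ← pow_mul, pow_add]; ring
  have e2 : (n.factorial : ℝ) * (B * τ) * D ^ n ≤ n.factorial * B * D ^ n * (q:ℝ) ^ (L1 + L2 * n) * τ := by
    have : (1:ℝ) ≤ (q:ℝ) ^ (L1 + L2 * n) := one_le_pow₀ hq1
    have h0 : 0 ≤ (n.factorial : ℝ) * B * D ^ n := by positivity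
    calc (n.factorial : ℝ) * (B * τ) * D ^ n = n.factorial * B * D ^ n * 1 * τ := by ring
      _ ≤ _ := by gcongr
  rw [e1]
  refine (add_le_add le_rfl e2).trans (le_of_eq ?_)
  ring

lemma rot_ext_int (t : ℝ) (k : ℤ) (y : XX) : (SL.rot (t - k)).ext y = (SL.rot t).ext y := by
  rw [SL.ext_rot, SL.ext_rot]
  have : ((t - k : ℝ) : T1) = (t : T1) := by
    rw [AddCircle.coe_sub, sub_eq_self, AddCircle.coe_eq_zero_iff]
    exact ⟨k, by simp⟩
  rw [this]

/-- One perturbation step. -/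
lemma step1 {α : ℝ} (hα : Liouville α) (H : SL) (n M K : ℕ) {η ε : ℝ} (hη : 0 < η) (hε : 0 < ε) :
    ∃ (h : SL) (M' : ℕ), M < M' ∧
      (∀ m : ℤ, |m| ≤ M → ∀ i ≤ n, ∀ x,
        ‖iD i (fun y => ((H.comp h).conj (m * α)).F y - (H.conj (m * α)).F y) x‖ ≤ η) ∧
      (∀ A, MeasurableSet A → |h.nu.real A - mm.real A| ≤ ε) ∧
      ∀ a a', bx K a → bx K a' → ¬ (a = 0 ∧ a' = 0) →
        ‖∫ y, EE a (h.ext ((SL.rot (M' * α)).ext y)) * EE a' (h.ext y) ∂mm‖ ≤ ε := by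
  obtain ⟨P, N, hN, q0, δ', hδ, hmix⟩ := mixH K hε
  obtain ⟨C, L, hC, hcl⟩ := stepClose P hN H n
  obtain ⟨q, p, M', s, k, hq, hq0, hsm, hM, hs, hτ⟩ := liou hα hN L (C := C * M) hη hδ q0 M
  obtain ⟨m1, m2⟩ := hmix q hq hq0
  refine ⟨P.hS N q hN hq, M', hM, ?_, m1, ?_⟩
  · intro m hm i hi x
    refine (hcl q hq α p m i hi x).trans (le_trans ?_ hsm)
    have hm' : |(m:ℝ)| ≤ M := by exact_mod_cast hm
    calc C * (q:ℝ) ^ L * (|(m:ℝ)| * |α - p / q|) ≤ C * (q:ℝ) ^ L * (M * |α - p / q|) := by gcongr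
      _ = _ := by ring
  · intro a a' ha ha' hne
    have := m2 s (M' * α - k) a a' hs hτ ha ha' hne
    simpa only [rot_ext_int] using this

end

noncomputable section
open MeasureTheory Filter Set

lemma span_ind {p : C(XX, ℂ) → Prop} (hE : ∀ a, p (EE a)) (hadd : ∀ f g, p f → p g → p (f + g))
    (hsmul : ∀ (c : ℂ) f, p f → p (c • f))
    (hcl : ∀ f, (∀ δ > 0, ∃ g, p g ∧ ‖f - g‖ ≤ δ) → p f) : ∀ f, p f := by
  have h1 : ∀ f ∈ Submodule.span ℂ (range EE), p f := by
    intro f hf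
    induction hf using Submodule.span_induction with
    | mem x hx => obtain ⟨a, rfl⟩ := hx; exact hE a
    | zero =>
      have := hsmul 0 _ (hE 0)
      have e : (0:ℂ) • EE 0 = 0 := by ext y; simp
      exact e ▸ this
    | add x y _ _ hx hy => exact hadd x y hx hy
    | smul c x _ hx => exact hsmul c x hx
  intro f
  have hf : f ∈ EA.topologicalClosure := by rw [EA_dense]; trivial
  have hf' : f ∈ closure (EA : Set C(XX, ℂ)) := hf
  refine hcl f fun δ hδ => ?_
  obtain ⟨g, hg, hd⟩ := Metric.mem_closure_iff.1 hf' δ hδ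
  exact ⟨g, h1 g hg, by rw [← dist_eq_norm]; exact hd.le⟩

/-- Correlation. -/
def Dc (ν : Measure XX) (u w : XX → XX) (f g : C(XX, ℂ)) : ℂ :=
  ∫ y, f (u y) * g (w y) ∂ν - (∫ y, f (u y) ∂ν) * ∫ y, g (w y) ∂ν

lemma int_cm {ν : Measure XX} [IsFiniteMeasure ν] {u : XX → XX} (hu : Measurable u) (f : C(XX, ℂ)) :
    Integrable (fun y => f (u y)) ν :=
  Integrable.of_bound (f.continuous.measurable.comp hu).aestronglyMeasurable ‖f‖
    (Eventually.of_forall fun _ => f.norm_coe_le_norm _)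

lemma int_cm2 {ν : Measure XX} [IsFiniteMeasure ν] {u w : XX → XX} (hu : Measurable u)
    (hw : Measurable w) (f g : C(XX, ℂ)) : Integrable (fun y => f (u y) * g (w y)) ν :=
  Integrable.of_bound ((f.continuous.measurable.comp hu).mul
    (g.continuous.measurable.comp hw)).aestronglyMeasurable (‖f‖ * ‖g‖)
    (Eventually.of_forall fun _ => by
      rw [norm_mul]
      exact mul_le_mul (f.norm_coe_le_norm _) (g.norm_coe_le_norm _) (norm_nonneg _) (norm_nonneg _))

lemma norm_int_le {ν : Measure XX} [IsProbabilityMeasure ν] {f : XX → ℂ} {C : ℝ} (h : ∀ y, ‖f y‖ ≤ C) :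
    ‖∫ y, f y ∂ν‖ ≤ C := by
  have := norm_integral_le_of_norm_le_const (μ := ν) (Eventually.of_forall h)
  simpa using this

lemma Dc_add {ν : Measure XX} [IsProbabilityMeasure ν] {u w : XX → XX} (hu : Measurable u) (hw : Measurable w)
    (f f' g) : Dc ν u w (f + f') g = Dc ν u w f g + Dc ν u w f' g := by
  simp only [Dc, ContinuousMap.add_apply, add_mul]
  rw [integral_add (int_cm2 hu hw f g) (int_cm2 hu hw f' g), integral_add (int_cm hu f) (int_cm hu f')]
  ring

lemma Dc_smul {ν : Measure XX} {u w : XX → XX} (c : ℂ) (f g) : Dc ν u w (c • f) g = c * Dc ν u w f g := by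
  simp only [Dc, ContinuousMap.smul_apply, smul_eq_mul, mul_assoc]
  rw [integral_const_mul, integral_const_mul]
  ring

lemma Dc_norm {ν : Measure XX} [IsProbabilityMeasure ν] {u w : XX → XX} (f g) : ‖Dc ν u w f g‖ ≤ 2 * ‖f‖ * ‖g‖ := by
  have h1 : ‖∫ y, f (u y) * g (w y) ∂ν‖ ≤ ‖f‖ * ‖g‖ := norm_int_le fun y => by
    rw [norm_mul]
    exact mul_le_mul (f.norm_coe_le_norm _) (g.norm_coe_le_norm _) (norm_nonneg _) (norm_nonneg _)
  have h2 : ‖∫ y, f (u y) ∂ν‖ ≤ ‖f‖ := norm_int_le fun y => f.norm_coe_le_norm _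
  have h3 : ‖∫ y, g (w y) ∂ν‖ ≤ ‖g‖ := norm_int_le fun y => g.norm_coe_le_norm _
  refine (norm_sub_le _ _).trans ?_
  rw [norm_mul]
  nlinarith [mul_le_mul h2 h3 (norm_nonneg _) (norm_nonneg _)]

lemma Dc_comm (ν u w f g) : Dc ν u w f g = Dc ν w u g f := by
  simp only [Dc, mul_comm]

lemma Dc_lim1 {ν : ℕ → Measure XX} [∀ j, IsProbabilityMeasure (ν j)] {u w : ℕ → XX → XX}
    (hu : ∀ j, Measurable (u j)) (hw : ∀ j, Measurable (w j)) (g : C(XX, ℂ))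
    (h : ∀ a, Tendsto (fun j => Dc (ν j) (u j) (w j) (EE a) g) atTop (nhds 0)) (f : C(XX, ℂ)) :
    Tendsto (fun j => Dc (ν j) (u j) (w j) f g) atTop (nhds 0) := by
  refine span_ind (p := fun f => Tendsto (fun j => Dc (ν j) (u j) (w j) f g) atTop (nhds 0)) h ?_ ?_ ?_ f
  · intro f f' h1 h2
    simp only [Dc_add (hu _) (hw _)]
    simpa using h1.add h2
  · intro c f h1
    simp only [Dc_smul]
    simpa using h1.const_mul c
  · intro f hf
    rw [Metric.tendsto_atTop]
    intro ε hε
    obtain ⟨f', hf', hd⟩ := hf (ε / (4 * (‖g‖ + 1))) (by positivity)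
    obtain ⟨N, hN⟩ := Metric.tendsto_atTop.1 hf' (ε / 2) (by positivity)
    refine ⟨N, fun j hj => ?_⟩
    have h1 := hN j hj
    rw [dist_zero_right] at h1 ⊢
    have h2 : Dc (ν j) (u j) (w j) f g = Dc (ν j) (u j) (w j) (f - f') g + Dc (ν j) (u j) (w j) f' g := by
      rw [← Dc_add (hu _) (hw _), sub_add_cancel]
    have h3 := Dc_norm (ν := ν j) (u := u j) (w := w j) (f - f') g
    have h4 : 2 * ‖f - f'‖ * ‖g‖ ≤ ε / 2 := by
      have : ‖f - f'‖ * (4 * (‖g‖ + 1)) ≤ ε := by rwa [le_div_iff₀ (by positivity)] at hd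
      nlinarith [norm_nonneg (f - f'), norm_nonneg g]
    rw [h2]
    refine (norm_add_le _ _).trans_lt ?_
    linarith

lemma Dc_lim {ν : ℕ → Measure XX} [∀ j, IsProbabilityMeasure (ν j)] {u w : ℕ → XX → XX}
    (hu : ∀ j, Measurable (u j)) (hw : ∀ j, Measurable (w j))
    (h : ∀ a a', Tendsto (fun j => Dc (ν j) (u j) (w j) (EE a) (EE a')) atTop (nhds 0)) (f g : C(XX, ℂ)) :
    Tendsto (fun j => Dc (ν j) (u j) (w j) f g) atTop (nhds 0) := by
  refine Dc_lim1 hu hw g (fun a => ?_) f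
  simp only [fun j => Dc_comm (ν j) (u j) (w j)]
  refine Dc_lim1 hw hu _ (fun a' => ?_) g
  simpa only [fun j => Dc_comm (ν j) (u j) (w j)] using h a a'

lemma EE0 (y : XX) : EE 0 y = 1 := by rw [EE_zero]; rfl

lemma bx_big (a : ℤ × ℤ × ℤ) : ∃ K : ℕ, ∀ j ≥ K, bx j a := by
  refine ⟨a.1.natAbs + a.2.1.natAbs + a.2.2.natAbs, fun j hj => ?_⟩
  unfold bx
  refine ⟨?_, ?_, ?_⟩ <;> · rw [Int.abs_eq_natAbs]; norm_cast; omega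

lemma bx_fin (n : ℕ) : {a : ℤ × ℤ × ℤ | bx n a}.Finite := by
  refine ((finite_Icc (-(n:ℤ)) n).prod ((finite_Icc (-(n:ℤ)) n).prod (finite_Icc (-(n:ℤ)) n))).subset ?_
  rintro a ⟨h1, h2, h3⟩
  simp only [abs_le] at h1 h2 h3
  refine ⟨?_, ?_, ?_⟩
  · exact ⟨by exact_mod_cast h1.1, by exact_mod_cast h1.2⟩
  · exact ⟨by exact_mod_cast h2.1, by exact_mod_cast h2.2⟩
  · exact ⟨by exact_mod_cast h3.1, by exact_mod_cast h3.2⟩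

end

noncomputable section
open MeasureTheory Filter Set

lemma SL.meas_ext (H : SL) : Measurable H.ext := H.continuous_ext.measurable

lemma SL.nu_comp (H h : SL) {A : Set XX} (hA : MeasurableSet A) :
    (H.comp h).nu.real A = h.nu.real (H.ext ⁻¹' A) := by
  unfold SL.nu
  rw [measureReal_def, measureReal_def, Measure.map_apply (SL.meas_ext _) hA,
    Measure.map_apply (SL.meas_ext _) (H.meas_ext hA)]
  have : (H.comp h).ext = H.ext ∘ h.ext := funext fun y => SL.ext_comp _ _ y
  rw [this, preimage_comp]

lemma SL.int_nu (H : SL) {f : XX → ℂ} (hf : Measurable f) :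
    ∫ y, f y ∂H.nu = ∫ y, f (H.ext y) ∂mm :=
  integral_map H.meas_ext.aemeasurable hf.aestronglyMeasurable

lemma mEE (a) : Measurable (EE a) := (EE a).continuous.measurable

lemma SL.Dc_conj (H h : SL) (t : ℝ) (a a') :
    Dc (H.comp h).nu ((H.comp h).conj t).ext id (EE a) (EE a') =
      Dc mm (h.ext ∘ (SL.rot t).ext) h.ext ((EE a).comp ⟨H.ext, H.continuous_ext⟩)
        ((EE a').comp ⟨H.ext, H.continuous_ext⟩) := by
  unfold Dc
  have m1 : Measurable fun y => EE a (((H.comp h).conj t).ext y) := (mEE a).comp (SL.meas_ext _)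
  have m2 : Measurable fun y => EE a' (id y) := mEE a'
  have m3 : Measurable fun y => EE a (((H.comp h).conj t).ext y) * EE a' (id y) := m1.mul m2
  rw [SL.int_nu _ m3, SL.int_nu _ m1, SL.int_nu _ m2]
  simp only [SL.conj_ext]
  simp only [SL.ext_comp]
  rfl

/-- The full step. -/
lemma step2 {α : ℝ} (hα : Liouville α) (H : SL) (n M : ℕ) {ε : ℝ} (hε : 0 < ε) :
    ∃ (H' : SL) (M' : ℕ), M < M' ∧
      (∀ m : ℤ, |m| ≤ M → ∀ i ≤ n + 1, ∀ x,
        ‖iD i (fun y => (H'.conj (m * α)).F y - (H.conj (m * α)).F y) x‖ ≤ ε) ∧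
      (∀ A, MeasurableSet A → |H'.nu.real A - H.nu.real A| ≤ ε) ∧
      (∀ a a', bx n a → bx n a' → ‖Dc H'.nu (H'.conj (M' * α)).ext id (EE a) (EE a')‖ ≤ ε) ∧
      (∀ m : ℤ, |m| ≤ M → ∀ a, bx n a → ∀ y,
        ‖EE a ((H'.conj (m * α)).ext y) - EE a ((H.conj (m * α)).ext y)‖ ≤ ε) := by
  choose B hB1 hB using fun m : ℤ => (H.conj (m * α)).inv.Bd 1
  obtain ⟨B0, hB0⟩ : ∃ B0 : ℝ, ∀ m : ℤ, |m| ≤ M → B m ≤ B0 := by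
    obtain ⟨b, hb⟩ := ((finite_Icc (-(M:ℤ)) M).image B).bddAbove
    exact ⟨b, fun m hm => hb ⟨m, abs_le.1 hm, rfl⟩⟩
  have hB01 : 1 ≤ B0 := (hB1 0).trans (hB0 0 (by simp))
  set η := min ε (ε / (16 * (n + 1) * (1 + B0))) with hη
  have hη0 : 0 < η := by positivity
  choose h M' hM hcl hnu hmix using fun j : ℕ => step1 hα H (n + 1) M j hη0 (Nat.one_div_pos_of_nat (α := ℝ) (n := j))
  have l0 : Tendsto (fun j : ℕ => (1:ℝ) / (j + 1)) atTop (nhds 0) := tendsto_one_div_add_atTop_nhds_zero_nat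
  have hu : ∀ j, Measurable ((h j).ext ∘ (SL.rot (M' j * α)).ext) := fun j => (SL.meas_ext _).comp (SL.meas_ext _)
  have hw : ∀ j, Measurable (h j).ext := fun j => (SL.meas_ext _)
  have key : ∀ b b', Tendsto (fun j => Dc mm ((h j).ext ∘ (SL.rot (M' j * α)).ext) (h j).ext (EE b) (EE b'))
      atTop (nhds 0) := by
    intro b b'
    by_cases hb : b = 0 ∧ b' = 0
    · obtain ⟨rfl, rfl⟩ := hb
      simp [Dc, EE0]
    obtain ⟨K, hK⟩ := bx_big b
    obtain ⟨K', hK'⟩ := bx_big b'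
    refine squeeze_zero_norm' (a := fun j : ℕ => 2 * ((1:ℝ) / (j + 1))) ?_ (by simpa using l0.const_mul 2)
    filter_upwards [eventually_ge_atTop K, eventually_ge_atTop K'] with j h1 h2
    have b0 : bx j 0 := by simp [bx]
    have e1 := hmix j b b' (hK j h1) (hK' j h2) hb
    have e2 : ‖(∫ y, EE b ((h j).ext ((SL.rot (M' j * α)).ext y)) ∂mm) * ∫ y, EE b' ((h j).ext y) ∂mm‖
        ≤ 1 / (j + 1) := by
      rw [norm_mul]
      have n1 : ‖∫ y, EE b ((h j).ext ((SL.rot (M' j * α)).ext y)) ∂mm‖ ≤ 1 := norm_int_le fun y => (EE_norm _ _).le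
      have n2 : ‖∫ y, EE b' ((h j).ext y) ∂mm‖ ≤ 1 := norm_int_le fun y => (EE_norm _ _).le
      by_cases hb0 : b = 0
      · have hb' : b' ≠ 0 := fun h => hb ⟨hb0, h⟩
        have := hmix j 0 b' b0 (hK' j h2) (fun h => hb' h.2)
        simp only [EE0, one_mul] at this
        nlinarith [norm_nonneg (∫ y, EE b ((h j).ext ((SL.rot (M' j * α)).ext y)) ∂mm), norm_nonneg (∫ y, EE b' ((h j).ext y) ∂mm)]
      · have := hmix j b 0 (hK j h1) b0 (fun h => hb0 h.1)
        simp only [EE0, mul_one] at this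
        nlinarith [norm_nonneg (∫ y, EE b ((h j).ext ((SL.rot (M' j * α)).ext y)) ∂mm), norm_nonneg (∫ y, EE b' ((h j).ext y) ∂mm)]
    refine (norm_sub_le _ _).trans ?_
    simp only [Function.comp_apply]
    linarith
  have key2 := fun f g => Dc_lim (ν := fun _ => mm) hu hw key f g
  have ev : ∀ᶠ j in atTop, ∀ a ∈ {a | bx n a}, ∀ a' ∈ {a | bx n a},
      ‖Dc mm ((h j).ext ∘ (SL.rot (M' j * α)).ext) (h j).ext ((EE a).comp ⟨H.ext, H.continuous_ext⟩)
        ((EE a').comp ⟨H.ext, H.continuous_ext⟩)‖ ≤ ε := by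
    rw [eventually_all_finite (bx_fin n)]
    intro a _
    rw [eventually_all_finite (bx_fin n)]
    intro a' _
    have := (key2 ((EE a).comp ⟨H.ext, H.continuous_ext⟩) ((EE a').comp ⟨H.ext, H.continuous_ext⟩)).norm
    rw [norm_zero] at this
    exact (this.eventually_lt_const hε).mono fun _ h => h.le
  obtain ⟨j, hj1, hj2⟩ := (ev.and (l0.eventually_lt_const hε)).exists
  refine ⟨H.comp (h j), M' j, hM j, ?_, ?_, ?_, ?_⟩
  · intro m hm i hi x
    exact (hcl j m hm i hi x).trans (min_le_left _ _)
  · intro A hA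
    rw [SL.nu_comp _ _ hA]
    have : H.nu.real A = mm.real (H.ext ⁻¹' A) := by
      unfold SL.nu
      rw [measureReal_def, measureReal_def, Measure.map_apply (SL.meas_ext _) hA]
    rw [this]
    exact (hnu j _ (H.meas_ext hA)).trans hj2.le
  · intro a a' ha ha'
    rw [SL.Dc_conj]
    exact hj1 a ha a' ha'
  · intro m hm a ha y
    refine (EE_close (K := n) (η := η) (B := B0) ?_ ?_ ?_ ha y).trans ?_
    · intro x
      have := hB m 1 le_rfl le_rfl x
      rw [norm_iteratedFDeriv_one] at this
      exact this.trans (hB0 m hm)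
    · intro x
      have := hcl j m hm 0 (by omega) x
      rwa [iD, norm_iteratedFDeriv_zero] at this
    · intro x
      have := hcl j m hm 1 (by omega) x
      rw [iD, norm_iteratedFDeriv_one, fderiv_fun_sub (SL.diffF _ _) (SL.diffF _ _)] at this
      exact this
    · have h1 : η * (16 * (n + 1) * (1 + B0)) ≤ ε := by
        rw [← le_div_iff₀ (by positivity)]; exact min_le_right _ _
      refine le_trans ?_ h1
      have : (0:ℝ) ≤ 16 * (1 + B0) * η := by positivity
      nlinarith

end

noncomputable section
open MeasureTheory Filter Set

lemma limF (f : ℕ → R2 → R2) (sf : ∀ n, Sm (f n))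
    (hb : ∀ j, ∀ i ≤ j + 1, ∀ x, ‖iD i (fun y => f (j + 1) y - f j y) x‖ ≤ (1 / 2 : ℝ) ^ j) :
    ∃ F, Sm F ∧ ∀ n, ∀ i ≤ n + 1, ∀ x, ‖iD i (fun y => F y - f n y) x‖ ≤ 2 * (1 / 2 : ℝ) ^ n := by
  set g : ℕ → R2 → R2 := fun j y => f (j + 1) y - f j y with hg
  have sg : ∀ j, Sm (g j) := fun j => (sf _).sub (sf _)
  have hsum : Summable fun j : ℕ => (1 / 2 : ℝ) ^ j := summable_geometric_two
  have gs : ∀ y, Summable fun j => g j y := fun y =>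
    Summable.of_norm_bounded hsum fun j => by
      have := hb j 0 (by omega) y
      rwa [iD, norm_iteratedFDeriv_zero] at this
  have tel : ∀ n y, f 0 y + ∑' j, g j y - f n y = ∑' j, g (j + n) y := by
    intro n y
    have h1 := (gs y).sum_add_tsum_nat_add n
    have h2 : ∑ i ∈ Finset.range n, g i y = f n y - f 0 y := Finset.sum_range_sub (fun j => f j y) n
    rw [← h1, h2]; abel
  refine ⟨fun y => f 0 y + ∑' j, g j y, ?_, ?_⟩
  · refine (sf 0).add (contDiff_tsum_of_eventually (v := fun _ j => (1 / 2 : ℝ) ^ j) sg (fun _ _ => hsum) ?_)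
    intro k _
    rw [Nat.cofinite_eq_atTop]
    filter_upwards [eventually_ge_atTop k] with j hj x
    exact hb j k (by omega) x
  · intro n i hi x
    simp only [tel]
    have hs2 : Summable fun j : ℕ => (1 / 2 : ℝ) ^ (j + n) := by
      simp only [pow_add]; exact hsum.mul_right _
    have bb : ∀ (k : ℕ) (j : ℕ) (x : R2), (k : ℕ∞) ≤ ((n + 1 : ℕ) : ℕ∞) →
        ‖iteratedFDeriv ℝ k (g (j + n)) x‖ ≤ (1 / 2 : ℝ) ^ (j + n) := fun k j x hk =>
      hb (j + n) k (by have : k ≤ n + 1 := by exact_mod_cast hk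
                       omega) x
    rw [iD, iteratedFDeriv_tsum_apply (N := ((n + 1 : ℕ) : ℕ∞)) (v := fun _ j => (1 / 2 : ℝ) ^ (j + n))
      (fun j => (sg _).of_le (by exact_mod_cast le_top)) (fun _ _ => hs2) bb (by exact_mod_cast hi)]
    refine (tsum_of_norm_bounded (hs2.hasSum) (fun j => bb i j x (by exact_mod_cast hi))).trans ?_
    simp only [pow_add]
    rw [tsum_mul_right, tsum_geometric_two]

lemma half_lim : Tendsto (fun n : ℕ => 2 * (1 / 2 : ℝ) ^ n) atTop (nhds 0) := by
  have := (tendsto_pow_atTop_nhds_zero_of_lt_one (r := (1/2:ℝ)) (by norm_num) (by norm_num)).const_mul 2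
  simpa using this

/-- `f n` is `C^∞`-close to `F`. -/
def Cl (f : ℕ → R2 → R2) (F : R2 → R2) : Prop :=
  ∀ n, ∀ i ≤ n + 1, ∀ x, ‖iD i (fun y => F y - f n y) x‖ ≤ 2 * (1 / 2 : ℝ) ^ n

lemma Cl.zero {f F} (h : Cl f F) (n x) : ‖F x - f n x‖ ≤ 2 * (1 / 2 : ℝ) ^ n := by
  have := h n 0 (by omega) x
  rwa [iD, norm_iteratedFDeriv_zero] at this

lemma Cl.one {f F} (h : Cl f F) (sf : ∀ n, Sm (f n)) (sF : Sm F) (n x) :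
    ‖fderiv ℝ F x - fderiv ℝ (f n) x‖ ≤ 2 * (1 / 2 : ℝ) ^ n := by
  have := h n 1 (by omega) x
  rwa [iD, norm_iteratedFDeriv_one, fderiv_fun_sub (sF.differentiable (by simp) x)
    ((sf n).differentiable (by simp) x)] at this

lemma Cl.tend {f F} (h : Cl f F) (sF : Sm F) {z : ℕ → R2} {w} (hz : Tendsto z atTop (nhds w)) :
    Tendsto (fun n => f n (z n)) atTop (nhds (F w)) := by
  have h1 : Tendsto (fun n => F (z n) - f n (z n)) atTop (nhds 0) :=
    squeeze_zero_norm (fun n => h.zero n (z n)) half_lim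
  have h2 : Tendsto (fun n => F (z n)) atTop (nhds (F w)) := (sF.continuous.tendsto w).comp hz
  simpa using h2.sub h1

lemma Cl.tend1 {f F} (h : Cl f F) (sf : ∀ n, Sm (f n)) (sF : Sm F) (x) :
    Tendsto (fun n => fderiv ℝ (f n) x) atTop (nhds (fderiv ℝ F x)) := by
  have h1 : Tendsto (fun n => fderiv ℝ F x - fderiv ℝ (f n) x) atTop (nhds 0) :=
    squeeze_zero_norm (fun n => h.one sf sF n x) half_lim
  simpa using (tendsto_const_nhds (x := fderiv ℝ F x)).sub h1

lemma limZ {f : ℕ → R2 → R2} {F} (h : Cl f F) (sF : Sm F) (hp : ∀ n, Zper (f n)) : Zper F := by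
  intro x m
  have h1 := h.tend sF (tendsto_const_nhds (x := ((x.1 + (m.1 : ℝ), x.2 + (m.2 : ℝ)) : R2)))
  have h2 := h.tend sF (tendsto_const_nhds (x := x))
  have h3 := (h2.add_const ((m.1 : ℝ), (m.2 : ℝ)))
  refine tendsto_nhds_unique h1 (h3.congr fun n => ?_)
  rw [hp n x m]; rfl

lemma limS (S : ℕ → SL)
    (hF : ∀ j, ∀ i ≤ j + 1, ∀ x, ‖iD i (fun y => (S (j + 1)).F y - (S j).F y) x‖ ≤ (1 / 2 : ℝ) ^ j)
    (hG : ∀ j, ∀ i ≤ j + 1, ∀ x, ‖iD i (fun y => (S (j + 1)).G y - (S j).G y) x‖ ≤ (1 / 2 : ℝ) ^ j) :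
    ∃ T : SL, Cl (fun n => (S n).F) T.F ∧ Cl (fun n => (S n).G) T.G := by
  obtain ⟨F, sF, cF⟩ := limF (fun n => (S n).F) (fun n => (S n).sF) hF
  obtain ⟨G, sG, cG⟩ := limF (fun n => (S n).G) (fun n => (S n).sG) hG
  have cF' : Cl (fun n => (S n).F) F := cF
  have cG' : Cl (fun n => (S n).G) G := cG
  refine ⟨⟨F, G, sF, sG, limZ cF' sF fun n => (S n).pF, limZ cG' sG fun n => (S n).pG, ?_, ?_, ?_⟩, cF', cG'⟩
  · intro x
    refine tendsto_nhds_unique (cF'.tend sF (cG'.tend sG (tendsto_const_nhds (x := x)))) ?_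
    simp [(S _).FG]
  · intro x
    refine tendsto_nhds_unique (cG'.tend sG (cF'.tend sF (tendsto_const_nhds (x := x)))) ?_
    simp [(S _).GF]
  · intro x
    have h1 := cF'.tend1 (fun n => (S n).sF) sF x
    have h2 := (ContinuousLinearMap.continuous_det (𝕜 := ℝ) (E := R2)).continuousAt.tendsto.comp h1
    refine tendsto_nhds_unique h2 ?_
    simp [Function.comp_def, (S _).dF]

lemma lim_ext {S : ℕ → SL} {T : SL} (h : Cl (fun n => (S n).F) T.F) (y : XX) :
    Tendsto (fun n => (S n).ext y) atTop (nhds (T.ext y)) := by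
  induction y using SL.XX_ind with
  | h a v hv =>
  simp only [SL.ext_mk]
  refine Tendsto.prodMk_nhds ?_ ?_
  · exact (continuous_pro.tendsto _).comp (h.tend T.sF tendsto_const_nhds)
  · have h1 := h.tend1 (fun n => (S n).sF) T.sF a
    have h2 : Tendsto (fun n => fderiv ℝ (S n).F a v) atTop (nhds (fderiv ℝ T.F a v)) :=
      ((ContinuousLinearMap.apply ℝ R2 v).continuous.tendsto _).comp h1
    have h3 : Tendsto (fun n => (⟨_, (S n).D_ne a hv⟩ : {v : R2 // v ≠ 0})) atTop
      (nhds ⟨_, T.D_ne a hv⟩) := tendsto_subtype_rng.2 h2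
    exact (continuous_mkP.tendsto _).comp h3

end

noncomputable section
open MeasureTheory Filter Set

/-- Properties of one step of the inductive construction. -/
def Stp (α : ℝ) (n : ℕ) (H H' : SL) (M M' : ℕ) : Prop := M < M' ∧
      (∀ m : ℤ, |m| ≤ M → ∀ i ≤ n + 1, ∀ x,
        ‖iD i (fun y => (H'.conj (m * α)).F y - (H.conj (m * α)).F y) x‖ ≤ (1 / 2 : ℝ) ^ n) ∧
      (∀ A, MeasurableSet A → |H'.nu.real A - H.nu.real A| ≤ (1 / 2 : ℝ) ^ n) ∧
      (∀ a a', bx n a → bx n a' → ‖Dc H'.nu (H'.conj (M' * α)).ext id (EE a) (EE a')‖ ≤ (1 / 2 : ℝ) ^ n) ∧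
      (∀ m : ℤ, |m| ≤ M → ∀ a, bx n a → ∀ y,
        ‖EE a ((H'.conj (m * α)).ext y) - EE a ((H.conj (m * α)).ext y)‖ ≤ (1 / 2 : ℝ) ^ n)

lemma seqE {α : ℝ} (hα : Liouville α) : ∃ (H : ℕ → SL) (M : ℕ → ℕ), (∀ n, n + 1 ≤ M n) ∧
    ∀ n, Stp α n (H n) (H (n + 1)) (M n) (M (n + 1)) := by
  choose A B hAB using fun (n : ℕ) (p : SL × ℕ) =>
    step2 hα p.1 n p.2 (ε := (1 / 2 : ℝ) ^ n) (by positivity)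
  let s : ℕ → SL × ℕ := fun n => Nat.rec (SL.rot 0, 1) (fun n p => (A n p, B n p)) n
  have hs : ∀ n, Stp α n (s n).1 (s (n + 1)).1 (s n).2 (s (n + 1)).2 := fun n => hAB n (s n)
  refine ⟨fun n => (s n).1, fun n => (s n).2, fun n => ?_, hs⟩
  induction n with
  | zero => exact le_rfl
  | succ n ih => exact Nat.succ_le_of_lt (lt_of_le_of_lt ih (hs n).1)

lemma conj_FF (H : SL) (s t : ℝ) (x) : (H.conj (s + t)).F x = (H.conj s).F ((H.conj t).F x) := by
  simp only [conj_F, H.GF]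
  congr 1
  ext <;> simp [rotL]; ring

lemma bx_mono {n k : ℕ} (h : n ≤ k) {a} (ha : bx n a) : bx k a := by
  have : (n:ℤ) ≤ k := by exact_mod_cast h
  exact ⟨ha.1.trans this, ha.2.1.trans this, ha.2.2.trans this⟩

lemma half_mono {n k : ℕ} (h : n ≤ k) : (1 / 2 : ℝ) ^ k ≤ (1 / 2 : ℝ) ^ n :=
  pow_le_pow_of_le_one (by norm_num) (by norm_num) h

lemma mainE {α : ℝ} (hα : Liouville α) : ∃ (H : ℕ → SL) (M : ℕ → ℕ) (f : SL), (∀ n, n + 1 ≤ M n) ∧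
    StrictMono M ∧ Cl (fun k => ((H (k + 1)).conj α).F) f.F ∧ Cl (fun k => ((H (k + 1)).conj α).G) f.G ∧
    (∀ n A, MeasurableSet A → |(H (n + 1)).nu.real A - (H n).nu.real A| ≤ (1 / 2 : ℝ) ^ n) ∧
    (∀ n a a', bx n a → bx n a' →
      ‖Dc (H (n + 1)).nu ((H (n + 1)).conj (M (n + 1) * α)).ext id (EE a) (EE a')‖ ≤ (1 / 2 : ℝ) ^ n) ∧
    (∀ n m : ℕ, m ≤ M n → ∀ a, bx n a → ∀ y,
      ‖EE a (((H n).conj (m * α)).ext y) - EE a (f.ext^[m] y)‖ ≤ 2 * (1 / 2 : ℝ) ^ n) := by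
  obtain ⟨H, M, hM, hs⟩ := seqE hα
  have Mm : StrictMono M := strictMono_nat_of_lt_succ fun n => (hs n).1
  have lim : ∀ m : ℤ, ∃ T : SL, Cl (fun k => ((H (k + m.natAbs)).conj (m * α)).F) T.F ∧
      Cl (fun k => ((H (k + m.natAbs)).conj (m * α)).G) T.G := by
    intro m
    have hm : ∀ k, |m| ≤ M (k + m.natAbs) := fun k => by
      have := hM (k + m.natAbs); rw [Int.abs_eq_natAbs]; norm_cast; omega
    refine limS (fun k => (H (k + m.natAbs)).conj (m * α)) ?_ ?_
    · intro j i hi x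
      have := (hs (j + m.natAbs)).2.1 m (hm j) i (by omega) x
      rw [show j + 1 + m.natAbs = j + m.natAbs + 1 by omega]
      exact this.trans (half_mono (by omega))
    · intro j i hi x
      have := (hs (j + m.natAbs)).2.1 (-m) (by rw [abs_neg]; exact hm j) i (by omega) x
      rw [show j + 1 + m.natAbs = j + m.natAbs + 1 by omega]
      have e : ((-m : ℤ) : ℝ) * α = -(m * α) := by push_cast; ring
      rw [e] at this
      exact this.trans (half_mono (by omega))
  choose T hTF hTG using lim
  have pt : ∀ (m : ℤ) (z : ℕ → R2) w, Tendsto z atTop (nhds w) →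
      Tendsto (fun n => ((H n).conj (m * α)).F (z n)) atTop (nhds ((T m).F w)) := by
    intro m z w hz
    have h1 := (hTF m).tend (T m).sF (hz.comp (tendsto_add_atTop_nat m.natAbs))
    exact (tendsto_add_atTop_iff_nat (f := fun n => ((H n).conj (m * α)).F (z n)) m.natAbs).1 h1
  have it : ∀ m : ℕ, ∀ y, (T m).ext y = (T 1).ext^[m] y := by
    intro m
    induction m with
    | zero =>
      intro y
      have e : (T (0:ℕ)).F = (SL.rot 0).F := by
        funext x
        refine tendsto_nhds_unique (pt _ _ _ (tendsto_const_nhds (x := x))) ?_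
        simp only [conj_F, Nat.cast_zero, Int.cast_zero, zero_mul]
        have : ∀ x : R2, rotL 0 x = x := fun x => by ext <;> simp [rotL]
        simp [this, SL.FG, SL.rot]
      rw [SL.ext_congr' e, SL.ext_rot]
      simp
    | succ m ih =>
      intro y
      have e : (T ((m + 1 : ℕ) : ℤ)).F = ((T 1).comp (T m)).F := by
        funext x
        refine tendsto_nhds_unique (pt _ _ _ (tendsto_const_nhds (x := x))) ?_
        have h1 := pt 1 _ _ (pt m _ _ (tendsto_const_nhds (x := x)))
        refine h1.congr fun n => ?_
        rw [← conj_FF]; congr 2; push_cast; ring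
      rw [SL.ext_congr' e, SL.ext_comp, ih, Function.iterate_succ_apply']
  refine ⟨H, M, T 1, hM, Mm, by simpa using hTF 1, by simpa using hTG 1, fun n A hA => (hs n).2.2.1 A hA,
    fun n a a' ha ha' => (hs n).2.2.2.1 a a' ha ha', ?_⟩
  intro n m hm a ha y
  rw [← it]
  have h1 : ∀ k, dist (EE a (((H (k + n)).conj (m * α)).ext y)) (EE a (((H (k + 1 + n)).conj (m * α)).ext y)) ≤
      (1 / 2 : ℝ) ^ n * (1 / 2) ^ k := by
    intro k
    have := (hs (k + n)).2.2.2.2 m (by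
      have := Mm.monotone (show n ≤ k + n by omega); simp; omega) a (bx_mono (by omega) ha) y
    rw [dist_comm, dist_eq_norm, show k + 1 + n = k + n + 1 by omega, ← pow_add, add_comm n]
    simpa using this
  have h2 : Tendsto (fun k => EE a (((H (k + n)).conj (m * α)).ext y)) atTop (nhds (EE a ((T m).ext y))) := by
    have := (((EE a).continuous.tendsto _).comp (lim_ext (hTF m) y))
    have h3 := (tendsto_add_atTop_iff_nat (f := fun n => EE a (((H n).conj (((m:ℤ):ℝ) * α)).ext y)) (m:ℤ).natAbs).1 this
    have h4 := (tendsto_add_atTop_iff_nat n).2 h3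
    simpa using h4
  have := dist_le_of_le_geometric_of_tendsto₀ (1 / 2 : ℝ) ((1 / 2 : ℝ) ^ n) (by norm_num) h1 h2
  rw [dist_eq_norm] at this
  simp only [zero_add] at this
  refine this.trans (le_of_eq ?_)
  ring

end

noncomputable section
open MeasureTheory Filter Set

lemma pdv_le {g : R2 → ℝ} (hg : ContDiff ℝ (⊤ : ℕ∞) g) {v : R2} (hv : ‖v‖ ≤ 1) (n x) :
    ‖iteratedFDeriv ℝ n (fun y => fderiv ℝ g y v) x‖ ≤ ‖iteratedFDeriv ℝ (n + 1) g x‖ := by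
  have sd : ContDiff ℝ (⊤ : ℕ∞) (fderiv ℝ g) := hg.fderiv_right (by simp)
  have e : (fun y => fderiv ℝ g y v) = (ContinuousLinearMap.apply ℝ ℝ v) ∘ fderiv ℝ g := rfl
  rw [e]
  refine (ContinuousLinearMap.norm_iteratedFDeriv_comp_left _ (n := n) sd.contDiffAt
    (by exact_mod_cast le_top)).trans ?_
  rw [norm_iteratedFDeriv_fderiv]
  have : ‖ContinuousLinearMap.apply ℝ ℝ v‖ ≤ 1 :=
    ContinuousLinearMap.opNorm_le_bound _ zero_le_one fun L => by
      simp only [ContinuousLinearMap.apply_apply, one_mul]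
      exact (L.le_opNorm v).trans (mul_le_of_le_one_right (norm_nonneg _) hv)
  exact mul_le_of_le_one_left (norm_nonneg _) this

lemma pd_smooth {g : R2 → ℝ} (hg : ContDiff ℝ (⊤ : ℕ∞) g) (v : R2) :
    ContDiff ℝ (⊤ : ℕ∞) (fun y => fderiv ℝ g y v) :=
  (hg.fderiv_right (m := (⊤ : ℕ∞)) (by simp)).clm_apply contDiff_const

lemma pdit {v : R2} (hv : ‖v‖ ≤ 1) (k : ℕ) : ∀ {g : R2 → ℝ}, ContDiff ℝ (⊤ : ℕ∞) g →
    ContDiff ℝ (⊤ : ℕ∞) ((fun (f : R2 → ℝ) y => fderiv ℝ f y v)^[k] g) ∧ ∀ n x,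
    ‖iteratedFDeriv ℝ n ((fun (f : R2 → ℝ) y => fderiv ℝ f y v)^[k] g) x‖ ≤ ‖iteratedFDeriv ℝ (n + k) g x‖ := by
  induction k with
  | zero => intro g hg; exact ⟨hg, fun n x => le_rfl⟩
  | succ k ih =>
    intro g hg
    obtain ⟨h1, h2⟩ := ih (pd_smooth hg v)
    refine ⟨h1, fun n x => (h2 n x).trans ?_⟩
    exact pdv_le hg hv (n + k) x

lemma pdm_le {g : R2 → ℝ} (hg : ContDiff ℝ (⊤ : ℕ∞) g) (a : ℕ × ℕ) (x) :
    |pdm a g x| ≤ ‖iteratedFDeriv ℝ (a.1 + a.2) g x‖ := by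
  obtain ⟨h1, h2⟩ := pdit (v := ((0:ℝ), (1:ℝ))) (by simp) a.2 hg
  obtain ⟨h3, h4⟩ := pdit (v := ((1:ℝ), (0:ℝ))) (by simp) a.1 h1
  have := (h4 0 x).trans (h2 _ x)
  rw [norm_iteratedFDeriv_zero, zero_add] at this
  exact this

lemma sup01_le {g : R2 → ℝ} {ε : ℝ} (hε : 0 ≤ ε) (h : ∀ x, |g x| ≤ ε) : sup01 g ≤ ε :=
  Real.iSup_le (fun x => Real.iSup_le (fun _ => h x) hε) hε

lemma sup01_nonneg (g : R2 → ℝ) : 0 ≤ sup01 g :=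
  Real.iSup_nonneg fun _ => Real.iSup_nonneg fun _ => abs_nonneg _

lemma inf_le {g : R2 → ℝ} {ε : ℝ} (hε : 0 ≤ ε) (h : ∀ x, |g x| ≤ ε) :
    (⨅ p : ℤ, sup01 fun x => g x + (p : ℝ)) ≤ ε :=
  (ciInf_le ⟨0, by rintro _ ⟨p, rfl⟩; exact sup01_nonneg _⟩ 0).trans (sup01_le hε (by simpa using h))

lemma dtk_le {F f : R2 → R2} (sF : Sm F) (sf : Sm f) {k : ℕ} {ε : ℝ} (hε : 0 ≤ ε)
    (h : ∀ i ≤ k, ∀ x, ‖iD i (fun y => f y - F y) x‖ ≤ ε) : dtk k F f ≤ ε := by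
  have sd : Sm (fun y => F y - f y) := sF.sub sf
  have h' : ∀ i ≤ k, ∀ x, ‖iD i (fun y => F y - f y) x‖ ≤ ε := by
    intro i hi x
    have e : (fun y => F y - f y) = -(fun y => f y - F y) := by funext y; simp
    rw [iD, e, iteratedFDeriv_neg_apply, norm_neg]
    exact h i hi x
  have c1 : ∀ i ≤ k, ∀ x, ‖iteratedFDeriv ℝ i (fun y => (F y).1 - (f y).1) x‖ ≤ ε := by
    intro i hi x
    have := ContinuousLinearMap.norm_iteratedFDeriv_comp_left (ContinuousLinearMap.fst ℝ ℝ ℝ) (x := x) (n := i) sd.contDiffAt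
      (by exact_mod_cast le_top)
    refine this.trans ((mul_le_of_le_one_left (norm_nonneg _) (ContinuousLinearMap.norm_fst_le ..)).trans (h' i hi x))
  have c2 : ∀ i ≤ k, ∀ x, ‖iteratedFDeriv ℝ i (fun y => (F y).2 - (f y).2) x‖ ≤ ε := by
    intro i hi x
    have := ContinuousLinearMap.norm_iteratedFDeriv_comp_left (ContinuousLinearMap.snd ℝ ℝ ℝ) (x := x) (n := i) sd.contDiffAt
      (by exact_mod_cast le_top)
    refine this.trans ((mul_le_of_le_one_left (norm_nonneg _) (ContinuousLinearMap.norm_snd_le ..)).trans (h' i hi x))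
  unfold dtk
  refine Finset.sup'_le _ _ fun a ha => ?_
  have hak : a.1 + a.2 ≤ k := (Finset.mem_filter.1 ha).2
  split_ifs
  · refine max_le (inf_le hε fun x => ?_) (inf_le hε fun x => ?_)
    · have := c1 0 (by omega) x
      rwa [norm_iteratedFDeriv_zero] at this
    · have := c2 0 (by omega) x
      rwa [norm_iteratedFDeriv_zero] at this
  · exact max_le (sup01_le hε fun x => (pdm_le sd.fst a x).trans (c1 _ hak x))
      (sup01_le hε fun x => (pdm_le sd.snd a x).trans (c2 _ hak x))

lemma dk_final {H : ℕ → SL} {f : SL} {α : ℝ} (h1 : Cl (fun k => ((H (k + 1)).conj α).F) f.F)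
    (h2 : Cl (fun k => ((H (k + 1)).conj α).G) f.G) (k : ℕ) (δ : ℝ) (hδ : 0 < δ) : ∃ h : STD,
        dkDist k (h.lift ∘ rotL α ∘ h.liftInv) (h.lift ∘ rotL (-α) ∘ h.liftInv)
                 f.toSTD.lift f.toSTD.liftInv < δ := by
  obtain ⟨n, hn, hk⟩ := ((half_lim.eventually_lt_const hδ).and (eventually_ge_atTop k)).exists
  refine ⟨(H (n + 1)).toSTD, lt_of_le_of_lt (max_le ?_ ?_) hn⟩
  · exact dtk_le ((H (n + 1)).conj α).sF f.sF (by positivity) fun i hi x => h1 n i (by omega) x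
  · exact dtk_le ((H (n + 1)).conj α).sG f.sG (by positivity) fun i hi x => h2 n i (by omega) x

end

noncomputable section
open MeasureTheory Filter Set

lemma L1diff {h : XX → ℝ} (hm : Measurable h) (hi : Integrable h mm) {ε : ℝ}
    (hA : ∀ A, MeasurableSet A → |∫ y in A, h y ∂mm| ≤ ε) : ∫ y, ‖h y‖ ∂mm ≤ 2 * ε := by
  set A := {y | 0 ≤ h y} with hAd
  have mA : MeasurableSet A := measurableSet_le measurable_const hm
  rw [← integral_add_compl mA hi.norm]
  have e1 : ∫ y in A, ‖h y‖ ∂mm = ∫ y in A, h y ∂mm :=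
    setIntegral_congr_fun mA fun y hy => Real.norm_of_nonneg hy
  have e2 : ∫ y in Aᶜ, ‖h y‖ ∂mm = -∫ y in Aᶜ, h y ∂mm := by
    rw [← integral_neg]
    exact setIntegral_congr_fun mA.compl fun y hy => Real.norm_of_nonpos (le_of_lt (not_le.1 hy))
  rw [e1, e2]
  have h1 := (le_abs_self _).trans (hA A mA)
  have h2 := (neg_le_abs _).trans (hA Aᶜ mA.compl)
  linarith

/-- Limit density. -/
lemma limDens {ν : ℕ → Measure XX} [∀ n, IsProbabilityMeasure (ν n)] (hac : ∀ n, ν n ≪ mm)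
    (hd : ∀ n A, MeasurableSet A → |(ν (n + 1)).real A - (ν n).real A| ≤ (1 / 2 : ℝ) ^ n) :
    ∃ g : XX → ℝ, Measurable g ∧ (∀ y, 0 ≤ g y) ∧ Integrable g mm ∧
      ∀ n, ∫ y, ‖g y - ((ν n).rnDeriv mm y).toReal‖ ∂mm ≤ 4 * (1 / 2 : ℝ) ^ n := by
  set ρ : ℕ → XX → ℝ := fun n y => ((ν n).rnDeriv mm y).toReal with hρ
  have ρm : ∀ n, Measurable (ρ n) := fun n => (Measure.measurable_rnDeriv _ _).ennreal_toReal
  have ρi : ∀ n, Integrable (ρ n) mm := fun n => Measure.integrable_toReal_rnDeriv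
  have d1 : ∀ n, ∫ y, ‖ρ (n + 1) y - ρ n y‖ ∂mm ≤ 2 * (1 / 2 : ℝ) ^ n := by
    intro n
    refine L1diff ((ρm _).sub (ρm _)) ((ρi _).sub (ρi _)) fun A hA => ?_
    simp only [Pi.sub_apply]
    rw [integral_sub (ρi _).integrableOn (ρi _).integrableOn, Measure.setIntegral_toReal_rnDeriv (hac _),
      Measure.setIntegral_toReal_rnDeriv (hac _)]
    exact hd n A hA
  set R : ℕ → Lp ℝ 1 mm := fun n => (ρi n).toL1 (ρ n) with hR
  have d2 : ∀ n, dist (R n) (R (n + 1)) ≤ 2 * (1 / 2 : ℝ) ^ n := by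
    intro n
    rw [dist_comm, dist_eq_norm, hR]
    simp only
    rw [← Integrable.toL1_sub, L1.norm_of_fun_eq_integral_norm]
    exact d1 n
  obtain ⟨G, hG⟩ := cauchySeq_tendsto_of_complete (cauchySeq_of_le_geometric _ _ (by norm_num) d2)
  have d3 := dist_le_of_le_geometric_of_tendsto _ _ (by norm_num) d2 hG
  have sG := (Lp.aestronglyMeasurable G)
  set g0 := sG.mk G with hg0
  have g0m : Measurable g0 := sG.stronglyMeasurable_mk.measurable
  have g0i : Integrable g0 mm := (L1.integrable_coeFn G).congr sG.ae_eq_mk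
  refine ⟨fun y => max (g0 y) 0, g0m.max measurable_const, fun y => le_max_right _ _, g0i.pos_part, fun n => ?_⟩
  have d4 : ∫ y, ‖g0 y - ρ n y‖ ∂mm ≤ 4 * (1 / 2 : ℝ) ^ n := by
    have e : G = g0i.toL1 g0 := by
      rw [← Integrable.toL1_coeFn G (L1.integrable_coeFn G)]
      exact (Integrable.toL1_eq_toL1_iff _ _ _ _).2 sG.ae_eq_mk
    have := d3 n
    rw [dist_comm, dist_eq_norm, e, hR] at this
    simp only at this
    rw [← Integrable.toL1_sub, L1.norm_of_fun_eq_integral_norm] at this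
    refine le_trans (le_of_eq rfl) (this.trans (le_of_eq (by ring)))
  refine le_trans (integral_mono_of_nonneg (Eventually.of_forall fun _ => norm_nonneg _)
    (g0i.sub (ρi n)).norm (Eventually.of_forall fun y => ?_)) d4
  simp only [Real.norm_eq_abs, Pi.sub_apply]
  have h0 : 0 ≤ ρ n y := ENNReal.toReal_nonneg
  have := abs_max_sub_max_le_abs (g0 y) (ρ n y) 0
  rwa [max_eq_left h0] at this

/-- The limit measure. -/
lemma limMeas {ν : ℕ → Measure XX} [∀ n, IsProbabilityMeasure (ν n)] (hac : ∀ n, ν n ≪ mm)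
    (hd : ∀ n A, MeasurableSet A → |(ν (n + 1)).real A - (ν n).real A| ≤ (1 / 2 : ℝ) ^ n) :
    ∃ g : XX → ENNReal, Measurable g ∧ IsProbabilityMeasure (mm.withDensity g) ∧
      (∀ n (f : XX → ℂ), Measurable f → (∀ y, ‖f y‖ ≤ 1) →
        ‖∫ y, f y ∂(mm.withDensity g) - ∫ y, f y ∂(ν n)‖ ≤ 4 * (1 / 2 : ℝ) ^ n) ∧
      (∀ A, MeasurableSet A → Tendsto (fun n => (ν n).real A) atTop (nhds ((mm.withDensity g).real A))) := by
  obtain ⟨g, gm, g0, gi, hg⟩ := limDens hac hd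
  have ρi : ∀ n, Integrable (fun y => ((ν n).rnDeriv mm y).toReal) mm := fun n => Measure.integrable_toReal_rnDeriv
  set G : XX → ENNReal := fun y => ENNReal.ofReal (g y) with hG
  have Gm : Measurable G := gm.ennreal_ofReal
  have hreal : ∀ A, MeasurableSet A → mm.withDensity G A = ENNReal.ofReal (∫ y in A, g y ∂mm) := by
    intro A hA
    rw [withDensity_apply _ hA, ofReal_integral_eq_lintegral_ofReal gi.integrableOn (Eventually.of_forall g0)]
  have hreal' : ∀ A, MeasurableSet A → (mm.withDensity G).real A = ∫ y in A, g y ∂mm := by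
    intro A hA
    rw [measureReal_def, hreal A hA, ENNReal.toReal_ofReal (integral_nonneg g0)]
  have lim : ∀ A, MeasurableSet A → Tendsto (fun n => (ν n).real A) atTop (nhds ((mm.withDensity G).real A)) := by
    intro A hA
    rw [hreal' A hA, tendsto_iff_norm_sub_tendsto_zero]
    have l4 : Tendsto (fun n : ℕ => 4 * (1 / 2 : ℝ) ^ n) atTop (nhds 0) := by
      have := half_lim.const_mul 2
      rw [mul_zero] at this
      exact this.congr fun n => by ring
    refine squeeze_zero (fun _ => norm_nonneg _) (fun n => ?_) l4
    refine le_trans ?_ (hg n)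
    rw [← Measure.setIntegral_toReal_rnDeriv (hac n), ← integral_sub (ρi n).integrableOn gi.integrableOn]
    refine (norm_integral_le_integral_norm _).trans ?_
    simp only [norm_sub_rev (g _)]
    exact setIntegral_le_integral ((ρi n).sub gi).norm (Eventually.of_forall fun _ => norm_nonneg _)
  have hp : IsProbabilityMeasure (mm.withDensity G) := by
    constructor
    have h1 := lim univ MeasurableSet.univ
    simp only [probReal_univ] at h1
    have h2 := tendsto_nhds_unique h1 tendsto_const_nhds
    rw [measureReal_def] at h2
    rwa [ENNReal.toReal_eq_one_iff] at h2
  refine ⟨G, Gm, hp, ?_, lim⟩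
  intro n f fm fb
  rw [integral_withDensity_eq_integral_toReal_smul Gm (Eventually.of_forall fun y => ENNReal.ofReal_lt_top),
    ← integral_rnDeriv_smul (hac n)]
  have giG : Integrable (fun y => (G y).toReal) mm := by simpa [hG, ENNReal.toReal_ofReal (g0 _)] using gi
  have i1 : Integrable (fun y => (G y).toReal • f y) mm :=
    Integrable.smul_bdd giG 1 fm.aestronglyMeasurable
      (Eventually.of_forall fb)
  have i2 : Integrable (fun y => ((ν n).rnDeriv mm y).toReal • f y) mm :=
    Integrable.smul_bdd (ρi n) 1 fm.aestronglyMeasurable (Eventually.of_forall fb)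
  rw [← integral_sub i1 i2]
  refine (norm_integral_le_of_norm_le (gi.sub (ρi n)).norm (Eventually.of_forall fun y => ?_)).trans (hg n)
  rw [← sub_smul, norm_smul]
  simp only [hG, ENNReal.toReal_ofReal (g0 _), Pi.sub_apply]
  exact mul_le_of_le_one_right (norm_nonneg _) (fb y)

end

noncomputable section
open MeasureTheory Filter Set

lemma marg {g : XX → ENNReal} (gm : Measurable g)
    (h1 : (mm.withDensity g).map Prod.fst = (volume : Measure T2)) :
    MarginalMuAbsCtsFibers (mm.withDensity g) := by
  have key : ∀ (A : Set T2) (B : Set PP), MeasurableSet A → MeasurableSet B →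
      mm.withDensity g (A ×ˢ B) = ∫⁻ x in A, (lam.withDensity fun p => g (x, p)) B ∂(volume : Measure T2) := by
    intro A B hA hB
    rw [withDensity_apply _ (hA.prod hB)]
    unfold mm
    rw [← Measure.prod_restrict, lintegral_prod _ gm.aemeasurable]
    refine lintegral_congr fun x => ?_
    rw [withDensity_apply _ hB]
  have km : Measurable fun x : T2 => (lam.withDensity fun p => g (x, p)) univ := by
    simp only [withDensity_apply _ MeasurableSet.univ, Measure.restrict_univ]
    exact gm.lintegral_prod_right'
  have ae1 : (fun x : T2 => (lam.withDensity fun p => g (x, p)) univ) =ᵐ[volume] fun _ => 1 := by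
    refine ae_eq_of_forall_setLIntegral_eq_of_sigmaFinite km measurable_const fun A hA _ => ?_
    rw [← key A univ hA MeasurableSet.univ, setLIntegral_one, ← h1, Measure.map_apply measurable_fst hA]
    congr 1
    ext y; simp
  classical
  refine ⟨h1, fun x => if (lam.withDensity fun p => g (x, p)) univ = 1 then lam.withDensity fun p => g (x, p)
    else lam, ?_, ?_, ?_⟩
  · intro x
    dsimp only
    split_ifs with h
    · exact ⟨h⟩
    · infer_instance
  · intro A B hA hB
    rw [key A B hA hB]
    refine lintegral_congr_ae (ae_restrict_of_ae ?_)
    filter_upwards [ae1] with x hx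
    rw [if_pos hx]
  · refine Eventually.of_forall fun x => ?_
    dsimp only
    split_ifs with h
    · exact (withDensity_absolutelyContinuous _ _).trans lam_ac
    · exact lam_ac

lemma int_id {ν : Measure XX} [IsFiniteMeasure ν] (f : C(XX, ℂ)) : Integrable (fun y => f y) ν :=
  int_cm measurable_id f

/-- Invariance from integrals of the basic functions. -/
lemma invE {ν : Measure XX} [IsProbabilityMeasure ν] {u : XX → XX} (hu : Continuous u)
    (h : ∀ a, ∫ y, EE a (u y) ∂ν = ∫ y, EE a y ∂ν) : MeasurePreserving u ν ν := by
  have all : ∀ f : C(XX, ℂ), ∫ y, f (u y) ∂ν = ∫ y, f y ∂ν := by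
    refine span_ind h ?_ ?_ ?_
    · intro f f' h1 h2
      simp only [ContinuousMap.add_apply]
      rw [integral_add (int_cm hu.measurable f) (int_cm hu.measurable f'), h1, h2]
      exact (integral_add (int_id f) (int_id f')).symm
    · intro c f h1
      simp only [ContinuousMap.smul_apply, smul_eq_mul]
      rw [integral_const_mul, integral_const_mul, h1]
    · intro f hf
      rw [← sub_eq_zero, ← norm_le_zero_iff]
      refine le_of_forall_pos_le_add fun ε hε => ?_
      obtain ⟨f', h1, h2⟩ := hf (ε / 2) (by positivity)
      have e1 : ∫ y, f (u y) ∂ν - ∫ y, f y ∂ν = ∫ y, (f - f') (u y) ∂ν - ∫ y, (f - f') y ∂ν := by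
        simp only [ContinuousMap.sub_apply]
        rw [integral_sub (int_cm hu.measurable f) (int_cm hu.measurable f'), h1,
          integral_sub (int_id f) (int_id f')]
        simp
      rw [e1]
      refine (norm_sub_le _ _).trans ?_
      have n1 : ‖∫ y, (f - f') (u y) ∂ν‖ ≤ ‖f - f'‖ := norm_int_le fun y => (f - f').norm_coe_le_norm _
      have n2 : ‖∫ y, (f - f') y ∂ν‖ ≤ ‖f - f'‖ := norm_int_le fun y => (f - f').norm_coe_le_norm _
      linarith
  refine ⟨hu.measurable, ?_⟩
  have : IsProbabilityMeasure (ν.map u) := Measure.isProbabilityMeasure_map hu.measurable.aemeasurable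
  refine ext_of_forall_integral_eq_of_IsFiniteMeasure fun f => ?_
  rw [integral_map hu.measurable.aemeasurable f.continuous.measurable.aestronglyMeasurable]
  have := all ⟨fun y => (f y : ℂ), Complex.continuous_ofReal.comp f.continuous⟩
  simp only [ContinuousMap.coe_mk] at this
  rw [integral_complex_ofReal, integral_complex_ofReal] at this
  exact_mod_cast this

lemma approxC {ν : Measure XX} [IsProbabilityMeasure ν] {A : Set XX} (hA : MeasurableSet A) {δ : ℝ} (hδ : 0 < δ) :
    ∃ f : C(XX, ℂ), ∫ y, ‖A.indicator (fun _ => (1:ℂ)) y - f y‖ ∂ν ≤ δ := by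
  have hi : Integrable (A.indicator (fun _ => (1:ℂ))) ν := (integrable_const _).indicator hA
  obtain ⟨f, hf, -⟩ := hi.exists_boundedContinuous_integral_sub_le hδ
  exact ⟨f.toContinuousMap, hf⟩

lemma mixAB {ν : Measure XX} [IsProbabilityMeasure ν] {u : ℕ → XX → XX} (hu : ∀ n, MeasurePreserving (u n) ν ν)
    (h : ∀ a a', Tendsto (fun n => Dc ν (u n) id (EE a) (EE a')) atTop (nhds 0)) {A B : Set XX}
    (hA : MeasurableSet A) (hB : MeasurableSet B) :
    Tendsto (fun n => ν (B ∩ (u n) ⁻¹' A)) atTop (nhds (ν A * ν B)) := by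
  have lim := Dc_lim (ν := fun _ => ν) (w := fun _ => id) (fun n => (hu n).measurable) (fun _ => measurable_id) h
  set IA : XX → ℂ := A.indicator fun _ => (1:ℂ) with hIA
  set IB : XX → ℂ := B.indicator fun _ => (1:ℂ) with hIB
  have mIA : Measurable IA := measurable_const.indicator hA
  have mIB : Measurable IB := measurable_const.indicator hB
  have bA : ∀ y, ‖IA y‖ ≤ 1 := fun y => by rw [hIA, indicator]; split_ifs <;> simp
  have bB : ∀ y, ‖IB y‖ ≤ 1 := fun y => by rw [hIB, indicator]; split_ifs <;> simp
  have iA : Integrable IA ν := (integrable_const _).indicator hA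
  have iB : Integrable IB ν := (integrable_const _).indicator hB
  rw [← ENNReal.tendsto_toReal_iff (fun n => measure_ne_top _ _) (ENNReal.mul_ne_top (measure_ne_top _ _) (measure_ne_top _ _)),
    ENNReal.toReal_mul]
  have eA : ∫ y, IA y ∂ν = ((ν A).toReal : ℂ) := by
    rw [hIA, integral_indicator hA]; simp [measureReal_def]
  have eB : ∫ y, IB y ∂ν = ((ν B).toReal : ℂ) := by
    rw [hIB, integral_indicator hB]; simp [measureReal_def]
  have eX : ∀ n, ∫ y, IA (u n y) * IB y ∂ν = ((ν (B ∩ (u n) ⁻¹' A)).toReal : ℂ) := by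
    intro n
    have m : MeasurableSet (B ∩ (u n) ⁻¹' A) := hB.inter ((hu n).measurable hA)
    have e : (fun y => IA (u n y) * IB y) = (B ∩ (u n) ⁻¹' A).indicator fun _ => (1:ℂ) := by
      funext y
      by_cases h1 : u n y ∈ A <;> by_cases h2 : y ∈ B <;> simp [hIA, hIB, h1, h2]
    rw [e, integral_indicator m]; simp [measureReal_def]
  rw [Metric.tendsto_atTop]
  intro ε hε
  obtain ⟨f, hf⟩ := approxC (ν := ν) hA (show 0 < ε / 8 by positivity)
  obtain ⟨g, hg⟩ := approxC (ν := ν) hB (show 0 < ε / (8 * (1 + ‖f‖)) by positivity)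
  have hfg : ‖f‖ * (ε / (8 * (1 + ‖f‖))) ≤ ε / 8 := by
    rw [mul_div_assoc', div_le_div_iff₀ (by positivity) (by norm_num)]
    nlinarith [norm_nonneg f]
  set δ' := ε / (8 * (1 + ‖f‖))
  obtain ⟨N, hN⟩ := Metric.tendsto_atTop.1 (lim f g) (ε / 4) (by positivity)
  refine ⟨N, fun n hn => ?_⟩
  have h0 := hN n hn
  rw [dist_zero_right] at h0
  have inv : ∀ φ : XX → ℝ, Measurable φ → ∫ y, φ (u n y) ∂ν = ∫ y, φ y ∂ν := fun φ hφ => by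
    conv_rhs => rw [← (hu n).map_eq]
    exact (integral_map (hu n).measurable.aemeasurable hφ.aestronglyMeasurable).symm
  have iDA : Integrable (fun y => ‖IA y - f y‖) ν := (iA.sub (int_id f)).norm
  have iDB : Integrable (fun y => ‖IB y - g y‖) ν := (iB.sub (int_id g)).norm
  have mDA : Measurable (fun y => ‖IA y - f y‖) := (mIA.sub f.continuous.measurable).norm
  have iDA' : Integrable (fun y => ‖IA (u n y) - f (u n y)‖) ν := (hu n).integrable_comp_of_integrable iDA
  have iAu : Integrable (fun y => IA (u n y)) ν := (hu n).integrable_comp_of_integrable iA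
  have iX : Integrable (fun y => IA (u n y) * IB y) ν := iAu.mul_bdd (c := 1) mIB.aestronglyMeasurable (Eventually.of_forall bB)
  have s1 : ‖∫ y, IA (u n y) * IB y ∂ν - ∫ y, f (u n y) * g (id y) ∂ν‖ ≤ ε / 4 := by
    rw [← integral_sub iX (int_cm2 (hu n).measurable measurable_id f g)]
    refine (norm_integral_le_of_norm_le (iDA'.add (iDB.const_mul ‖f‖)) (Eventually.of_forall fun y => ?_)).trans ?_
    · have e : IA (u n y) * IB y - f (u n y) * g (id y) = (IA (u n y) - f (u n y)) * IB y + f (u n y) * (IB y - g y) := by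
        simp only [id]; ring
      rw [e]
      refine (norm_add_le _ _).trans ?_
      rw [norm_mul, norm_mul]
      exact add_le_add (mul_le_of_le_one_right (norm_nonneg _) (bB y))
        (mul_le_mul_of_nonneg_right (f.norm_coe_le_norm _) (norm_nonneg _))
    · simp only [Pi.add_apply]
      rw [integral_add iDA' (iDB.const_mul ‖f‖), integral_const_mul, inv _ mDA]
      have := mul_le_mul_of_nonneg_left hg (norm_nonneg f)
      linarith
  have s2 : ‖(∫ y, f (u n y) ∂ν) * (∫ y, g (id y) ∂ν) - (∫ y, IA y ∂ν) * ∫ y, IB y ∂ν‖ ≤ ε / 4 := by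
    have e1 : ∫ y, f (u n y) ∂ν = ∫ y, f y ∂ν := by
      conv_rhs => rw [← (hu n).map_eq]
      exact (integral_map (hu n).measurable.aemeasurable f.continuous.measurable.aestronglyMeasurable).symm
    have e2 : ‖∫ y, IA y ∂ν - ∫ y, f y ∂ν‖ ≤ ε / 8 := by
      rw [← integral_sub iA (int_id f)]
      exact (norm_integral_le_integral_norm _).trans hf
    have e3 : ‖∫ y, IB y ∂ν - ∫ y, g y ∂ν‖ ≤ δ' := by
      rw [← integral_sub iB (int_id g)]
      exact (norm_integral_le_integral_norm _).trans hg
    have e4 : ‖∫ y, f y ∂ν‖ ≤ ‖f‖ := norm_int_le fun y => f.norm_coe_le_norm _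
    have e5 : ‖∫ y, IB y ∂ν‖ ≤ 1 := norm_int_le bB
    rw [e1]
    simp only [id]
    have e : (∫ y, f y ∂ν) * (∫ y, g y ∂ν) - (∫ y, IA y ∂ν) * ∫ y, IB y ∂ν =
      -((∫ y, IA y ∂ν - ∫ y, f y ∂ν) * (∫ y, IB y ∂ν) + (∫ y, f y ∂ν) * (∫ y, IB y ∂ν - ∫ y, g y ∂ν)) := by ring
    rw [e, norm_neg]
    refine (norm_add_le _ _).trans ?_
    rw [norm_mul, norm_mul]
    have := mul_le_mul e2 e5 (norm_nonneg _) (by positivity)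
    have := mul_le_mul e4 e3 (norm_nonneg _) (norm_nonneg _)
    linarith
  have tot : ‖∫ y, IA (u n y) * IB y ∂ν - (∫ y, IA y ∂ν) * ∫ y, IB y ∂ν‖ < ε := by
    have e : ∫ y, IA (u n y) * IB y ∂ν - (∫ y, IA y ∂ν) * ∫ y, IB y ∂ν =
      (∫ y, IA (u n y) * IB y ∂ν - ∫ y, f (u n y) * g (id y) ∂ν) + Dc ν (u n) id f g +
      ((∫ y, f (u n y) ∂ν) * (∫ y, g (id y) ∂ν) - (∫ y, IA y ∂ν) * ∫ y, IB y ∂ν) := by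
      unfold Dc; ring
    rw [e]
    refine (norm_add₃_le).trans_lt ?_
    linarith
  rw [eX, eA, eB] at tot
  rw [dist_eq_norm, ← Complex.norm_real]
  push_cast
  exact tot

end

noncomputable section
open MeasureTheory Filter Set

lemma cmpI {ν ν' : Measure XX} [IsProbabilityMeasure ν] [IsProbabilityMeasure ν'] {s t : ℝ}
    (h : ∀ f : XX → ℂ, Measurable f → (∀ y, ‖f y‖ ≤ 1) → ‖∫ y, f y ∂ν - ∫ y, f y ∂ν'‖ ≤ s)
    {f f' : XX → ℂ} (mf : Measurable f) (mf' : Measurable f') (bf : ∀ y, ‖f y‖ ≤ 1) (bf' : ∀ y, ‖f' y‖ ≤ 1)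
    (hd : ∀ y, ‖f' y - f y‖ ≤ t) : ‖∫ y, f y ∂ν - ∫ y, f' y ∂ν'‖ ≤ s + t := by
  have i1 : Integrable f ν' := Integrable.of_bound mf.aestronglyMeasurable 1 (Eventually.of_forall bf)
  have i2 : Integrable f' ν' := Integrable.of_bound mf'.aestronglyMeasurable 1 (Eventually.of_forall bf')
  have h2 : ‖∫ y, f' y ∂ν' - ∫ y, f y ∂ν'‖ ≤ t := by
    rw [← integral_sub i2 i1]; exact norm_int_le hd
  have e : ∫ y, f y ∂ν - ∫ y, f' y ∂ν' = (∫ y, f y ∂ν - ∫ y, f y ∂ν') - (∫ y, f' y ∂ν' - ∫ y, f y ∂ν') := by ring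
  rw [e]
  exact (norm_sub_le _ _).trans (add_le_add (h f mf bf) h2)

lemma half_lim' (c : ℝ) : Tendsto (fun n : ℕ => c * (1 / 2 : ℝ) ^ n) atTop (nhds 0) := by
  have := half_lim.const_mul (c / 2)
  rw [mul_zero] at this
  exact this.congr fun n => by ring

lemma prodDiff {x y x' y' : ℂ} {s t : ℝ} (hx : ‖x‖ ≤ 1) (hy' : ‖y'‖ ≤ 1) (h1 : ‖x - x'‖ ≤ s) (h2 : ‖y - y'‖ ≤ t) :
    ‖x * y - x' * y'‖ ≤ s + t := by
  have e : x * y - x' * y' = x * (y - y') + (x - x') * y' := by ring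
  rw [e]
  refine (norm_add_le _ _).trans ?_
  rw [norm_mul, norm_mul]
  nlinarith [norm_nonneg x, norm_nonneg y', norm_nonneg (y - y'), norm_nonneg (x - x')]

lemma finalE {α : ℝ} (hα : Liouville α) : ∃ (H : ℕ → SL) (f : SL) (ν : Measure XX),
    Cl (fun k => ((H (k + 1)).conj α).F) f.F ∧ Cl (fun k => ((H (k + 1)).conj α).G) f.G ∧
    IsProbabilityMeasure ν ∧ MarginalMuAbsCtsFibers ν ∧ MeasurePreserving f.ext ν ν ∧ WeakMixing ν f.ext := by
  obtain ⟨H, M, f, hM, Mm, c1, c2, hd, hmix, hcl⟩ := mainE hα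
  obtain ⟨g, gm, hp, hTV, hlim⟩ := limMeas (ν := fun n => (H n).nu) (fun n => (H n).nu_ac) hd
  set ν := mm.withDensity g with hν
  have mu : ∀ m : ℕ, Measurable (f.ext^[m]) := fun m => f.meas_ext.iterate m
  -- marginal
  have h1 : ν.map Prod.fst = (volume : Measure T2) := by
    have : IsProbabilityMeasure (ν.map Prod.fst) := Measure.isProbabilityMeasure_map measurable_fst.aemeasurable
    ext A hA
    rw [Measure.map_apply measurable_fst hA]
    have l := hlim (Prod.fst ⁻¹' A) (measurable_fst hA)
    have e : ∀ n, (H n).nu.real (Prod.fst ⁻¹' A) = (volume : Measure T2).real A := fun n => by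
      rw [measureReal_def, measureReal_def, ← (H n).nu_fst, Measure.map_apply measurable_fst hA]
    simp only [e] at l
    have := tendsto_nhds_unique l tendsto_const_nhds
    rwa [measureReal_def, measureReal_def, ENNReal.toReal_eq_toReal_iff' (measure_ne_top _ _) (measure_ne_top _ _)] at this
  -- invariance
  have hinv : MeasurePreserving f.ext ν ν := by
    refine invE f.continuous_ext fun a => ?_
    obtain ⟨K, hK⟩ := bx_big a
    have hb : ∀ᶠ n : ℕ in atTop, ‖∫ y, EE a (f.ext y) ∂ν - ∫ y, EE a y ∂ν‖ ≤ 10 * (1 / 2 : ℝ) ^ n := by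
      filter_upwards [eventually_ge_atTop K] with n hn
      have k1 := cmpI (t := 2 * (1 / 2 : ℝ) ^ n) (hTV n) (f := fun y => EE a (f.ext y)) (f' := fun y => EE a (((H n).conj α).ext y))
        ((mEE a).comp f.meas_ext) ((mEE a).comp (SL.meas_ext _)) (fun y => (EE_norm _ _).le)
        (fun y => (EE_norm _ _).le) (fun y => by
          have := hcl n 1 (by have := hM n; omega) a (hK n hn) y
          rw [Nat.cast_one, one_mul, Function.iterate_one] at this
          exact this)
      have k2 := hTV n (EE a) (mEE a) fun y => (EE_norm _ _).le
      have k3 : ∫ y, EE a (((H n).conj α).ext y) ∂(H n).nu = ∫ y, EE a y ∂(H n).nu := by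
        conv_rhs => rw [← ((H n).mp_conj α).map_eq]
        exact (integral_map (SL.meas_ext _).aemeasurable (mEE a).aestronglyMeasurable).symm
      rw [k3] at k1
      have e : ∫ y, EE a (f.ext y) ∂ν - ∫ y, EE a y ∂ν = (∫ y, EE a (f.ext y) ∂ν - ∫ y, EE a y ∂(H n).nu) -
        (∫ y, EE a y ∂ν - ∫ y, EE a y ∂(H n).nu) := by ring
      rw [e]
      refine (norm_sub_le _ _).trans ?_
      linarith
    have := ge_of_tendsto (half_lim' 10) hb
    exact sub_eq_zero.1 (norm_le_zero_iff.1 this)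
  refine ⟨H, f, ν, c1, c2, hp, marg gm h1, hinv, fun n => M (n + 1), fun a b h => Mm (by omega), ?_⟩
  intro A B hA hB
  refine mixAB (u := fun n => f.ext^[M (n + 1)]) (fun n => hinv.iterate _) (fun a a' => ?_) hA hB
  obtain ⟨K, hK⟩ := bx_big a
  obtain ⟨K', hK'⟩ := bx_big a'
  refine squeeze_zero_norm' (a := fun n : ℕ => 17 * (1 / 2 : ℝ) ^ n) ?_ (half_lim' 17)
  filter_upwards [eventually_ge_atTop K, eventually_ge_atTop K'] with n hn hn'
  set c := ((H (n + 1)).conj (M (n + 1) * α)).ext with hc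
  set u := f.ext^[M (n + 1)] with hu
  have mc : Measurable c := SL.meas_ext _
  have muu : Measurable u := mu _
  have hle : (1 / 2 : ℝ) ^ (n + 1) = (1 / 2) * (1 / 2 : ℝ) ^ n := by rw [pow_succ]; ring
  have hcu : ∀ y, ‖EE a (c y) - EE a (u y)‖ ≤ 2 * (1 / 2 : ℝ) ^ (n + 1) := fun y =>
    hcl (n + 1) _ le_rfl a (bx_mono (by omega) (hK n hn)) y
  have k0 := hmix n a a' (hK n hn) (hK' n hn')
  have k1 := cmpI (hTV (n + 1)) (f := fun y => EE a (u y)) (f' := fun y => EE a (c y))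
    ((mEE a).comp muu) ((mEE a).comp mc) (fun y => (EE_norm _ _).le) (fun y => (EE_norm _ _).le) hcu
  have k2 := hTV (n + 1) (fun y => EE a' (id y)) (mEE a') fun y => (EE_norm _ _).le
  have k3 := cmpI (hTV (n + 1)) (f := fun y => EE a (u y) * EE a' (id y)) (f' := fun y => EE a (c y) * EE a' (id y))
    (((mEE a).comp muu).mul (mEE a')) (((mEE a).comp mc).mul (mEE a'))
    (fun y => by rw [norm_mul, EE_norm, EE_norm, one_mul]) (fun y => by rw [norm_mul, EE_norm, EE_norm, one_mul])
    (fun y => by rw [← sub_mul, norm_mul, EE_norm, mul_one]; exact hcu y)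
  have n1 : ‖∫ y, EE a (u y) ∂ν‖ ≤ 1 := norm_int_le fun y => (EE_norm _ _).le
  have n2 : ‖∫ y, EE a' (id y) ∂(H (n + 1)).nu‖ ≤ 1 := norm_int_le fun y => (EE_norm _ _).le
  have k4 := prodDiff n1 n2 k1 k2
  have e : Dc ν u id (EE a) (EE a') = Dc (H (n + 1)).nu c id (EE a) (EE a') +
    (∫ y, EE a (u y) * EE a' (id y) ∂ν - ∫ y, EE a (c y) * EE a' (id y) ∂(H (n + 1)).nu) -
    ((∫ y, EE a (u y) ∂ν) * (∫ y, EE a' (id y) ∂ν) -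
      (∫ y, EE a (c y) ∂(H (n + 1)).nu) * ∫ y, EE a' (id y) ∂(H (n + 1)).nu) := by
    unfold Dc; ring
  rw [e]
  refine (norm_sub_le _ _).trans ((add_le_add_left (norm_add_le _ _) _).trans ?_)
  rw [hle] at k3 k4
  have : (0:ℝ) ≤ (1 / 2) ^ n := by positivity
  linarith

lemma base_wm {f : SL} {ν : Measure XX} (h1 : ν.map Prod.fst = (volume : Measure T2)) (h : WeakMixing ν f.ext) :
    WeakMixing (volume : Measure T2) f.map := by
  obtain ⟨s, hs, hm⟩ := h
  refine ⟨s, hs, fun A B hA hB => ?_⟩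
  have it : ∀ n y, (f.ext^[n] y).1 = f.map^[n] y.1 := by
    intro n
    induction n with
    | zero => intro y; rfl
    | succ n ih => intro y; rw [Function.iterate_succ_apply, ih, Function.iterate_succ_apply]; rfl
  have := hm _ _ (measurable_fst hA) (measurable_fst hB)
  rw [← Measure.map_apply measurable_fst hA, ← Measure.map_apply measurable_fst hB, h1] at this
  refine this.congr fun n => ?_
  have mA : MeasurableSet (B ∩ f.map^[s n] ⁻¹' A) :=
    hB.inter (f.continuous_map.measurable.iterate _ hA)
  rw [← h1, Measure.map_apply measurable_fst mA]
  congr 1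
  ext y
  simp [it]

end

/-- Theorem 1.1 for `T²`, quantitative version. For every Liouville
number `α` there are a smooth measure-preserving diffeomorphism `f` of `T²` and a Borel
probability measure `ν` on `T² × ℙ(ℝ²)` such that: `f` lies in the `C^∞`-closure of the
conjugates of `R_α`; `f` is weakly mixing w.r.t. `μ`; `ν` has marginal `μ` and
absolutely continuous fibers, is invariant under the projectivized derivative extension
`(f, df)`, and `(f, df)` is weakly mixing w.r.t. `ν`. -/
theorem statement0 (α : ℝ) (hα : Liouville α) :
    ∃ (f : STD) (ν : Measure (T2 × PP)) (Df : T2 × PP → T2 × PP),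
      IsProbabilityMeasure ν ∧
      (∀ (k : ℕ) (δ : ℝ), 0 < δ → ∃ h : STD,
        dkDist k (h.lift ∘ rotL α ∘ h.liftInv) (h.lift ∘ rotL (-α) ∘ h.liftInv)
                 f.lift f.liftInv < δ) ∧
      WeakMixing (volume : Measure T2) f.toFun ∧
      MarginalMuAbsCtsFibers ν ∧
      IsProjDerivExt f.lift f.toFun Df ∧
      MeasurePreserving Df ν ν ∧
      WeakMixing ν Df := by
  obtain ⟨H, f, ν, c1, c2, hp, hm, hinv, hw⟩ := finalE hα
  refine ⟨f.toSTD, ν, f.ext, hp, fun k δ hδ => dk_final c1 c2 k δ hδ, base_wm hm.1 hw, hm, ?_, hinv, hw⟩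
  intro a v hv hx
  have e : f.toSTD.toFun (pro a) = pro (f.F a) := f.map_pro a
  rw [e]
  exact f.ext_mk a v hv
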